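/- Let M be a closed orientable surface (a compact, connected, orientable topological 2-manifold without boundary) equipped with a metric d inducing its topology. Let Z ⊆ M be a compact connected subset and z ∈ Z, and for ε > 0 let Z_ε = {x ∈ M : d(x, Z) < ε} denote the open ε-neighborhood of Z. Then there exists ε₀ > 0 such that for all 0 < ε < ε₀ the images of the inclusion-induced homomorphisms i_* : π₁(Z_ε, z) → π₁(M, z) and i_* : π₁(Z_{ε₀}, z) → π₁(M, z) coincide. -/

import Mathlib

section
open Set Filter Topology Metric unitInterval
namespace S14

lemma exists_sqrt {E : Type*} [NormedAddCommGroup E] [NormedSpace ℝ E] (u : E → ℂ)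
    (hu : Continuous u) (h0 : ∀ x, u x ≠ 0) :
    ∃ s : E → ℂ, Continuous s ∧ ∀ x, s x ^ 2 = u x := by
  have h : IsSimplyConnected (univ : Set E) := by
    rw [IsSimplyConnected]
    have : ContractibleSpace (univ : Set E) :=
      (convex_univ (𝕜 := ℝ)).contractibleSpace ⟨0, trivial⟩
    infer_instance
  obtain ⟨f, hf, hf2⟩ := Complex.exists_continuousOn_pow_eq h isOpen_univ hu.continuousOn
    (by rintro ⟨x, -, hx⟩; exact h0 x hx) (n := 2) two_ne_zero
  exact ⟨f, continuousOn_univ.1 hf, hf2⟩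

lemma exists_sqrt_I (u : I → ℂ) (hu : Continuous u) (h0 : ∀ x, u x ≠ 0) :
    ∃ s : I → ℂ, Continuous s ∧ ∀ x, s x ^ 2 = u x := by
  obtain ⟨s, hs, hs2⟩ := exists_sqrt (fun x : ℝ => u (projIcc 0 1 zero_le_one x))
    (hu.comp continuous_projIcc) (fun x => h0 _)
  exact ⟨fun t => s t, hs.comp continuous_subtype_val, fun t => by simp [hs2]⟩

lemma exists_sqrt_II (u : I × I → ℂ) (hu : Continuous u) (h0 : ∀ x, u x ≠ 0) :
    ∃ s : I × I → ℂ, Continuous s ∧ ∀ x, s x ^ 2 = u x := by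
  obtain ⟨s, hs, hs2⟩ := exists_sqrt
    (fun x : ℝ × ℝ => u (projIcc 0 1 zero_le_one x.1, projIcc 0 1 zero_le_one x.2))
    (hu.comp (by fun_prop)) (fun x => h0 _)
  exact ⟨fun t => s (t.1, t.2), hs.comp (by fun_prop), fun t => by simp [hs2]⟩

/-- sign ratio of a continuous square root along a path -/
noncomputable def sr (f : I → ℂ) : ℂ :=
  open Classical in
  if h : ∃ s : I → ℂ, Continuous s ∧ ∀ t, s t ^ 2 = f t then h.choose 1 / h.choose 0 else 0

lemma sr_eq {f s : I → ℂ} (hs : Continuous s) (h : ∀ t, s t ^ 2 = f t) (h0 : ∀ t, f t ≠ 0) :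
    sr f = s 1 / s 0 := by
  have hex : ∃ s : I → ℂ, Continuous s ∧ ∀ t, s t ^ 2 = f t := ⟨s, hs, h⟩
  rw [sr, dif_pos hex]
  obtain ⟨hc, h2⟩ := hex.choose_spec
  rcases isPreconnected_univ.eq_or_eq_neg_of_sq_eq (f := hex.choose) (g := s) hc.continuousOn
    hs.continuousOn (fun t _ => by rw [Pi.pow_apply, Pi.pow_apply, h2, h])
    (fun {t} _ ht => h0 t (by rw [← h, ht]; simp)) with h' | h'
  · rw [h' (mem_univ 0), h' (mem_univ 1)]
  · rw [h' (mem_univ 0), h' (mem_univ 1)]; simp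

lemma sr_mul {f g : I → ℂ} (hf : Continuous f) (hg : Continuous g) (hf0 : ∀ t, f t ≠ 0)
    (hg0 : ∀ t, g t ≠ 0) : sr (fun t => f t * g t) = sr f * sr g := by
  obtain ⟨s, hs, hs2⟩ := exists_sqrt_I f hf hf0
  obtain ⟨r, hr, hr2⟩ := exists_sqrt_I g hg hg0
  rw [sr_eq hs hs2 hf0, sr_eq hr hr2 hg0, sr_eq (s := fun t => s t * r t) (by fun_prop)
    (fun t => by simp [mul_pow, hs2, hr2]) (fun t => mul_ne_zero (hf0 t) (hg0 t))]
  ring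

lemma sr_sq {f : I → ℂ} (hf : Continuous f) (hf0 : ∀ t, f t ≠ 0) :
    sr f ^ 2 = f 1 / f 0 := by
  obtain ⟨s, hs, hs2⟩ := exists_sqrt_I f hf hf0
  rw [sr_eq hs hs2 hf0, div_pow, hs2, hs2]

/-- square roots of nullhomotopic families -/
lemma sqrt_homotopy {X : Type*} [TopologicalSpace X] (u : X × I → ℂ) (hu : Continuous u)
    (h0 : ∀ x, u x ≠ 0) (h1 : ∀ x, u (x, 0) = 1) :
    ∃ S : X × I → ℂ, Continuous S ∧ (∀ x, S x ^ 2 = u x) ∧ ∀ x, S (x, 0) = 1 := by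
  have cov := Complex.isCoveringMap_exp
  let H : C(I × X, {x : ℂ // x ≠ 0}) :=
    ⟨fun p => ⟨u (p.2, p.1), h0 _⟩, by fun_prop⟩
  let f : C(X, ℂ) := ⟨fun _ => 0, by fun_prop⟩
  have hH : ∀ a, H (0, a) = ⟨Complex.exp (f a), Complex.exp_ne_zero _⟩ := fun a => by
    simp [H, f, h1]
  let L := cov.liftHomotopy H f hH
  refine ⟨fun p => Complex.exp (L (p.2, p.1) / 2), by fun_prop, fun p => ?_, fun x => ?_⟩
  · have := congr_fun (cov.liftHomotopy_lifts H f hH) (p.2, p.1)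
    have h2 := congrArg Subtype.val this
    simp only [Function.comp] at h2
    rw [← Complex.exp_nat_mul]
    refine Eq.trans ?_ h2
    congr 1
    push_cast; ring_nf; rfl
  · have : L (0, x) = f x := cov.liftHomotopy_zero H f hH x
    simp [this, f]

open Complex in
lemma descend (u : ℂ × ℂ → ℂ) (hu : ContinuousOn u {x | x.2 ≠ 0})
    (h0 : ∀ x : ℂ × ℂ, x.2 ≠ 0 → u x ≠ 0)
    (hp : ∀ S : ℂ × ℂ → ℂ, Continuous S → (∀ x, S x ^ 2 = u (x.1, exp x.2)) →
      ∀ c ζ, S (c, ζ + 2 * Real.pi * Complex.I) = S (c, ζ)) :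
    ∃ S : ℂ × ℂ → ℂ, ContinuousOn S {x | x.2 ≠ 0} ∧ ∀ x : ℂ × ℂ, x.2 ≠ 0 → S x ^ 2 = u x := by
  obtain ⟨S, hS, hS2⟩ := exists_sqrt (fun x : ℂ × ℂ => u (x.1, exp x.2))
    (hu.comp_continuous (by fun_prop) (fun x => exp_ne_zero _)) (fun x => h0 _ (exp_ne_zero _))
  have hper := hp S hS hS2
  have key : ∀ c ζ ξ, exp ζ = exp ξ → S (c, ζ) = S (c, ξ) := by
    intro c ζ ξ h
    obtain ⟨n, hn⟩ := exp_eq_exp_iff_exists_int.1 h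
    have hP : Function.Periodic (fun ζ => S (c, ζ)) (2 * Real.pi * Complex.I) := hper c
    have := hP.int_mul n ξ
    simpa [hn] using this
  refine ⟨fun x => S (x.1, log x.2), ?_, fun x hx => by rw [hS2]; simp [exp_log hx]⟩
  intro x hx
  apply ContinuousAt.continuousWithinAt
  by_cases hs : x.2 ∈ slitPlane
  · exact hS.continuousAt.comp (continuousAt_fst.prodMk
      (ContinuousAt.comp (continuousAt_clog hs) continuousAt_snd))
  · have hs' : -x.2 ∈ slitPlane := by
      rw [mem_slitPlane_iff] at hs ⊢
      simp only [neg_re, neg_im] at *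
      push Not at hs
      rcases lt_or_eq_of_le hs.1 with h | h
      · left; linarith
      · exact absurd (Complex.ext h hs.2) hx
    have : ContinuousAt (fun y : ℂ × ℂ => S (y.1, log (-y.2) + Real.pi * Complex.I)) x := by
      refine ContinuousAt.comp (f := fun y : ℂ × ℂ => (y.1, log (-y.2) + Real.pi * Complex.I))
        hS.continuousAt ?_
      exact continuousAt_fst.prodMk ((ContinuousAt.comp (f := fun y : ℂ × ℂ => -y.2)
        (continuousAt_clog hs') (by fun_prop)).add continuousAt_const)
    refine this.congr ?_
    have hne : ∀ᶠ y : ℂ × ℂ in 𝓝 x, y.2 ≠ 0 := continuousAt_snd.eventually_ne hx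
    filter_upwards [hne] with y hy
    apply key
    rw [exp_add, exp_log (neg_ne_zero.2 hy), exp_log hy]; simp

open Complex in
lemma exists_sqrt_swap (T : ℂ → ℂ) (hT : Continuous T) (hinj : Function.Injective T) :
    ∃ S : ℂ × ℂ → ℂ, ContinuousOn S {x | x.1 ≠ x.2} ∧
      ∀ x : ℂ × ℂ, x.1 ≠ x.2 → S x ^ 2 = (T x.1 - T x.2) * (x.1 - x.2) := by
  obtain ⟨S, hS, hS2⟩ := descend
    (fun x => (T (x.1 + x.2) - T (x.1 - x.2)) * (2 * x.2)) (by fun_prop)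
    (fun x hx => mul_ne_zero (sub_ne_zero.2 fun h => hx (by
      have := hinj h; linear_combination this / 2)) (by simpa using hx)) (by
    intro S hS h2 c ζ
    have hne : ∀ x : ℂ × ℂ, S x ≠ 0 := fun x h => by
      have := h2 x
      rw [h] at this
      rw [eq_comm, zero_pow two_ne_zero] at this
      rcases mul_eq_zero.1 this with h' | h'
      · have h3 := hinj (sub_eq_zero.1 h')
        have : exp x.2 = 0 := by simp only at h3; linear_combination h3 / 2
        exact exp_ne_zero _ this
      · simp [exp_ne_zero] at h'
    rcases isPreconnected_univ.eq_or_eq_neg_of_sq_eq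
      (f := fun x : ℂ × ℂ => S (x.1, x.2 + Real.pi * Complex.I)) (g := S)
      (by fun_prop) hS.continuousOn (fun x _ => by
        simp only [Pi.pow_apply, h2, exp_add, exp_pi_mul_I]; ring_nf)
      (fun {x} _ => hne x) with h' | h'
    · have h1 := h' (mem_univ (c, ζ)); have h3 := h' (mem_univ (c, ζ + Real.pi * Complex.I))
      simp only at h1 h3
      rw [← h1, ← h3]; congr 2; ring
    · have h1 := h' (mem_univ (c, ζ)); have h3 := h' (mem_univ (c, ζ + Real.pi * Complex.I))
      simp only [Pi.neg_apply] at h1 h3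
      rw [h1, neg_neg] at h3
      rw [← h3]; congr 2; ring)
  refine ⟨fun x => S ((x.1 + x.2) / 2, (x.1 - x.2) / 2), ?_, fun x hx => ?_⟩
  · exact hS.comp (by fun_prop) (fun x hx => by
      simpa [sub_eq_zero] using hx)
  · rw [hS2 _ (by simpa [sub_eq_zero] using hx)]
    simp only
    ring_nf

open Complex in
lemma planar_sqrt (u : ℂ → ℂ) (m : ℂ) (R : ℝ) (hu : ContinuousOn u {m}ᶜ)
    (h0 : ∀ x, x ≠ m → u x ≠ 0) (h1 : ∀ x, R < ‖x - m‖ → u x = 1) :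
    ∃ S : ℂ → ℂ, ContinuousOn S {m}ᶜ ∧ ∀ x, x ≠ m → S x ^ 2 = u x := by
  obtain ⟨S, hS, hS2⟩ := descend (fun x => u (m + x.2))
    (hu.comp (by fun_prop) (fun x hx => by simpa using hx))
    (fun x hx => h0 _ (by simpa using hx)) (by
    intro S hS h2 c ζ
    have hne : ∀ x : ℂ × ℂ, S x ≠ 0 := fun x h => by
      have := h2 x
      rw [h, eq_comm, zero_pow two_ne_zero] at this
      exact h0 _ (by simp [exp_ne_zero]) this
    rcases isPreconnected_univ.eq_or_eq_neg_of_sq_eq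
      (f := fun x : ℂ × ℂ => S (x.1, x.2 + 2 * Real.pi * Complex.I)) (g := S)
      (by fun_prop) hS.continuousOn (fun x _ => by
        simp only [Pi.pow_apply, h2, exp_add, exp_two_pi_mul_I]; ring_nf)
      (fun {x} _ => hne x) with h' | h'
    · exact h' (mem_univ (c, ζ))
    · exfalso
      let r : ℝ := Real.log (|R| + 1)
      have hr : Real.exp r = |R| + 1 := Real.exp_log (by positivity)
      rcases isPreconnected_univ.eq_or_eq_neg_of_sq_eq
        (f := fun y : ℝ => S (0, r + y * Complex.I)) (g := fun _ => 1)
        (by fun_prop) (by fun_prop) (fun y _ => by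
          simp only [Pi.pow_apply, h2]
          rw [h1]; · simp
          simp only [add_sub_cancel_left, norm_exp]
          simp [hr]
          have := le_abs_self R; linarith)
        (fun {x} _ => one_ne_zero) with h3 | h3
      all_goals
        have e1 := h3 (mem_univ 0); have e2 := h3 (mem_univ (2 * Real.pi))
        have e3 := h' (mem_univ (0, (r : ℂ)))
        simp at e1 e2 e3
        rw [e2, e1] at e3
        norm_num at e3)
  refine ⟨fun x => S (0, x - m), hS.comp (by fun_prop) (fun x hx => by
    simpa [sub_eq_zero] using hx), fun x hx => ?_⟩
  rw [hS2 _ (by simpa [sub_eq_zero] using hx)]; simp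

end S14
end

section
open Set Filter Topology Metric unitInterval
namespace S14

structure Disc (M : Type*) [TopologicalSpace M] where
  f : ℂ → M
  emb : IsOpenEmbedding f

section
variable {M : Type*} [TopologicalSpace M]

noncomputable def Disc.inv (j : Disc M) : M → ℂ := Function.invFun j.f

lemma Disc.cont (j : Disc M) : Continuous j.f := j.emb.continuous

lemma Disc.inv_f (j : Disc M) (w : ℂ) : j.inv (j.f w) = w :=
  Function.leftInverse_invFun j.emb.injective w

lemma Disc.f_inv (j : Disc M) {x : M} (hx : x ∈ range j.f) : j.f (j.inv x) = x :=
  Function.invFun_eq hx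

lemma Disc.isOpen (j : Disc M) : IsOpen (range j.f) := j.emb.isOpen_range

lemma Disc.cont_inv (j : Disc M) : ContinuousOn j.inv (range j.f) := by
  rintro _ ⟨w, rfl⟩
  apply ContinuousAt.continuousWithinAt
  rw [ContinuousAt, j.inv_f, ← j.emb.map_nhds_eq, tendsto_map'_iff]
  have : j.inv ∘ j.f = id := funext j.inv_f
  rw [this]; exact tendsto_id

lemma Disc.contAt_inv (j : Disc M) {x : M} (hx : x ∈ range j.f) : ContinuousAt j.inv x :=
  j.cont_inv.continuousAt (j.isOpen.mem_nhds hx)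

lemma Disc.homotopic (j : Disc M) {x y : M} (δ δ' : Path x y) (h : range δ ⊆ range j.f)
    (h' : range δ' ⊆ range j.f) : δ.Homotopic δ' := by
  have key : ∀ (d : Path x y) (hd : range d ⊆ range j.f),
      ((d.map' (j.cont_inv.mono hd)).map j.cont).cast
        (j.f_inv (hd d.source_mem_range)).symm (j.f_inv (hd d.target_mem_range)).symm = d := by
    intro d hd; ext t; simpa [Path.map'] using j.f_inv (hd ⟨t, rfl⟩)
  rw [← key δ h, ← key δ' h']
  exact ((SimplyConnectedSpace.paths_homotopic (δ.map' (j.cont_inv.mono h))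
    (δ'.map' (j.cont_inv.mono h'))).map ⟨j.f, j.cont⟩).pathCast _ _

def Rel (j : Disc M) (U : Set M) (x y : M) : Prop :=
  ∃ γ : Path x y, range γ ⊆ U ∧ ∃ δ : Path x y, range δ ⊆ range j.f ∧ γ.Homotopic δ

variable {j j' : Disc M} {U V : Set M} {x y w : M}

lemma Rel.mem_left (h : Rel j U x y) : x ∈ range j.f := by
  obtain ⟨-, -, δ, hδ, -⟩ := h; exact hδ δ.source_mem_range

lemma Rel.mem_right (h : Rel j U x y) : y ∈ range j.f := by
  obtain ⟨-, -, δ, hδ, -⟩ := h; exact hδ δ.target_mem_range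

lemma Rel.symm (h : Rel j U x y) : Rel j U y x := by
  obtain ⟨γ, hγ, δ, hδ, e⟩ := h
  exact ⟨γ.symm, by simpa using hγ, δ.symm, by simpa using hδ, e.symm₂⟩

lemma Rel.trans (h : Rel j U x y) (h' : Rel j U y w) : Rel j U x w := by
  obtain ⟨γ, hγ, δ, hδ, e⟩ := h
  obtain ⟨γ', hγ', δ', hδ', e'⟩ := h'
  exact ⟨γ.trans γ', by simp [Path.trans_range, hγ, hγ'], δ.trans δ',
    by simp [Path.trans_range, hδ, hδ'], e.hcomp e'⟩

lemma Rel.of_joinedIn (h : JoinedIn (U ∩ range j.f) x y) : Rel j U x y := by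
  have h1 : range h.somePath ⊆ U ∩ range j.f := by
    rintro _ ⟨t, rfl⟩; exact h.somePath_mem t
  exact ⟨h.somePath, fun p hp => (h1 hp).1, h.somePath, fun p hp => (h1 hp).2, .refl _⟩

lemma Rel.change (h : Rel j U x y) (hp : JoinedIn (range j.f ∩ range j'.f) x y) :
    Rel j' U x y := by
  obtain ⟨γ, hγ, δ, hδ, e⟩ := h
  have h1 : range hp.somePath ⊆ range j.f ∩ range j'.f := by
    rintro _ ⟨t, rfl⟩; exact hp.somePath_mem t
  exact ⟨γ, hγ, hp.somePath, fun p hp => (h1 hp).2,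
    e.trans (j.homotopic _ _ hδ fun p hp => (h1 hp).1)⟩

lemma Disc.joinedIn (j : Disc M) {A : Set ℂ} (hA : IsPathConnected A) {x y : M}
    (hx : x ∈ j.f '' A) (hy : y ∈ j.f '' A) : JoinedIn (j.f '' A) x y :=
  (hA.image j.cont).joinedIn x hx y hy

lemma Disc.joinedIn_range (j : Disc M) {x y : M}
    (hx : x ∈ range j.f) (hy : y ∈ range j.f) : JoinedIn (range j.f) x y := by
  rw [← image_univ] at *
  exact j.joinedIn isPathConnected_univ hx hy

lemma small_disc [ChartedSpace (EuclideanSpace ℝ (Fin 2)) M] (x : M) (W : Set M)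
    (hW : W ∈ 𝓝 x) : ∃ j : Disc M, j.f 0 = x ∧ range j.f ⊆ W := by
  let e := chartAt (EuclideanSpace ℝ (Fin 2)) x
  have hx : x ∈ e.source := mem_chart_source _ x
  have h1 : e.target ∩ e.symm ⁻¹' W ∈ 𝓝 (e x) :=
    inter_mem (e.open_target.mem_nhds (e.map_source hx))
      ((e.continuousAt_symm (e.map_source hx)).preimage_mem_nhds (by
        rwa [e.left_inv hx]))
  obtain ⟨r, hr, hb⟩ := Metric.mem_nhds_iff.1 h1
  let A : ℂ ≃L[ℝ] EuclideanSpace ℝ (Fin 2) := ContinuousLinearEquiv.ofFinrankEq (by simp)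
  let u := OpenPartialHomeomorph.univBall (e x) r
  let F := (A.toHomeomorph.toOpenPartialHomeomorph.trans u).trans e.symm
  have hmem : ∀ w, u w ∈ ball (e x) r := fun w => by
    rw [← OpenPartialHomeomorph.univBall_target (e x) hr]
    exact u.map_source (by simp [u])
  have hF : F.source = univ := by
    ext w
    simp only [F, OpenPartialHomeomorph.trans_source, mem_inter_iff, mem_preimage, mem_univ,
      iff_true]
    exact ⟨⟨by simp, by simp [u]⟩, (hb (hmem _)).1⟩
  refine ⟨⟨F, F.isOpenEmbedding hF⟩, ?_, ?_⟩
  · simp [F, u, e]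
  · rintro _ ⟨w, rfl⟩
    exact (hb (hmem _)).2

end

section
variable {M : Type*} [MetricSpace M]

def TT (Z : Set M) (ρ : ℝ) : Prop := ∀ x ∈ Z, ∀ y ∈ Z, ∀ δ : Path x y, range δ ⊆ ball x ρ →
  ∀ ε > 0, ∃ γ : Path x y, range γ ⊆ thickening ε Z ∧ δ.Homotopic γ

variable [ChartedSpace (EuclideanSpace ℝ (Fin 2)) M]

lemma unif_joined [CompactSpace M] {ρ : ℝ} (hρ : 0 < ρ) :
    ∃ ε₀ > 0, ∀ p q : M, dist p q < ε₀ → ∃ j : Disc M, p ∈ range j.f ∧ q ∈ range j.f ∧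
      range j.f ⊆ ball p ρ := by
  choose j hj0 hj using fun x : M => small_disc x (ball x (ρ / 2)) (ball_mem_nhds _ (by positivity))
  obtain ⟨ε₀, h0, h⟩ := lebesgue_number_lemma_of_metric (isCompact_univ (X := M))
    (fun x => (j x).isOpen) (fun x _ => mem_iUnion.2 ⟨x, 0, hj0 x⟩)
  refine ⟨ε₀, h0, fun p q hpq => ?_⟩
  obtain ⟨i, hi⟩ := h p trivial
  refine ⟨j i, hi (mem_ball_self h0), hi (by rwa [mem_ball']), fun y hy => ?_⟩
  have h1 := hj i hy
  have h2 := hj i (hi (mem_ball_self h0))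
  rw [mem_ball] at *
  linarith [dist_triangle_right y p i]

lemma final_of_TT [CompactSpace M] {Z : Set M} {ρ : ℝ} (hρ : 0 < ρ) (hT : TT Z ρ) {z : M}
    (hz : z ∈ Z) : ∃ ε₀ : ℝ, 0 < ε₀ ∧ ∀ ε : ℝ, 0 < ε → ε < ε₀ →
      ∀ γ : Path z z, Set.range γ ⊆ Metric.thickening ε₀ Z →
        ∃ γ' : Path z z, Set.range γ' ⊆ Metric.thickening ε Z ∧ γ.Homotopic γ' := by
  obtain ⟨ε₀, h0, h⟩ := unif_joined (M := M) (ρ := ρ / 4) (by positivity)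
  refine ⟨ε₀, h0, fun ε hε _ γ hγ => ?_⟩
  let P : I → I → Prop := fun s t => ∀ y ∈ Z, ∀ β : Path (γ s) y, range β ⊆ ball (γ s) (ρ / 4) →
    ∀ y' ∈ Z, ∀ β' : Path (γ t) y', range β' ⊆ ball (γ t) (ρ / 4) →
      ∃ γ' : Path y y', range γ' ⊆ thickening ε Z ∧
        ((β.symm.trans (γ.subpath s t)).trans β').Homotopic γ'
  have hloc : ∀ s t, range (γ.subpath s t) ⊆ ball (γ s) (ρ / 4) → P s t := by
    intro s t hst y hy β hβ y' hy' β' hβ'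
    obtain ⟨γ', h1, h2⟩ := hT y hy y' hy' ((β.symm.trans (γ.subpath s t)).trans β') (by
      have e1 := hβ β.target_mem_range
      have e2 := hst (γ.subpath s t).target_mem_range
      have key : ∀ v, dist v (γ s) < ρ / 2 → v ∈ ball y ρ := fun v hv => by
        rw [mem_ball] at *
        linarith [dist_triangle_right v y (γ s)]
      rw [Path.trans_range, Path.trans_range]
      rintro v ((hv | hv) | hv)
      · rw [Path.symm_range] at hv
        have := hβ hv
        rw [mem_ball] at this; exact key v (by linarith)
      · have := hst hv
        rw [mem_ball] at this; exact key v (by linarith)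
      · have := hβ' hv
        rw [mem_ball] at this e2; exact key v (by linarith [dist_triangle v (γ t) (γ s)])) ε hε
    exact ⟨γ', h1, h2⟩
  have hP : P 0 1 := by
    refine isPreconnected_univ.induction₂' P ?_ ?_ (mem_univ 0) (mem_univ 1)
    · intro t _
      rw [nhdsWithin_univ]
      obtain ⟨r, hr, hr2⟩ := Metric.continuousAt_iff.1 (γ.continuous.continuousAt (x := t)) (ρ / 8) (by positivity)
      have hb : ∀ s, dist s t < r → ∀ v ∈ uIcc s t, dist (γ v) (γ t) < ρ / 8 := fun s hs v hv =>
        hr2 (by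
          rw [Subtype.dist_eq, Real.dist_eq] at *
          have hv' : (v : ℝ) ∈ uIcc (s : ℝ) t := by
            rw [mem_uIcc] at hv ⊢
            exact hv
          rw [abs_sub_comm (v : ℝ)]
          exact (abs_sub_right_of_mem_uIcc hv').trans_lt (by rwa [abs_sub_comm]))
      filter_upwards [Metric.ball_mem_nhds t hr] with s hs
      constructor
      · apply hloc
        rw [Path.range_subpath]
        rintro _ ⟨v, hv, rfl⟩
        rw [uIcc_comm] at hv
        have := hb s hs v hv
        rw [mem_ball]; linarith
      · apply hloc
        rw [Path.range_subpath]
        rintro _ ⟨v, hv, rfl⟩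
        have h1 := hb s hs v hv
        have h2 := hb s hs s left_mem_uIcc
        rw [mem_ball]; linarith [dist_triangle_right (γ v) (γ s) (γ t)]
    · intro r s t _ _ _ hrs hst y hy β hβ y' hy' β' hβ'
      obtain ⟨q, hq, hq2⟩ := mem_thickening_iff.1 (hγ ⟨s, rfl⟩)
      obtain ⟨j, hj1, hj2, hj3⟩ := h _ _ hq2
      have hJ := j.joinedIn_range hj1 hj2
      have hb : range hJ.somePath ⊆ ball (γ s) (ρ / 4) := by
        rintro _ ⟨t, rfl⟩; exact hj3 (hJ.somePath_mem t)
      obtain ⟨a, ha, ea⟩ := hrs y hy β hβ q hq hJ.somePath hb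
      obtain ⟨b, hb, eb⟩ := hst q hq hJ.somePath hb y' hy' β' hβ'
      refine ⟨a.trans b, by simp [Path.trans_range, ha, hb], ?_⟩
      refine Path.Homotopic.trans ?_ (ea.hcomp eb)
      have e3 := Path.Homotopic.Quotient.eq.2 ⟨Path.Homotopy.subpathTransSubpath γ r s t⟩
      rw [← Path.Homotopic.Quotient.eq]
      simp only [Path.Homotopic.Quotient.mk_trans, Path.Homotopic.Quotient.mk_symm] at e3 ⊢
      rw [← e3]
      simp only [Path.Homotopic.Quotient.trans_assoc]
      rw [← Path.Homotopic.Quotient.trans_assoc (Path.Homotopic.Quotient.mk hJ.somePath), Path.Homotopic.Quotient.trans_symm,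
        Path.Homotopic.Quotient.refl_trans]
  obtain ⟨γ', h1, h2⟩ := hP z hz (((Path.refl z).cast γ.source rfl)) (by
    rintro _ ⟨t, rfl⟩; simp [hρ]) z hz ((Path.refl z).cast γ.target rfl) (by
    rintro _ ⟨t, rfl⟩; simp [hρ])
  refine ⟨γ', h1, Path.Homotopic.trans ?_ h2⟩
  have : ((Path.refl z).cast γ.source rfl).symm.trans (γ.subpath 0 1) =
    (Path.refl z).trans (γ.cast rfl γ.target) := by
    rw [Path.subpath_zero_one]
    ext t; simp [Path.trans_apply]
  rw [this]
  have h3 : (((Path.refl z).trans (γ.cast rfl γ.target)).trans ((Path.refl z).cast γ.target rfl)) =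
    ((Path.refl z).trans γ).trans (Path.refl z) := by
    ext t; simp [Path.trans_apply]
  rw [h3, ← Path.Homotopic.Quotient.eq]
  simp

lemma TT_of_pieces {Z : Set M} (hZ : IsCompact Z) {ι : Type*} [Finite ι] (Zs : ι → Set M)
    (d : ι → Disc M) (hcov : Z ⊆ ⋃ a, Zs a) (hsub : ∀ a, Zs a ⊆ (d a).f '' closedBall 0 2)
    (hrel : ∀ a, ∀ x ∈ Zs a, ∀ y ∈ Zs a, ∀ ε > 0, Rel (d a) (thickening ε Z) x y) :
    ∃ ρ > 0, TT Z ρ := by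
  have hcl : ∀ a, closure (Zs a) ⊆ range (d a).f := fun a =>
    (closure_minimal (hsub a) (((isCompact_closedBall _ _).image (d a).cont).isClosed)).trans
      (image_subset_range _ _)
  classical
  have hx : ∀ x : Z, ∃ j : Disc M, j.f 0 = x ∧ ∀ a, (range j.f ∩ Zs a).Nonempty →
      (x : M) ∈ closure (Zs a) ∧ range j.f ⊆ range (d a).f := by
    intro x
    obtain ⟨j, h0, hj⟩ := small_disc (x : M) (⋂ a, if (x : M) ∈ closure (Zs a) then range (d a).f
      else (closure (Zs a))ᶜ) (by
      rw [iInter_mem]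
      intro a
      split_ifs with h
      · exact (d a).isOpen.mem_nhds (hcl a h)
      · exact isClosed_closure.isOpen_compl.mem_nhds h)
    refine ⟨j, h0, fun a ⟨p, hp, hpa⟩ => ?_⟩
    by_cases h : (x : M) ∈ closure (Zs a)
    · refine ⟨h, fun q hq => ?_⟩
      have := mem_iInter.1 (hj hq) a
      rwa [if_pos h] at this
    · have := mem_iInter.1 (hj hp) a
      rw [if_neg h] at this
      exact absurd (subset_closure hpa) this
  choose j h0 hj using hx
  have main : ∀ x : Z, ∀ ε > 0, ∀ u ∈ Z, u ∈ range (j x).f → Rel (j x) (thickening ε Z) u x := by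
    intro x ε hε u hu huj
    obtain ⟨a, ha⟩ := mem_iUnion.1 (hcov hu)
    obtain ⟨h1, h2⟩ := hj x a ⟨u, huj, ha⟩
    have hopen : ball (x : M) ε ∈ 𝓝 ((j x).f 0) := by rw [h0]; exact ball_mem_nhds _ hε
    obtain ⟨r, hr, hr2⟩ := Metric.mem_nhds_iff.1 ((j x).cont.continuousAt.preimage_mem_nhds hopen)
    have hO : (j x).f '' ball 0 r ∈ 𝓝 (x : M) :=
      ((j x).emb.isOpenMap _ isOpen_ball).mem_nhds ⟨0, mem_ball_self hr, h0 x⟩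
    obtain ⟨v, hv, hva⟩ := mem_closure_iff_nhds.1 h1 _ hO
    have r1 : Rel (j x) (thickening ε Z) u v := (hrel a u ha v hva ε hε).change (by
      rw [inter_eq_self_of_subset_right h2]
      exact (j x).joinedIn_range huj (image_subset_range _ _ hv))
    refine r1.trans (Rel.of_joinedIn (((j x).joinedIn (A := ball 0 r)
      ((convex_ball _ _).isPathConnected ⟨0, mem_ball_self hr⟩) hv
      ⟨0, mem_ball_self hr, h0 x⟩).mono ?_))
    refine subset_inter ?_ (image_subset_range _ _)
    rintro _ ⟨w, hw, rfl⟩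
    exact mem_thickening_iff.2 ⟨x, x.2, hr2 hw⟩
  obtain ⟨ρ, hρ, h⟩ := lebesgue_number_lemma_of_metric hZ (fun x => (j x).isOpen)
    (fun x hx => mem_iUnion.2 ⟨⟨x, hx⟩, 0, h0 ⟨x, hx⟩⟩)
  refine ⟨ρ, hρ, fun x hx y hy δ hδ ε hε => ?_⟩
  obtain ⟨i, hi⟩ := h x hx
  have hδi := hδ.trans hi
  obtain ⟨γ, hγ, δ', hδ', e⟩ := (main i ε hε x hx (hδi δ.source_mem_range)).trans
    (main i ε hε y hy (hδi δ.target_mem_range)).symm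
  exact ⟨γ, hγ, ((j i).homotopic _ _ hδi hδ').trans e.symm⟩

end
end S14
end

section
open Set Filter Topology Metric unitInterval
namespace S14

section
variable {M : Type*} [TopologicalSpace M] [T2Space M]

open Classical in
noncomputable def FF (j : Disc M) (p q x : M) : ℂ :=
  if x ∈ range j.f then (j.inv x - j.inv p) / (j.inv x - j.inv q) else 1

lemma Disc.inv_inj (j : Disc M) {x y : M} (hx : x ∈ range j.f) (hy : y ∈ range j.f)
    (h : j.inv x = j.inv y) : x = y := by
  rw [← j.f_inv hx, h, j.f_inv hy]

lemma FF_ne (j : Disc M) {p q x : M} (hp : p ∈ range j.f) (hq : q ∈ range j.f) (h1 : x ≠ p)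
    (h2 : x ≠ q) : FF j p q x ≠ 0 := by
  rw [FF]; split_ifs with h
  · exact div_ne_zero (sub_ne_zero.2 fun e => h1 (j.inv_inj h hp e))
      (sub_ne_zero.2 fun e => h2 (j.inv_inj h hq e))
  · exact one_ne_zero

lemma FF_mul (j : Disc M) {p q r x : M} (hq : q ∈ range j.f) (h2 : x ≠ q) :
    FF j p q x * FF j q r x = FF j p r x := by
  simp only [FF]; split_ifs with h
  · have : j.inv x - j.inv q ≠ 0 := sub_ne_zero.2 fun e => h2 (j.inv_inj h hq e)
    field_simp
  · simp

lemma FF_cont (j : Disc M) {q : M} (hq : q ∈ range j.f) :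
    ContinuousOn (fun y : M × M => FF j y.2 q y.1) {y | y.1 ≠ q ∧ y.2 ∈ range j.f} := by
  rintro ⟨x, p⟩ ⟨hx, hp⟩
  simp only at hx hp
  apply ContinuousAt.continuousWithinAt
  by_cases h : x ∈ range j.f
  · have h1 : ContinuousAt (fun y : M × M => (j.inv y.1 - j.inv y.2) / (j.inv y.1 - j.inv q)) (x, p) := by
      have e1 : ContinuousAt (fun y : M × M => j.inv y.1) (x, p) :=
        ContinuousAt.comp (f := Prod.fst) (j.contAt_inv h) continuousAt_fst
      have e2 : ContinuousAt (fun y : M × M => j.inv y.2) (x, p) :=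
        ContinuousAt.comp (f := Prod.snd) (j.contAt_inv hp) continuousAt_snd
      exact (e1.sub e2).div (e1.sub continuousAt_const)
        (sub_ne_zero.2 fun e => hx (j.inv_inj h hq e))
    refine h1.congr ?_
    have : ∀ᶠ y : M × M in 𝓝 (x, p), y.1 ∈ range j.f :=
      continuousAt_fst.eventually_mem (j.isOpen.mem_nhds h)
    filter_upwards [this] with y hy
    rw [FF, if_pos hy]
  · have hv : FF j p q x = 1 := if_neg h
    rw [ContinuousAt]
    simp only [hv]
    rw [Metric.tendsto_nhds]
    intro ε hε
    set b := j.inv q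
    set B : ℝ := ‖b - j.inv p‖ + 1
    have hB : 0 < B := by positivity
    have e1 : ∀ᶠ y : M × M in 𝓝 (x, p), ‖b - j.inv y.2‖ < B := by
      have : ContinuousAt (fun y : M × M => ‖b - j.inv y.2‖) (x, p) :=
        (continuousAt_const.sub
        (ContinuousAt.comp (f := Prod.snd) (j.contAt_inv hp) continuousAt_snd)).norm
      exact this.eventually_lt_const (lt_add_one _)
    have e2 : ∀ᶠ y : M × M in 𝓝 (x, p), y.1 ∈ (j.f '' closedBall b (B / ε))ᶜ := by
      apply continuousAt_fst.eventually_mem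
      apply ((isCompact_closedBall b (B / ε)).image j.cont).isClosed.isOpen_compl.mem_nhds
      exact fun hm => h (image_subset_range _ _ hm)
    filter_upwards [e1, e2] with y h1 h2
    rw [FF]; split_ifs with hy
    · have hd : B / ε < ‖j.inv y.1 - b‖ := by
        by_contra hc
        exact h2 ⟨j.inv y.1, by simpa [dist_eq_norm] using hc, j.f_inv hy⟩
      have hpos : 0 < ‖j.inv y.1 - b‖ := lt_of_le_of_lt (by positivity) hd
      have hne : j.inv y.1 - b ≠ 0 := norm_pos_iff.1 hpos
      have : (j.inv y.1 - j.inv y.2) / (j.inv y.1 - b) - 1 =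
        (b - j.inv y.2) / (j.inv y.1 - b) := by field_simp; ring
      rw [dist_eq_norm, this, norm_div, div_lt_iff₀ hpos]
      rw [div_lt_iff₀ hε] at hd
      linarith
    · simpa using hε

lemma FF_cont' (j : Disc M) {p q : M} (hp : p ∈ range j.f) (hq : q ∈ range j.f) :
    ContinuousOn (FF j p q) {q}ᶜ :=
  (FF_cont j hq).comp (f := fun x => (x, p)) (by fun_prop) (fun x hx => ⟨hx, hp⟩)

noncomputable def esq (w : ℂ) : ℂ := Complex.exp (Complex.log w / 2)

lemma esq_sq {w : ℂ} (h : w ≠ 0) : esq w ^ 2 = w := by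
  rw [esq, ← Complex.exp_nat_mul]
  push_cast; rw [mul_div_cancel₀ _ two_ne_zero, Complex.exp_log h]

lemma esq_cont : ContinuousOn esq Complex.slitPlane := fun w hw =>
  (((continuousAt_clog hw).div_const 2).cexp).continuousWithinAt

/-- A loop, given as two paths. -/
structure Lp (M : Type*) [TopologicalSpace M] where
  P : I → M
  X : I → M
  hP : Continuous P
  hX : Continuous X
  h1 : P 1 = X 0
  h0 : P 0 = X 1

def Lp.supp (l : Lp M) : Set M := range l.P ∪ range l.X

noncomputable def nn (l : Lp M) (u : M → ℂ) : ℂ :=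
  sr (fun t => u (l.P t)) * sr (fun t => u (l.X t))

lemma nn_mul (l : Lp M) {u v : M → ℂ} (hu : ContinuousOn u l.supp) (hv : ContinuousOn v l.supp)
    (hu0 : ∀ x ∈ l.supp, u x ≠ 0) (hv0 : ∀ x ∈ l.supp, v x ≠ 0) :
    nn l (fun x => u x * v x) = nn l u * nn l v := by
  have mP : ∀ t, l.P t ∈ l.supp := fun t => Or.inl ⟨t, rfl⟩
  have mX : ∀ t, l.X t ∈ l.supp := fun t => Or.inr ⟨t, rfl⟩
  simp only [nn]
  rw [sr_mul (f := fun t => u (l.P t)) (g := fun t => v (l.P t)) (hu.comp_continuous l.hP mP) (hv.comp_continuous l.hP mP) (fun t => hu0 _ (mP t))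
    (fun t => hv0 _ (mP t)), sr_mul (f := fun t => u (l.X t)) (g := fun t => v (l.X t)) (hu.comp_continuous l.hX mX) (hv.comp_continuous l.hX mX)
    (fun t => hu0 _ (mX t)) (fun t => hv0 _ (mX t))]
  ring

lemma nn_sq (l : Lp M) {u : M → ℂ} (hu : ContinuousOn u l.supp)
    (hu0 : ∀ x ∈ l.supp, u x ≠ 0) : nn l u = 1 ∨ nn l u = -1 := by
  have mP : ∀ t, l.P t ∈ l.supp := fun t => Or.inl ⟨t, rfl⟩
  have mX : ∀ t, l.X t ∈ l.supp := fun t => Or.inr ⟨t, rfl⟩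
  rw [← sq_eq_one_iff, nn, mul_pow, sr_sq (f := fun t => u (l.P t)) (hu.comp_continuous l.hP mP) (fun t => hu0 _ (mP t)),
    sr_sq (f := fun t => u (l.X t)) (hu.comp_continuous l.hX mX) (fun t => hu0 _ (mX t)), l.h1, l.h0]
  have := hu0 _ (mX 0); have := hu0 _ (mX 1)
  field_simp

lemma nn_of_sqrt (l : Lp M) {u S : M → ℂ} (hS : ContinuousOn S l.supp)
    (hS2 : ∀ x ∈ l.supp, S x ^ 2 = u x) (hu0 : ∀ x ∈ l.supp, u x ≠ 0) : nn l u = 1 := by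
  have mP : ∀ t, l.P t ∈ l.supp := fun t => Or.inl ⟨t, rfl⟩
  have mX : ∀ t, l.X t ∈ l.supp := fun t => Or.inr ⟨t, rfl⟩
  rw [nn, sr_eq (s := fun t => S (l.P t)) (hS.comp_continuous l.hP mP) (fun t => hS2 _ (mP t)) (fun t => hu0 _ (mP t)),
    sr_eq (s := fun t => S (l.X t)) (hS.comp_continuous l.hX mX) (fun t => hS2 _ (mX t)) (fun t => hu0 _ (mX t)), l.h1, l.h0]
  have key : ∀ t, S (l.X t) ≠ 0 := fun t h => hu0 _ (mX t) (by rw [← hS2 _ (mX t), h]; simp)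
  have := key 0; have := key 1
  field_simp

lemma nn_of_slit (l : Lp M) {u : M → ℂ} (hu : ContinuousOn u l.supp)
    (hs : ∀ x ∈ l.supp, u x ∈ Complex.slitPlane) : nn l u = 1 :=
  nn_of_sqrt l (S := fun x => esq (u x)) (esq_cont.comp hu hs)
    (fun x hx => esq_sq (Complex.slitPlane_ne_zero (hs x hx)))
    (fun x hx => (Complex.slitPlane_ne_zero (hs x hx)))

lemma Lp.isCompact (l : Lp M) : IsCompact l.supp :=
  (isCompact_range l.hP).union (isCompact_range l.hX)

lemma nn_cocycle (l : Lp M) (j : Disc M) {p q r : M} (hp : p ∈ range j.f) (hq : q ∈ range j.f)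
    (hr : r ∈ range j.f) (hp' : p ∉ l.supp) (hq' : q ∉ l.supp) (hr' : r ∉ l.supp) :
    nn l (FF j p q) * nn l (FF j q r) = nn l (FF j p r) := by
  have key : ∀ a ∉ l.supp, ∀ x ∈ l.supp, x ≠ a := fun a ha x hx h => ha (h ▸ hx)
  rw [← nn_mul l ((FF_cont' j hp hq).mono (key q hq')) ((FF_cont' j hq hr).mono (key r hr'))
    (fun x hx => FF_ne j hp hq (key p hp' x hx) (key q hq' x hx))
    (fun x hx => FF_ne j hq hr (key q hq' x hx) (key r hr' x hx))]
  have h1 : ∀ x ∈ l.supp, FF j p q x * FF j q r x = FF j p r x := fun x hx =>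
    FF_mul j hq (key q hq' x hx)
  simp only [nn]
  congr 2 <;> ext t
  · exact h1 _ (Or.inl ⟨t, rfl⟩)
  · exact h1 _ (Or.inr ⟨t, rfl⟩)

lemma nn_locconst (l : Lp M) (j : Disc M) {p : M} (hp : p ∈ range j.f) (hp' : p ∉ l.supp) :
    ∀ᶠ q in 𝓝 p, nn l (FF j q p) = 1 := by
  have h1 : j.f ⁻¹' l.suppᶜ ∈ 𝓝 (j.inv p) := j.cont.continuousAt.preimage_mem_nhds
    (by rw [j.f_inv hp]; exact l.isCompact.isClosed.isOpen_compl.mem_nhds hp')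
  obtain ⟨c, hc, hb⟩ := Metric.mem_nhds_iff.1 h1
  have h2 : ∀ᶠ q in 𝓝 p, dist (j.inv q) (j.inv p) < c :=
    (j.contAt_inv hp).eventually_mem (ball_mem_nhds _ hc)
  filter_upwards [h2, j.isOpen.mem_nhds hp] with q hq hqj
  apply nn_of_slit
  · exact (FF_cont' j hqj hp).mono fun x hx h => hp' (h ▸ hx)
  · intro x hx
    rw [FF]; split_ifs with h
    · have hd : c ≤ ‖j.inv x - j.inv p‖ := by
        by_contra hcc
        have := hb (a := j.inv x) (by simpa [dist_eq_norm] using hcc)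
        rw [mem_preimage, j.f_inv h] at this
        exact this hx
      have hpos : 0 < ‖j.inv x - j.inv p‖ := lt_of_lt_of_le hc hd
      have hne : j.inv x - j.inv p ≠ 0 := norm_pos_iff.1 hpos
      have e : (j.inv x - j.inv q) / (j.inv x - j.inv p) =
        1 - (j.inv q - j.inv p) / (j.inv x - j.inv p) := by field_simp; ring
      have hn : ‖(j.inv q - j.inv p) / (j.inv x - j.inv p)‖ < 1 := by
        rw [norm_div, div_lt_one hpos, ← dist_eq_norm]; linarith
      rw [e]
      left
      have := Complex.re_le_norm ((j.inv q - j.inv p) / (j.inv x - j.inv p))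
      simp only [Complex.sub_re, Complex.one_re]; linarith
    · exact Complex.one_mem_slitPlane

lemma nn_compat (l : Lp M) (e j : Disc M) (hej : range e.f ⊆ range j.f) {p q : M}
    (hp : p ∈ range e.f) (hq : q ∈ range e.f) (hp' : p ∉ l.supp) (hq' : q ∉ l.supp) :
    nn l (FF e p q) = nn l (FF j p q) := by
  obtain ⟨a, rfl⟩ := hp
  obtain ⟨b, rfl⟩ := hq
  have mj : ∀ w, e.f w ∈ range j.f := fun w => hej ⟨w, rfl⟩
  obtain ⟨S, hS, hS2⟩ := exists_sqrt_swap (fun w => j.inv (e.f w))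
    (j.cont_inv.comp_continuous e.cont mj)
    (fun x y h => e.emb.injective (j.inv_inj (mj x) (mj y) h))
  have hS0 : ∀ x y, x ≠ y → S (x, y) ≠ 0 := fun x y h h' => by
    have := hS2 (x, y) h
    rw [h', eq_comm, zero_pow two_ne_zero] at this
    rcases mul_eq_zero.1 this with h1 | h1
    · exact h (e.emb.injective (j.inv_inj (mj x) (mj y) (sub_eq_zero.1 h1)))
    · exact h (sub_eq_zero.1 h1)
  let c : I → ℂ := fun s => b + (s : ℝ) * (a - b)
  have hc : Continuous c := by fun_prop
  have c0 : c 0 = b := by simp [c]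
  have c1 : c 1 = a := by simp [c]
  let K : Set M := range (fun s => e.f (c s))
  have hK : IsCompact K := isCompact_range (e.cont.comp hc)
  have hKne : ∀ x : (Kᶜ : Set M), ∀ s, (x : M) ≠ e.f (c s) := fun x s h => x.2 ⟨s, h.symm⟩
  have hKb : ∀ x : (Kᶜ : Set M), (x : M) ≠ e.f b := fun x => by rw [← c0]; exact hKne x 0
  obtain ⟨S1, hS1, hS12, hS10⟩ := sqrt_homotopy (X := (Kᶜ : Set M))
    (fun y => FF e (e.f (c y.2)) (e.f b) y.1 * FF j (e.f (c y.2)) (e.f b) y.1) (by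
      refine Continuous.mul ?_ ?_
      · exact (FF_cont e ⟨b, rfl⟩).comp_continuous
          (f := fun y : (Kᶜ : Set M) × I => ((y.1 : M), e.f (c y.2)))
          ((by fun_prop : Continuous _).prodMk (e.cont.comp (by fun_prop)))
          (fun y => ⟨hKb y.1, ⟨_, rfl⟩⟩)
      · exact (FF_cont j (mj b)).comp_continuous
          (f := fun y : (Kᶜ : Set M) × I => ((y.1 : M), e.f (c y.2)))
          ((by fun_prop : Continuous _).prodMk (e.cont.comp (by fun_prop)))
          (fun y => ⟨hKb y.1, mj _⟩))
    (fun y => mul_ne_zero (FF_ne e ⟨_, rfl⟩ ⟨_, rfl⟩ (hKne _ _) (hKb _))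
      (FF_ne j (mj _) (mj _) (hKne _ _) (hKb _)))
    (fun x => by
      have : ∀ d : Disc M, e.f b ∈ range d.f → FF d (e.f b) (e.f b) x = 1 := fun d hd => by
        rw [FF]; split_ifs with h
        · exact div_self (sub_ne_zero.2 fun e => hKb x (d.inv_inj h hd e))
        · rfl
      simp only [c0, this e ⟨b, rfl⟩, this j (mj b), mul_one])
  have formula : ∀ w v : ℂ, w ≠ v → w ≠ b →
      (S (w, v) / S (w, b)) ^ 2 = FF e (e.f v) (e.f b) (e.f w) * FF j (e.f v) (e.f b) (e.f w) := by
    intro w v h1 h2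
    rw [div_pow, hS2 _ h1, hS2 _ h2, FF, FF, if_pos ⟨w, rfl⟩, if_pos (mj w)]
    simp only [e.inv_f]
    rw [mul_div_mul_comm, mul_comm]
  classical
  let R : M → ℂ := fun x => if h : x ∈ K then S (e.inv x, a) / S (e.inv x, b) else S1 (⟨x, h⟩, 1)
  have hR : ∀ w, R (e.f w) = S (w, a) / S (w, b) := by
    intro w
    simp only [R]
    split_ifs with h
    · rw [e.inv_f]
    · have hw : ∀ s, w ≠ c s := fun s hs => h ⟨s, by simp [hs]⟩
      have hwb : w ≠ b := by rw [← c0]; exact hw 0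
      have := isPreconnected_univ.eq_of_sq_eq (f := fun s : I => S1 (⟨e.f w, h⟩, s))
        (g := fun s : I => S (w, c s) / S (w, b)) (by fun_prop)
        (by
          rw [continuousOn_univ]
          exact (hS.comp_continuous (f := fun s => (w, c s)) (by fun_prop) hw).div_const _)
        (fun s _ => by
          simp only [Pi.pow_apply]
          rw [hS12, formula w _ (hw s) hwb])
        (fun {s} _ => div_ne_zero (hS0 _ _ (hw s)) (hS0 _ _ hwb)) (mem_univ 0)
        (by simp only [hS10, c0]; rw [div_self (hS0 _ _ hwb)])
      have := this (mem_univ 1)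
      simpa [c1] using this
  have key : ∀ x ∈ l.supp, x ≠ e.f a ∧ x ≠ e.f b :=
    fun x hx => ⟨fun h => hp' (h ▸ hx), fun h => hq' (h ▸ hx)⟩
  have hR2 : ∀ x ∈ l.supp, R x ^ 2 = FF e (e.f a) (e.f b) x * FF j (e.f a) (e.f b) x := by
    intro x hx
    by_cases h : x ∈ range e.f
    · obtain ⟨w, rfl⟩ := h
      rw [hR, formula w a (fun h => (key _ hx).1 (by rw [h])) (fun h => (key _ hx).2 (by rw [h]))]
    · have hxK : x ∉ K := by rintro ⟨s, rfl⟩; exact h ⟨_, rfl⟩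
      simp only [R, dif_neg hxK]
      rw [hS12]; simp [c1]
  have hRc : ContinuousOn R l.supp := by
    intro x hx
    apply ContinuousAt.continuousWithinAt
    by_cases h : x ∈ range e.f
    · obtain ⟨w, rfl⟩ := h
      have hwa : w ≠ a := fun h => (key _ hx).1 (by rw [h])
      have hwb : w ≠ b := fun h => (key _ hx).2 (by rw [h])
      have hSa : ∀ v, w ≠ v → ContinuousAt (fun x => S (e.inv x, v)) (e.f w) := fun v hv =>
        ContinuousAt.comp (f := fun x => (e.inv x, v)) (hS.continuousAt
          ((isOpen_ne_fun continuous_fst continuous_snd).mem_nhds (by simpa [e.inv_f] using hv)))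
          ((e.contAt_inv ⟨w, rfl⟩).prodMk continuousAt_const)
      refine ((hSa a hwa).div (hSa b hwb) (by rw [e.inv_f]; exact hS0 _ _ hwb)).congr ?_
      filter_upwards [e.isOpen.mem_nhds ⟨w, rfl⟩] with y hy
      obtain ⟨v, rfl⟩ := hy
      rw [hR]; simp [e.inv_f]
    · have hxK : x ∉ K := by rintro ⟨s, rfl⟩; exact h ⟨_, rfl⟩
      have : ContinuousOn R Kᶜ := by
        rw [continuousOn_iff_continuous_domRestrict]
        have : (Kᶜ : Set M).domRestrict R = fun y => S1 (y, 1) := by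
          ext y; exact dif_neg y.2
        rw [this]; fun_prop
      exact this.continuousAt (hK.isClosed.isOpen_compl.mem_nhds hxK)
  have hne : ∀ d : Disc M, e.f a ∈ range d.f → e.f b ∈ range d.f →
    ∀ x ∈ l.supp, FF d (e.f a) (e.f b) x ≠ 0 := fun d h1 h2 x hx =>
      FF_ne d h1 h2 (key x hx).1 (key x hx).2
  have hcc : ∀ d : Disc M, e.f a ∈ range d.f → e.f b ∈ range d.f →
    ContinuousOn (FF d (e.f a) (e.f b)) l.supp := fun d h1 h2 =>
      (FF_cont' d h1 h2).mono fun x hx => (key x hx).2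
  have h1 := nn_of_sqrt l hRc hR2 (fun x hx => mul_ne_zero (hne e ⟨a, rfl⟩ ⟨b, rfl⟩ x hx)
    (hne j (mj a) (mj b) x hx))
  rw [nn_mul l (hcc e ⟨a, rfl⟩ ⟨b, rfl⟩) (hcc j (mj a) (mj b)) (hne e ⟨a, rfl⟩ ⟨b, rfl⟩)
    (hne j (mj a) (mj b))] at h1
  rcases nn_sq l (hcc e ⟨a, rfl⟩ ⟨b, rfl⟩) (hne e ⟨a, rfl⟩ ⟨b, rfl⟩) with h | h <;>
  rcases nn_sq l (hcc j (mj a) (mj b)) (hne j (mj a) (mj b)) with h' | h' <;>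
  rw [h, h'] at h1 ⊢ <;> norm_num at h1

end
end S14
end

section
open Set Filter Topology Metric unitInterval
namespace S14

lemma quot_im (w : ℂ) (s t : ℝ) : ((w - s) / (w - t)).im = w.im * (s - t) / Complex.normSq (w - t) := by
  rw [Complex.div_im]; simp; ring

lemma quot_re (w : ℂ) (s t : ℝ) : ((w - s) / (w - t)).re =
    ((w.re - s) * (w.re - t) + w.im ^ 2) / Complex.normSq (w - t) := by
  rw [Complex.div_re]; simp; ring

lemma quot_slit {w : ℂ} {s t : ℝ} (hst : s < t) (hw : w ∉ Complex.ofReal '' Icc s t) :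
    (w - s) / (w - t) ∈ Complex.slitPlane := by
  have hwt : w - t ≠ 0 := fun h => hw ⟨t, ⟨hst.le, le_rfl⟩, (sub_eq_zero.1 h).symm⟩
  have hn : 0 < Complex.normSq (w - t) := Complex.normSq_pos.2 hwt
  by_cases hy : w.im = 0
  · left
    rw [quot_re, hy]
    apply div_pos _ hn
    have hx : ¬ (s ≤ w.re ∧ w.re ≤ t) := fun h => hw ⟨w.re, h, Complex.ext rfl (by simp [hy])⟩
    rcases lt_or_ge w.re s with h | h
    · nlinarith [mul_pos_of_neg_of_neg (sub_neg.2 h) (sub_neg.2 (h.trans hst))]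
    · have h2 : t < w.re := by by_contra h'; exact hx ⟨h, not_lt.1 h'⟩
      nlinarith [mul_pos (sub_pos.2 (hst.trans h2)) (sub_pos.2 h2)]
  · right
    rw [quot_im]
    exact div_ne_zero (mul_ne_zero hy (sub_ne_zero.2 hst.ne)) hn.ne'

lemma esq_neg_of_im_neg {w : ℂ} (h : w.im < 0) : esq (-w) = Complex.I * esq w := by
  have : Complex.log (-w) = Complex.log w + Real.pi * Complex.I := by
    simp only [Complex.log, norm_neg, Complex.arg_neg_eq_arg_add_pi_of_im_neg h]
    push_cast; ring
  rw [esq, this, add_div, Complex.exp_add, esq, mul_comm]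
  congr 1
  rw [mul_div_right_comm, Complex.exp_pi_div_two_mul_I]

lemma esq_neg_of_im_pos {w : ℂ} (h : 0 < w.im) : esq w = Complex.I * esq (-w) := by
  have := esq_neg_of_im_neg (w := -w) (by simpa using h)
  rwa [neg_neg] at this

lemma esq_ne (w : ℂ) : esq w ≠ 0 := Complex.exp_ne_zero _

section
variable {M : Type*} [TopologicalSpace M] [T2Space M]

lemma FF_slit (D : Disc M) {s t : ℝ} (hst : s < t) {x : M} (hx : x ∉ (fun r : ℝ => D.f r) '' Icc s t) :
    FF D (D.f s) (D.f t) x ∈ Complex.slitPlane := by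
  rw [FF]; split_ifs with h
  · obtain ⟨w, rfl⟩ := h
    simp only [D.inv_f]
    apply quot_slit hst
    rintro ⟨r, hr, rfl⟩
    exact hx ⟨r, hr, rfl⟩
  · exact Complex.one_mem_slitPlane

lemma nn_avoid (l : Lp M) (D : Disc M) {s t : ℝ} (hst : s < t)
    (h : ∀ x ∈ l.supp, x ∉ (fun r : ℝ => D.f r) '' Icc s t) : nn l (FF D (D.f s) (D.f t)) = 1 :=
  nn_of_slit l ((FF_cont' D ⟨_, rfl⟩ ⟨_, rfl⟩).mono fun x hx e =>
    h x hx ⟨t, ⟨hst.le, le_rfl⟩, e.symm⟩) (fun x hx => FF_slit D hst (h x hx))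

lemma nn_cross (l : Lp M) (D : Disc M) {s t θ η : ℝ} (hs : s < θ) (ht : θ < t) (hη : 0 < η)
    (hP : ∀ τ, l.P τ ∉ (fun r : ℝ => D.f r) '' Icc s t)
    (hX : ∀ τ : I, l.X τ = D.f (θ + (η * (2 * τ - 1) : ℝ) * Complex.I)) :
    nn l (FF D (D.f s) (D.f t)) = -1 := by
  have hst := hs.trans ht
  let u := FF D (D.f s) (D.f t)
  have huX : ∀ τ : I, u (l.X τ) = ((θ + (η * (2 * τ - 1) : ℝ) * Complex.I) - s) /
      ((θ + (η * (2 * τ - 1) : ℝ) * Complex.I) - t) := by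
    intro τ
    simp only [u]
    rw [hX, FF, if_pos ⟨_, rfl⟩]; simp only [D.inv_f]
  have hden : ∀ y : ℝ, (θ + (y : ℝ) * Complex.I) - t ≠ 0 := fun y h => by
    have := congrArg Complex.re h; simp at this; linarith
  have hXneg : ∀ τ : I, - u (l.X τ) ∈ Complex.slitPlane := by
    intro τ
    have hn := Complex.normSq_pos.2 (hden (η * (2 * τ - 1)))
    by_cases hy : (η * (2 * (τ : ℝ) - 1)) = 0
    · left
      rw [huX, Complex.neg_re, quot_re, neg_pos]
      apply div_neg_of_neg_of_pos _ hn
      rw [hy]; simp; nlinarith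
    · right
      rw [huX, Complex.neg_im, quot_im, neg_ne_zero]
      refine div_ne_zero (mul_ne_zero ?_ (sub_ne_zero.2 hst.ne)) hn.ne'
      simpa using hy
  have hcX : Continuous fun τ => u (l.X τ) :=
    (FF_cont' D ⟨_, rfl⟩ ⟨_, rfl⟩).comp_continuous l.hX (fun τ h => by
      rw [mem_singleton_iff, hX] at h
      have := congrArg Complex.re (D.emb.injective h); simp at this; linarith)
  have hcP : Continuous fun τ => u (l.P τ) :=
    (FF_cont' D ⟨_, rfl⟩ ⟨_, rfl⟩).comp_continuous l.hP
      (fun τ h => hP τ ⟨t, ⟨hst.le, le_rfl⟩, Eq.symm h⟩)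
  have h1 : sr (fun τ => u (l.P τ)) = esq (u (l.P 1)) / esq (u (l.P 0)) :=
    sr_eq (s := fun τ => esq (u (l.P τ))) (esq_cont.comp_continuous hcP fun τ => FF_slit D hst (hP τ))
      (fun τ => esq_sq (Complex.slitPlane_ne_zero (FF_slit D hst (hP τ))))
      (fun τ => Complex.slitPlane_ne_zero (FF_slit D hst (hP τ)))
  have h2 : sr (fun τ => u (l.X τ)) =
      (Complex.I * esq (- u (l.X 1))) / (Complex.I * esq (- u (l.X 0))) :=
    sr_eq (s := fun τ => Complex.I * esq (- u (l.X τ)))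
      (continuous_const.mul (esq_cont.comp_continuous hcX.neg hXneg))
      (fun τ => by rw [mul_pow, esq_sq (Complex.slitPlane_ne_zero (hXneg τ))]; simp)
      (fun τ => by simpa using Complex.slitPlane_ne_zero (hXneg τ))
  have i1 : (u (l.X 1)).im < 0 := by
    rw [huX, quot_im]
    apply div_neg_of_neg_of_pos _ (Complex.normSq_pos.2 (hden _))
    simp; nlinarith
  have i0 : 0 < (u (l.X 0)).im := by
    rw [huX, quot_im]
    apply div_pos _ (Complex.normSq_pos.2 (hden _))
    simp; nlinarith
  change sr (fun τ => u (l.P τ)) * sr (fun τ => u (l.X τ)) = -1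
  rw [h1, h2, l.h1, l.h0, esq_neg_of_im_neg i1, esq_neg_of_im_pos i0]
  have := esq_ne (u (l.X 1)); have := esq_ne (-u (l.X 0))
  field_simp
  simp
end
end S14
end

section
open Set Filter Topology Metric unitInterval
namespace S14

universe u
variable {M : Type u} [MetricSpace M]

/-- the closed arc -/
def arc (D : Disc M) : Set M := (fun r : ℝ => D.f r) '' Icc 0 1

structure Gr {κ ι α : Type*} (D : κ → Disc M) (P : Set M) (d : ι → Disc M) (E : α → Disc M) :
    Prop where
  fin : P.Finite
  e0 : ∀ k, (D k).f (0 : ℝ) ∈ P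
  e1 : ∀ k, (D k).f (1 : ℝ) ∈ P
  oP : ∀ k, ∀ θ ∈ Ioo (0 : ℝ) 1, (D k).f θ ∉ P
  disj : ∀ k k', ∀ θ ∈ Ioo (0 : ℝ) 1, ∀ θ' ∈ Ioo (0 : ℝ) 1, (D k).f θ = (D k').f θ' → k = k'
  cov : ∀ x, ∃ i, x ∈ (d i).f '' closedBall 0 2
  faces : ∀ Q : Set M, IsPreconnected Q → Q ⊆ (P ∪ ⋃ k, arc (D k))ᶜ → ∃ i, Q ⊆ (d i).f '' ball 0 2
  near : ∀ k i, (arc (D k) ∩ (d i).f '' closedBall 0 2).Nonempty → arc (D k) ⊆ range (d i).f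
  covE : ∀ x, ∃ a, x ∈ range (E a).f
  pair : ∀ a b, (range (E a).f ∩ range (E b).f).Nonempty →
    ∃ i, range (E a).f ⊆ range (d i).f ∧ range (E b).f ⊆ range (d i).f
  arcE : ∀ k, ∃ a, arc (D k) ⊆ range (E a).f ∧ range (E a).f ⊆ range (D k).f

variable {κ ι α : Type*} {D : κ → Disc M} {P : Set M} {d : ι → Disc M} {E : α → Disc M}

@[ext] structure Sg (D : κ → Disc M) (Z : Set M) where
  k : κ
  s : ℝ
  t : ℝ
  h0 : 0 ≤ s
  hst : s < t
  h1 : t ≤ 1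
  av : ∀ θ ∈ Ioo s t, (D k).f θ ∉ Z
  es : s = 0 ∨ (D k).f s ∈ Z
  et : t = 1 ∨ (D k).f t ∈ Z

namespace Sg
variable {Z : Set M}

def a (h : Sg D Z) : M := (D h.k).f h.s
def b (h : Sg D Z) : M := (D h.k).f h.t
def g (h : Sg D Z) : Set M := (fun r : ℝ => (D h.k).f r) '' Ioo h.s h.t
def Good (h : Sg D Z) : Prop := h.a ∈ Z ∧ h.b ∈ Z
end Sg

variable {Z : Set M}

lemma Disc.inj_real (D : Disc M) {x y : ℝ} (h : D.f x = D.f y) : x = y :=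
  Complex.ofReal_injective (D.emb.injective h)

lemma Disc.cont_real (D : Disc M) : Continuous fun r : ℝ => D.f r :=
  D.cont.comp Complex.continuous_ofReal

lemma isCompact_arc (D : Disc M) : IsCompact (arc D) := isCompact_Icc.image D.cont_real

lemma Sg.not_Z (h : Sg D Z) {x : M} (hx : x ∈ h.g) : x ∉ Z := by
  obtain ⟨θ, hθ, rfl⟩ := hx; exact h.av θ hθ

lemma Sg.Ioo_sub (h : Sg D Z) : Ioo h.s h.t ⊆ Ioo 0 1 := Ioo_subset_Ioo h.h0 h.h1

lemma Sg.not_P (G : Gr D P d E) (h : Sg D Z) {x : M} (hx : x ∈ h.g) : x ∉ P := by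
  obtain ⟨θ, hθ, rfl⟩ := hx; exact G.oP _ _ (h.Ioo_sub hθ)

lemma Sg.g_sub (h : Sg D Z) : h.g ⊆ arc (D h.k) :=
  image_mono (h.Ioo_sub.trans Ioo_subset_Icc_self)

lemma Sg.g_eq0 (G : ∀ k k', ∀ θ ∈ Ioo (0 : ℝ) 1, ∀ θ' ∈ Ioo (0 : ℝ) 1, (D k).f θ = (D k').f θ' → k = k')
    {h h' : Sg D Z} {x : M} (hx : x ∈ h.g) (hx' : x ∈ h'.g) : h = h' := by
  obtain ⟨k, s, t, h0, hst, h1, av, es, et⟩ := h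
  obtain ⟨k', s', t', h0', hst', h1', av', es', et'⟩ := h'
  obtain ⟨θ, hθ, rfl⟩ := hx
  obtain ⟨θ', hθ', e⟩ := hx'
  simp only at e hθ hθ'
  have hk : k' = k := G _ _ _ ⟨h0'.trans_lt hθ'.1, hθ'.2.trans_le h1'⟩ _
    ⟨h0.trans_lt hθ.1, hθ.2.trans_le h1⟩ e
  subst hk
  have : θ' = θ := (D k').inj_real e
  subst this
  have hs : s = s' := by
    rcases lt_trichotomy s s' with h | h | h
    · exact absurd (es'.resolve_left (by linarith)) (av s' ⟨h, hθ'.1.trans hθ.2⟩)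
    · exact h
    · exact absurd (es.resolve_left (by linarith)) (av' s ⟨h, hθ.1.trans hθ'.2⟩)
  have ht : t = t' := by
    rcases lt_trichotomy t t' with h | h | h
    · exact absurd (et.resolve_left (by linarith)) (av' t ⟨hθ'.1.trans hθ.2, h⟩)
    · exact h
    · exact absurd (et'.resolve_left (by linarith)) (av t' ⟨hθ.1.trans hθ'.2, h⟩)
  subst hs ht; rfl

lemma Sg.g_eq (G : Gr D P d E) {h h' : Sg D Z} {x : M} (hx : x ∈ h.g) (hx' : x ∈ h'.g) : h = h' :=
  Sg.g_eq0 G.disj hx hx'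

variable (D P Z) in
def BB : Set M := P ∪ (⋃ k, arc (D k)) ∪ Z

/-- existence of a segment through a non-`Z` point -/
lemma exists_sg (hZ : IsClosed Z) (k : κ) {θ : ℝ} (hθ : θ ∈ Ioo (0 : ℝ) 1) (hn : (D k).f θ ∉ Z) :
    ∃ h : Sg D Z, h.k = k ∧ θ ∈ Ioo h.s h.t := by
  let T : Set ℝ := {0, 1} ∪ (fun r : ℝ => (D k).f r) ⁻¹' Z
  have hT : IsClosed T := (Set.toFinite _).isClosed.union (hZ.preimage (D k).cont_real)
  have hθT : θ ∉ T := by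
    rintro ((h | h) | h)
    · exact hθ.1.ne' h
    · exact hθ.2.ne h
    · exact hn h
  obtain ⟨s, hs⟩ := ((isCompact_Icc (a := 0) (b := θ)).inter_right hT).exists_isGreatest
    ⟨0, ⟨le_rfl, hθ.1.le⟩, Or.inl (Or.inl rfl)⟩
  obtain ⟨t, ht⟩ := ((isCompact_Icc (a := θ) (b := 1)).inter_right hT).exists_isLeast
    ⟨1, ⟨hθ.2.le, le_rfl⟩, Or.inl (Or.inr rfl)⟩
  have hsθ : s < θ := lt_of_le_of_ne hs.1.1.2 fun e => hθT (e ▸ hs.1.2)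
  have hθt : θ < t := lt_of_le_of_ne ht.1.1.1 fun e => hθT (e ▸ ht.1.2)
  refine ⟨⟨k, s, t, hs.1.1.1, hsθ.trans hθt, ht.1.1.2, ?_, ?_, ?_⟩, rfl, hsθ, hθt⟩
  · intro r hr hrZ
    rcases le_total r θ with h | h
    · exact absurd (hs.2 ⟨⟨hs.1.1.1.trans hr.1.le, h⟩, Or.inr hrZ⟩) (not_le.2 hr.1)
    · exact absurd (ht.2 ⟨⟨h, hr.2.le.trans ht.1.1.2⟩, Or.inr hrZ⟩) (not_le.2 hr.2)
  · rcases hs.1.2 with (h | h) | h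
    · exact Or.inl h
    · exact absurd (show s = 1 from h) (hsθ.trans hθ.2).ne
    · exact Or.inr h
  · rcases ht.1.2 with (h | h) | h
    · exact absurd (show t = 0 from h) (hθ.1.trans hθt).ne'
    · exact Or.inl h
    · exact Or.inr h

lemma BB_cases (G : Gr D P d E) (hZ : IsClosed Z) {x : M} (hx : x ∈ BB D P Z) :
    x ∈ Z ∨ (∃ h : Sg D Z, x ∈ h.g) ∨ (x ∈ P ∧ x ∉ Z) := by
  by_cases hxZ : x ∈ Z
  · exact Or.inl hxZ
  by_cases hxP : x ∈ P
  · exact Or.inr (Or.inr ⟨hxP, hxZ⟩)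
  rcases hx with (h | h) | h
  · exact absurd h hxP
  · obtain ⟨k, θ, hθ, rfl⟩ := mem_iUnion.1 h
    have h0 : θ ≠ 0 := fun e => hxP (by simpa [e] using G.e0 k)
    have h1 : θ ≠ 1 := fun e => hxP (by simpa [e] using G.e1 k)
    obtain ⟨h', rfl, hm⟩ := exists_sg hZ k ⟨lt_of_le_of_ne hθ.1 h0.symm, lt_of_le_of_ne hθ.2 h1⟩ hxZ
    exact Or.inr (Or.inl ⟨h', θ, hm, rfl⟩)
  · exact absurd h hxZ

lemma Sg.g_BB (h : Sg D Z) : h.g ⊆ BB D P Z := fun _ hx =>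
  Or.inl (Or.inr (mem_iUnion.2 ⟨_, h.g_sub hx⟩))

lemma Sg.a_mem (h : Sg D Z) : h.a ∈ arc (D h.k) := ⟨h.s, ⟨h.h0, h.hst.le.trans h.h1⟩, rfl⟩
lemma Sg.b_mem (h : Sg D Z) : h.b ∈ arc (D h.k) := ⟨h.t, ⟨h.h0.trans h.hst.le, h.h1⟩, rfl⟩
lemma arc_BB (k : κ) : arc (D k) ⊆ BB D P Z := fun _ hx => Or.inl (Or.inr (mem_iUnion.2 ⟨k, hx⟩))

variable [Finite κ]

lemma isClosed_BB (G : Gr D P d E) (hZ : IsClosed Z) : IsClosed (BB D P Z) :=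
  (G.fin.isClosed.union (isClosed_iUnion_of_finite fun k => (isCompact_arc _).isClosed)).union hZ

lemma Sg.isClosed_diff (G : Gr D P d E) (hZ : IsClosed Z) (h : Sg D Z) :
    IsClosed (BB D P Z \ h.g) := by
  classical
  have : BB D P Z \ h.g = P ∪ Z ∪ (⋃ k : {k // k ≠ h.k}, arc (D k)) ∪
      (fun r : ℝ => (D h.k).f r) '' (Icc 0 h.s ∪ Icc h.t 1) := by
    ext x
    constructor
    · rintro ⟨(hx | hx) | hx, hg⟩
      · exact Or.inl (Or.inl (Or.inl hx))
      · obtain ⟨k, hk⟩ := mem_iUnion.1 hx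
        by_cases hkk : k = h.k
        · subst hkk
          obtain ⟨θ, hθ, rfl⟩ := hk
          right
          refine ⟨θ, ?_, rfl⟩
          by_contra hc
          simp only [mem_union, mem_Icc, not_or, not_and_or, not_le] at hc
          exact hg ⟨θ, ⟨hc.1.resolve_left (not_lt.2 hθ.1), hc.2.resolve_right (not_lt.2 hθ.2)⟩, rfl⟩
        · exact Or.inl (Or.inr (mem_iUnion.2 ⟨⟨k, hkk⟩, hk⟩))
      · exact Or.inl (Or.inl (Or.inr hx))
    · rintro (((hx | hx) | hx) | hx)
      · exact ⟨Or.inl (Or.inl hx), fun hg => h.not_P G hg hx⟩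
      · exact ⟨Or.inr hx, fun hg => h.not_Z hg hx⟩
      · obtain ⟨⟨k, hkk⟩, hk⟩ := mem_iUnion.1 hx
        refine ⟨arc_BB _ hk, fun hg => ?_⟩
        obtain ⟨θ, hθ, rfl⟩ := hk
        obtain ⟨θ', hθ', e⟩ := hg
        simp only at e
        have hθP : (D k).f θ ∉ P := e ▸ G.oP _ _ (h.Ioo_sub hθ')
        have h0 : θ ≠ 0 := fun e => hθP (by simpa [e] using G.e0 k)
        have h1 : θ ≠ 1 := fun e => hθP (by simpa [e] using G.e1 k)
        exact hkk (G.disj _ _ θ ⟨lt_of_le_of_ne hθ.1 h0.symm, lt_of_le_of_ne hθ.2 h1⟩ _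
          (h.Ioo_sub hθ') e.symm)
      · obtain ⟨θ, hθ, rfl⟩ := hx
        have h1 : θ ∈ Icc (0 : ℝ) 1 := by
          rcases hθ with hθ | hθ
          · exact ⟨hθ.1, hθ.2.trans (h.hst.le.trans h.h1)⟩
          · exact ⟨(h.h0.trans h.hst.le).trans hθ.1, hθ.2⟩
        refine ⟨arc_BB _ ⟨θ, h1, rfl⟩, ?_⟩
        rintro ⟨θ', hθ', e⟩
        have := (D h.k).inj_real e
        subst this
        rcases hθ with hθ | hθ
        · exact absurd hθ'.1 (not_lt.2 hθ.2)
        · exact absurd hθ'.2 (not_lt.2 hθ.1)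
  rw [this]
  refine (((G.fin.isClosed.union hZ)).union
    (isClosed_iUnion_of_finite fun k => (isCompact_arc _).isClosed)).union ?_
  exact ((isCompact_Icc.union isCompact_Icc).image (D h.k).cont_real).isClosed

/-- collar radius -/
noncomputable def Sg.rad (P : Set M) (h : Sg D Z) (θ : ℝ) : ℝ :=
  infDist (θ : ℂ) ((D h.k).f ⁻¹' (BB D P Z \ h.g))

/-- the two open sides of the collar (`e = 1` or `e = -1`) -/
def Sg.side (P : Set M) (h : Sg D Z) (e : ℝ) : Set M :=
  (D h.k).f '' {w | w.re ∈ Ioo h.s h.t ∧ 0 < e * w.im ∧ e * w.im < h.rad P w.re}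

def Sg.col (P : Set M) (h : Sg D Z) : Set M :=
  (D h.k).f '' {w | w.re ∈ Ioo h.s h.t ∧ |w.im| < h.rad P w.re}

lemma Sg.rad_cont (h : Sg D Z) : Continuous (h.rad P) :=
  (continuous_infDist_pt _).comp Complex.continuous_ofReal

lemma Sg.Y_ne (h : Sg D Z) : ((D h.k).f ⁻¹' (BB D P Z \ h.g)).Nonempty :=
  ⟨(h.s : ℂ), arc_BB _ h.a_mem, by
    rintro ⟨θ, hθ, e⟩
    exact hθ.1.ne' ((D h.k).inj_real e)⟩

lemma Sg.rad_pos (G : Gr D P d E) (hZ : IsClosed Z) (h : Sg D Z) {θ : ℝ} (hθ : θ ∈ Ioo h.s h.t) :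
    0 < h.rad P θ :=
  (((h.isClosed_diff G hZ).preimage (D h.k).cont).notMem_iff_infDist_pos h.Y_ne).1
    fun hm => hm.2 ⟨θ, hθ, rfl⟩

lemma Sg.col_BB (h : Sg D Z) {x : M} (hx : x ∈ h.col P) (hB : x ∈ BB D P Z) : x ∈ h.g := by
  obtain ⟨w, ⟨hw, hr⟩, rfl⟩ := hx
  by_contra hg
  have h1 : h.rad P w.re ≤ dist (w.re : ℂ) w := infDist_le_dist_of_mem ⟨hB, hg⟩
  have h2 : dist (w.re : ℂ) w = |w.im| := by
    rw [dist_comm, dist_eq_norm]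
    have : w - (w.re : ℂ) = w.im * Complex.I := by apply Complex.ext <;> simp
    rw [this]; simp
  linarith

lemma Sg.isOpen_col (h : Sg D Z) : IsOpen (h.col P) := by
  apply (D h.k).emb.isOpenMap
  refine (isOpen_Ioo.preimage Complex.continuous_re).inter ?_
  exact isOpen_lt (Complex.continuous_im.abs) (h.rad_cont.comp Complex.continuous_re)

lemma Sg.g_col (G : Gr D P d E) (hZ : IsClosed Z) (h : Sg D Z) : h.g ⊆ h.col P := by
  rintro _ ⟨θ, hθ, rfl⟩
  exact ⟨θ, ⟨by simpa using hθ, by simpa using h.rad_pos G hZ hθ⟩, rfl⟩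

lemma Sg.side_col (h : Sg D Z) {e : ℝ} (he : e = 1 ∨ e = -1) : h.side P e ⊆ h.col P := by
  rintro _ ⟨w, ⟨h1, h2, h3⟩, rfl⟩
  refine ⟨w, ⟨h1, ?_⟩, rfl⟩
  rcases he with rfl | rfl
  · rw [abs_lt]; constructor <;> linarith
  · rw [abs_lt]; constructor <;> linarith

lemma Sg.side_BB (h : Sg D Z) {e : ℝ} (he : e = 1 ∨ e = -1) : h.side P e ⊆ (BB D P Z)ᶜ := by
  intro x hx hB
  have h1 := h.col_BB (h.side_col he hx) hB
  obtain ⟨w, ⟨-, h2, -⟩, rfl⟩ := hx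
  obtain ⟨θ, hθ, e'⟩ := h1
  have := (D h.k).emb.injective e'
  subst this
  simp at h2

lemma Sg.col_cases (h : Sg D Z) {x : M} (hx : x ∈ h.col P) :
    x ∈ h.g ∨ x ∈ h.side P 1 ∨ x ∈ h.side P (-1) := by
  obtain ⟨w, ⟨h1, h2⟩, rfl⟩ := hx
  rw [abs_lt] at h2
  rcases lt_trichotomy w.im 0 with h | h | h
  · right; right; exact ⟨w, ⟨h1, by linarith, by linarith⟩, rfl⟩
  · left; exact ⟨w.re, h1, congrArg _ (by apply Complex.ext <;> simp [h])⟩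
  · right; left; exact ⟨w, ⟨h1, by linarith, by linarith⟩, rfl⟩

lemma Sg.side_conn (G : Gr D P d E) (hZ : IsClosed Z) (h : Sg D Z) {e : ℝ} (he : e = 1 ∨ e = -1) :
    IsPreconnected (h.side P e) := by
  have hee : e * e = 1 := by rcases he with rfl | rfl <;> norm_num
  have : h.side P e = (fun p : ℝ × ℝ => (D h.k).f (p.1 + (e * (p.2 * h.rad P p.1) : ℝ) * Complex.I)) ''
      (Ioo h.s h.t ×ˢ Ioo 0 1) := by
    ext x
    constructor
    · rintro ⟨w, ⟨h1, h2, h3⟩, rfl⟩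
      have hr : 0 < h.rad P w.re := h2.trans h3
      refine ⟨(w.re, e * w.im / h.rad P w.re), ⟨h1, by positivity, by rwa [div_lt_one hr]⟩, ?_⟩
      simp only
      congr 1
      rw [div_mul_cancel₀ _ hr.ne', ← mul_assoc, hee]
      apply Complex.ext <;> simp
    · rintro ⟨⟨x, y⟩, ⟨h1, h2, h3⟩, rfl⟩
      simp only at h1 h2 h3
      have hr0 := h.rad_pos G hZ h1
      have e1 : ∀ y : ℝ, e * (e * y) = y := fun y => by rw [← mul_assoc, hee, one_mul]
      refine ⟨_, ⟨by simpa using h1, ?_, ?_⟩, rfl⟩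
      · simp [e1]; positivity
      · simp [e1]; nlinarith
  rw [this]
  refine (isPreconnected_Ioo.prod isPreconnected_Ioo).image _ (Continuous.continuousOn ?_)
  refine (D h.k).cont.comp ?_
  have := (h.rad_cont (P := P))
  fun_prop

noncomputable def Sg.mid (h : Sg D Z) : ℝ := (h.s + h.t) / 2

lemma Sg.mid_mem (h : Sg D Z) : h.mid ∈ Ioo h.s h.t := by
  have := h.hst
  constructor <;> rw [Sg.mid] <;> linarith

/-- base points on the sides -/
noncomputable def Sg.x (P : Set M) (h : Sg D Z) (e : ℝ) : M :=
  (D h.k).f (h.mid + (e * (h.rad P h.mid / 2) : ℝ) * Complex.I)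

lemma Sg.x_mem (G : Gr D P d E) (hZ : IsClosed Z) (h : Sg D Z) {e : ℝ} (he : e = 1 ∨ e = -1) :
    h.x P e ∈ h.side P e := by
  have hee : e * e = 1 := by rcases he with rfl | rfl <;> norm_num
  have := h.rad_pos G hZ h.mid_mem
  refine ⟨_, ⟨by simpa using h.mid_mem, ?_, ?_⟩, rfl⟩
  · simp [← mul_assoc, hee]; positivity
  · simp [← mul_assoc, hee]; linarith

end S14
end

section
open Set Filter Topology Metric unitInterval
namespace S14

universe u
variable {M : Type u} [MetricSpace M]
variable {κ ι α : Type*} {D : κ → Disc M} {P : Set M} {d : ι → Disc M} {E : α → Disc M} {Z : Set M}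

def Om (P : Set M) (S : Set (Sg D Z)) : Set M := (BB D P Z \ ⋃ h ∈ S, h.g)ᶜ

lemma BBc_Om (S : Set (Sg D Z)) : (BB D P Z)ᶜ ⊆ Om P S := compl_subset_compl.2 diff_subset

lemma Om_mono {S S' : Set (Sg D Z)} (h : S ⊆ S') : Om P S ⊆ Om P S' :=
  compl_subset_compl.2 (diff_subset_diff_right (biUnion_subset_biUnion_left h))

lemma g_Om {S : Set (Sg D Z)} {h : Sg D Z} (hS : h ∈ S) : h.g ⊆ Om P S :=
  fun _ hx hc => hc.2 (mem_biUnion hS hx)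

lemma Om_g (G : Gr D P d E) {S : Set (Sg D Z)} {h : Sg D Z} {x : M} (hx : x ∈ Om P S)
    (hg : x ∈ h.g) : h ∈ S := by
  by_contra hS
  refine hx ⟨h.g_BB hg, fun hc => ?_⟩
  obtain ⟨h', hS', hg'⟩ := mem_iUnion₂.1 hc
  exact hS (h.g_eq G hg hg' ▸ hS')

lemma Om_Z {S : Set (Sg D Z)} {x : M} (hx : x ∈ Om P S) : x ∉ Z := by
  intro hZ
  refine hx ⟨Or.inr hZ, fun hc => ?_⟩
  obtain ⟨h', hS', hg'⟩ := mem_iUnion₂.1 hc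
  exact h'.not_Z hg' hZ

lemma mem_Om {S : Set (Sg D Z)} {x : M} (h : x ∈ BB D P Z → ∃ h ∈ S, x ∈ h.g) : x ∈ Om P S := by
  rintro ⟨h1, h2⟩
  obtain ⟨h', hS, hg⟩ := h h1
  exact h2 (mem_biUnion hS hg)

lemma Om_cases {S : Set (Sg D Z)} {x : M} (h : x ∈ Om P S) (hB : x ∈ BB D P Z) : ∃ h ∈ S, x ∈ h.g := by
  by_contra hc
  exact h ⟨hB, fun h' => hc (by simpa using h')⟩

def Sg.cl (h : Sg D Z) : Set M := (fun r : ℝ => (D h.k).f r) '' Icc h.s h.t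

lemma Sg.cl_cases (h : Sg D Z) (hg : h.Good) {x : M} (hx : x ∈ h.cl) : x ∈ Z ∨ x ∈ h.g := by
  obtain ⟨r, hr, rfl⟩ := hx
  rcases hr.1.eq_or_lt with e | e
  · left; subst e; exact hg.1
  rcases hr.2.eq_or_lt with e' | e'
  · left; subst e'; exact hg.2
  · exact Or.inr ⟨r, ⟨e, e'⟩, rfl⟩

lemma Om_cl (G : Gr D P d E) {S : Set (Sg D Z)} {h : Sg D Z} (hg : h.Good) (hS : h ∉ S) {x : M}
    (hx : x ∈ Om P S) : x ∉ h.cl := fun hc =>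
  (h.cl_cases hg hc).elim (Om_Z hx) fun h' => hS (Om_g G hx h')

variable [Finite κ]

lemma isOpen_Om (G : Gr D P d E) (hZ : IsClosed Z) (S : Set (Sg D Z)) : IsOpen (Om P S) := by
  rw [Om, isOpen_compl_iff]
  have : BB D P Z \ ⋃ h ∈ S, h.g = BB D P Z ∩ ⋂ h ∈ S, (BB D P Z \ h.g) := by
    ext x
    constructor
    · exact fun h => ⟨h.1, mem_iInter₂.2 fun h' hS => ⟨h.1, fun hg => h.2 (mem_biUnion hS hg)⟩⟩
    · refine fun h => ⟨h.1, fun hc => ?_⟩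
      obtain ⟨h', hS, hg⟩ := mem_iUnion₂.1 hc
      exact (mem_iInter₂.1 h.2 h' hS).2 hg
  rw [this]
  exact (isClosed_BB G hZ).inter (isClosed_biInter fun h _ => h.isClosed_diff G hZ)

lemma mk_loop (G : Gr D P d E) (hZ : IsClosed Z) {S : Set (Sg D Z)} {h : Sg D Z} (hS : h ∉ S)
    (hg : h.Good) (hj : JoinedIn (Om P S) (h.x P 1) (h.x P (-1))) :
    ∃ l : Lp M, (∀ x ∈ l.supp, x ∉ Z) ∧ nn l (FF (D h.k) h.a h.b) = -1 ∧
      ∀ h' ∉ S, h' ≠ h → h'.Good → nn l (FF (D h'.k) h'.a h'.b) = 1 := by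
  have hr := h.rad_pos G hZ h.mid_mem
  set η := h.rad P h.mid / 2 with hη
  let l : Lp M :=
    { P := hj.somePath
      X := fun τ => (D h.k).f (h.mid + (η * (2 * τ - 1) : ℝ) * Complex.I)
      hP := hj.somePath.continuous
      hX := (D h.k).cont.comp (by fun_prop)
      h1 := by rw [hj.somePath.target, Sg.x]; norm_num [η]
      h0 := by rw [hj.somePath.source, Sg.x]; norm_num [η] }
  have hPO : ∀ τ, l.P τ ∈ Om P S := hj.somePath_mem
  have hXc : ∀ τ, l.X τ ∈ h.col P := fun τ => by
    refine ⟨_, ⟨by simpa using h.mid_mem, ?_⟩, rfl⟩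
    have h1 : |2 * (τ : ℝ) - 1| ≤ 1 := by
      rw [abs_le]; constructor <;> linarith [τ.2.1, τ.2.2]
    have h2 : 0 < η := by positivity
    have : |η * (2 * (τ : ℝ) - 1)| < h.rad P h.mid := by
      rw [abs_mul, abs_of_pos h2]; nlinarith
    simpa [abs_mul] using this
  refine ⟨l, ?_, ?_, ?_⟩
  · rintro x (⟨τ, rfl⟩ | ⟨τ, rfl⟩) hxZ
    · exact Om_Z (hPO τ) hxZ
    · exact h.not_Z (h.col_BB (hXc τ) (Or.inr hxZ)) hxZ
  · exact nn_cross l (D h.k) h.mid_mem.1 h.mid_mem.2 (by positivity) (fun τ => Om_cl G hg hS (hPO τ))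
      (fun τ => rfl)
  · intro h' hS' hne hg'
    apply nn_avoid l (D h'.k) h'.hst
    rintro x (⟨τ, rfl⟩ | ⟨τ, rfl⟩) hc
    · exact Om_cl G hg' hS' (hPO τ) hc
    · rcases h'.cl_cases hg' hc with h1 | h1
      · exact h.not_Z (h.col_BB (hXc τ) (Or.inr h1)) h1
      · exact hne (h'.g_eq G h1 (h.col_BB (hXc τ) (h'.g_BB h1)))

def Ind (F : Set (Sg D Z)) : Prop := (∀ h ∈ F, h.Good) ∧ F.Finite ∧ ∃ l : Sg D Z → Lp M,
  (∀ h ∈ F, (∀ x ∈ (l h).supp, x ∉ Z) ∧ nn (l h) (FF (D h.k) h.a h.b) = -1) ∧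
  ∀ h ∈ F, ∀ h' ∈ F, h ≠ h' → nn (l h) (FF (D h'.k) h'.a h'.b) = 1 ∨
    nn (l h') (FF (D h.k) h.a h.b) = 1

lemma Ind.insert (G : Gr D P d E) (hZ : IsClosed Z) {F : Set (Sg D Z)} (hF : Ind F) {h : Sg D Z}
    (hhF : h ∉ F) (hg : h.Good)
    (hj : JoinedIn (Om P {h' | h'.Good ∧ h' ∉ insert h F}) (h.x P 1) (h.x P (-1))) :
    Ind (insert h F) := by
  classical
  obtain ⟨h1, h2, l, h3, h4⟩ := hF
  obtain ⟨l0, a1, a2, a3⟩ := mk_loop G hZ (fun hc => hc.2 (mem_insert _ _)) hg hj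
  refine ⟨fun h' hh' => hh'.elim (fun e => e ▸ hg) (h1 h'), h2.insert h, Function.update l h l0, ?_, ?_⟩
  · rintro h' (rfl | hh')
    · simpa using ⟨a1, a2⟩
    · have n1 : h' ≠ h := fun e => hhF (e ▸ hh')
      rw [Function.update_of_ne n1]
      exact h3 h' hh'
  · have key : ∀ h' ∈ F, nn l0 (FF (D h'.k) h'.a h'.b) = 1 := fun h' hh' =>
      a3 h' (fun hc => hc.2 (mem_insert_of_mem _ hh')) (fun e => hhF (e ▸ hh')) (h1 h' hh')
    rintro h' (rfl | hh') h'' (rfl | hh'') hne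
    · exact absurd rfl hne
    · left; simpa using key _ hh''
    · right; simpa using key _ hh'
    · have n1 : h' ≠ h := fun e => hhF (e ▸ hh')
      have n2 : h'' ≠ h := fun e => hhF (e ▸ hh'')
      rw [Function.update_of_ne n1, Function.update_of_ne n2]
      exact h4 _ hh' _ hh'' hne

lemma nn_sq' (l : Lp M) (j : Disc M) {p q : M} (hp : p ∈ range j.f) (hq : q ∈ range j.f)
    (hp' : p ∉ l.supp) (hq' : q ∉ l.supp) : nn l (FF j p q) = 1 ∨ nn l (FF j p q) = -1 :=
  nn_sq l ((FF_cont' j hp hq).mono fun _ hx e => hq' (e ▸ hx))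
    fun _ hx => FF_ne j hp hq (fun e => hp' (e ▸ hx)) (fun e => hq' (e ▸ hx))

lemma const_lemma (G : Gr D P d E) (hZc : IsPreconnected Z) (p : α → M)
    (hp : ∀ a, (Z ∩ range (E a).f).Nonempty → p a ∈ Z ∩ range (E a).f) (l l' : Lp M)
    (hl : ∀ x ∈ l.supp, x ∉ Z) (hl' : ∀ x ∈ l'.supp, x ∉ Z)
    (heq : ∀ a b i, nn l (FF (d i) (p a) (p b)) = 1 ↔ nn l' (FF (d i) (p a) (p b)) = 1)
    (c : α) {x y : M} (hx : x ∈ Z) (hy : y ∈ Z) (hxc : x ∈ range (E c).f) (hyc : y ∈ range (E c).f) :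
    nn l (FF (E c) x y) = nn l' (FF (E c) x y) := by
  have nl : ∀ x ∈ Z, x ∉ l.supp := fun x hx h => hl x h hx
  have nl' : ∀ x ∈ Z, x ∉ l'.supp := fun x hx h => hl' x h hx
  have hpZ : ∀ a, ∀ x ∈ Z, x ∈ range (E a).f → p a ∈ Z ∧ p a ∈ range (E a).f :=
    fun a x h1 h2 => hp a ⟨x, h1, h2⟩
  -- agreement statement at a point in a chart
  let u : α → M → Prop := fun a x => nn l (FF (E a) x (p a)) = nn l' (FF (E a) x (p a))
  have step : ∀ a, ∀ x ∈ Z, ∀ y ∈ Z, x ∈ range (E a).f → y ∈ range (E a).f →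
      ((u a x ↔ u a y) ↔ nn l (FF (E a) x y) = nn l' (FF (E a) x y)) := by
    intro a x hx y hy hxa hya
    obtain ⟨h1, h2⟩ := hpZ a x hx hxa
    have c1 := nn_cocycle l (E a) hxa hya h2 (nl _ hx) (nl _ hy) (nl _ h1)
    have c2 := nn_cocycle l' (E a) hxa hya h2 (nl' _ hx) (nl' _ hy) (nl' _ h1)
    simp only [u]
    rw [← c1, ← c2]
    rcases nn_sq' l (E a) hxa hya (nl _ hx) (nl _ hy) with e1 | e1 <;>
    rcases nn_sq' l' (E a) hxa hya (nl' _ hx) (nl' _ hy) with e2 | e2 <;>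
    rcases nn_sq' l (E a) hya h2 (nl _ hy) (nl _ h1) with e3 | e3 <;>
    rcases nn_sq' l' (E a) hya h2 (nl' _ hy) (nl' _ h1) with e4 | e4 <;>
    rw [e1, e2, e3, e4] <;> norm_num
  have change : ∀ a b, ∀ x ∈ Z, x ∈ range (E a).f → x ∈ range (E b).f → (u a x ↔ u b x) := by
    intro a b x hx hxa hxb
    obtain ⟨i, hia, hib⟩ := G.pair a b ⟨x, hxa, hxb⟩
    obtain ⟨h1, h2⟩ := hpZ a x hx hxa
    obtain ⟨h3, h4⟩ := hpZ b x hx hxb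
    simp only [u]
    rw [nn_compat l (E a) (d i) hia hxa h2 (nl _ hx) (nl _ h1),
      nn_compat l' (E a) (d i) hia hxa h2 (nl' _ hx) (nl' _ h1),
      nn_compat l (E b) (d i) hib hxb h4 (nl _ hx) (nl _ h3),
      nn_compat l' (E b) (d i) hib hxb h4 (nl' _ hx) (nl' _ h3)]
    rw [← nn_cocycle l (d i) (hia hxa) (hia h2) (hib h4) (nl _ hx) (nl _ h1) (nl _ h3),
      ← nn_cocycle l' (d i) (hia hxa) (hia h2) (hib h4) (nl' _ hx) (nl' _ h1) (nl' _ h3)]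
    have := heq a b i
    rcases nn_sq' l (d i) (hia h2) (hib h4) (nl _ h1) (nl _ h3) with e1 | e1 <;>
    rcases nn_sq' l' (d i) (hia h2) (hib h4) (nl' _ h1) (nl' _ h3) with e2 | e2 <;>
    rw [e1, e2] at this ⊢ <;> (try norm_num at this) <;> norm_num
  choose A hA using G.covE
  have glob : ∀ x ∈ Z, ∀ y ∈ Z, (u (A x) x ↔ u (A y) y) := by
    intro x hx y hy
    refine hZc.induction₂' (fun x y => x ∈ Z → y ∈ Z → (u (A x) x ↔ u (A y) y)) ?_ ?_ hx hy hx hy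
    · intro x hx
      have e1 := nn_locconst l (E (A x)) (hA x) (nl x hx)
      have e2 := nn_locconst l' (E (A x)) (hA x) (nl' x hx)
      have e3 := (E (A x)).isOpen.mem_nhds (hA x)
      filter_upwards [nhdsWithin_le_nhds e1, nhdsWithin_le_nhds e2, nhdsWithin_le_nhds e3,
        self_mem_nhdsWithin] with y h1 h2 h3 h4
      have : u (A x) x ↔ u (A y) y := by
        rw [← change (A x) (A y) y h4 h3 (hA y)]
        exact ((step (A x) y h4 x hx h3 (hA x)).2 (by rw [h1, h2])).symm
      exact ⟨fun _ _ => this, fun _ _ => this.symm⟩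
    · intro x y w _ hy _ h1 h2 h3 h4
      exact (h1 h3 hy).trans (h2 hy h4)
  rw [← step c x hx y hy hxc hyc, change c (A x) x hx hxc (hA x), change c (A y) y hy hyc (hA y)]
  exact glob x hx y hy

lemma Ind.bound [Finite α] [Finite ι] (G : Gr D P d E) (hZc : IsConnected Z) {F : Set (Sg D Z)}
    (hF : Ind F) : F.ncard ≤ Nat.card (α → α → ι → Prop) := by
  classical
  obtain ⟨h1, h2, l, h3, h4⟩ := hF
  let p : α → M := fun a => if h : (Z ∩ range (E a).f).Nonempty then h.some else hZc.nonempty.some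
  have hp : ∀ a, (Z ∩ range (E a).f).Nonempty → p a ∈ Z ∩ range (E a).f := fun a h => by
    simp only [p, dif_pos h]; exact h.some_mem
  let w : Sg D Z → (α → α → ι → Prop) := fun h a b i => nn (l h) (FF (d i) (p a) (p b)) = 1
  have key : ∀ h ∈ F, ∀ h' ∈ F, w h = w h' → nn (l h) (FF (D h.k) h.a h.b) =
      nn (l h') (FF (D h.k) h.a h.b) := by
    intro h hh h' hh' e
    obtain ⟨c, hc1, hc2⟩ := G.arcE h.k
    have ha := hc1 h.a_mem
    have hb := hc1 h.b_mem
    obtain ⟨ga, gb⟩ := h1 h hh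
    have nl : ∀ x ∈ Z, x ∉ (l h).supp := fun x hx h' => (h3 h hh).1 x h' hx
    have nl' : ∀ x ∈ Z, x ∉ (l h').supp := fun x hx h'' => (h3 h' hh').1 x h'' hx
    rw [← nn_compat (l h) (E c) (D h.k) hc2 ha hb (nl _ ga) (nl _ gb),
      ← nn_compat (l h') (E c) (D h.k) hc2 ha hb (nl' _ ga) (nl' _ gb)]
    refine const_lemma G hZc.isPreconnected p hp _ _ (h3 h hh).1 (h3 h' hh').1 ?_ c ga gb ha hb
    intro a b i
    exact iff_of_eq (congrFun (congrFun (congrFun e a) b) i)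
  have inj : InjOn w F := by
    intro h hh h' hh' e
    by_contra hne
    rcases h4 h hh h' hh' hne with h5 | h5
    · have := key h' hh' h hh e.symm
      rw [(h3 h' hh').2, h5] at this; norm_num at this
    · have := key h hh h' hh' e
      rw [(h3 h hh).2, h5] at this; norm_num at this
  rw [← ncard_image_of_injOn inj]
  exact ncard_le_card _

lemma exists_F [Finite α] [Finite ι] (G : Gr D P d E) (hZ : IsClosed Z) (hZc : IsConnected Z) :
    ∃ F : Set (Sg D Z), F.Finite ∧ (∀ h ∈ F, h.Good) ∧ ∀ h : Sg D Z, h.Good → h ∉ F →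
      ¬ JoinedIn (Om P {h' | h'.Good ∧ h' ∉ insert h F}) (h.x P 1) (h.x P (-1)) := by
  by_contra hc
  push Not at hc
  have : ∀ n : ℕ, ∃ F : Set (Sg D Z), Ind F ∧ F.ncard = n := by
    intro n
    induction n with
    | zero =>
      have i : (Lp M) := ⟨fun _ => hZc.nonempty.some, fun _ => hZc.nonempty.some,
        continuous_const, continuous_const, rfl, rfl⟩
      exact ⟨∅, ⟨by simp, by simp, fun _ => i, by simp, by simp⟩, by simp⟩
    | succ n ih =>
      obtain ⟨F, hF, hn⟩ := ih
      obtain ⟨h, hg, hhF, hj⟩ := hc F hF.2.1 hF.1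
      exact ⟨insert h F, hF.insert G hZ hhF hg hj, by rw [ncard_insert_of_notMem hhF hF.2.1, hn]⟩
  obtain ⟨F, hF, hn⟩ := this (Nat.card (α → α → ι → Prop) + 1)
  have := hF.bound G hZc
  omega

end S14
end

section
open Set Filter Topology Metric unitInterval
namespace S14

universe u
variable {M : Type u} [MetricSpace M]
variable {κ ι α : Type*} {D : κ → Disc M} {P : Set M} {d : ι → Disc M} {E : α → Disc M} {Z : Set M}

lemma joined_uIcc (D : Disc M) {W : Set M} {τ e : ℝ} (h : ∀ r ∈ uIcc τ e, D.f r ∈ W) :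
    JoinedIn W (D.f τ) (D.f e) := by
  have h1 : IsPathConnected ((fun r : ℝ => D.f r) '' uIcc τ e) :=
    ((convex_uIcc τ e).isPathConnected nonempty_uIcc).image D.cont_real
  refine (h1.joinedIn _ ⟨τ, left_mem_uIcc, rfl⟩ _ ⟨e, right_mem_uIcc, rfl⟩).mono ?_
  rintro _ ⟨r, hr, rfl⟩; exact h r hr

lemma near_arc (D : Disc M) (x : M) {W : Set M} (hW : W ∈ 𝓝 x) : ∀ᶠ y in 𝓝 x, ∀ θ ∈ Icc (0 : ℝ) 1,
    D.f θ = y → ∃ τ ∈ Icc (0 : ℝ) 1, D.f τ = x ∧ ∀ r ∈ uIcc θ τ, D.f r ∈ W := by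
  by_cases hx : x ∈ arc D
  · obtain ⟨τ, hτ, rfl⟩ := hx
    simp only at hW ⊢
    obtain ⟨δ, hδ, hb⟩ := Metric.mem_nhds_iff.1 (D.cont.continuousAt.preimage_mem_nhds hW)
    have h2 : ∀ᶠ y in 𝓝 (D.f τ), D.inv y ∈ ball (τ : ℂ) δ :=
      (D.contAt_inv ⟨_, rfl⟩).eventually_mem (by rw [D.inv_f]; exact ball_mem_nhds _ hδ)
    filter_upwards [h2] with y hy θ hθ e
    refine ⟨τ, hτ, rfl, fun r hr => hb ?_⟩
    subst e
    rw [D.inv_f, mem_ball, Complex.dist_of_im_eq (by simp)] at hy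
    rw [mem_ball, Complex.dist_of_im_eq (by simp)]
    simp only [Complex.ofReal_re, Real.dist_eq] at hy ⊢
    have := abs_sub_right_of_mem_uIcc hr
    rw [abs_sub_comm] at this hy
    linarith [abs_sub_comm τ θ]
  · filter_upwards [(isCompact_arc D).isClosed.isOpen_compl.mem_nhds hx] with y hy θ hθ e
    exact absurd ⟨θ, hθ, e⟩ hy

lemma near_join (j : Disc M) {x : M} (hx : x ∈ range j.f) {W : Set M} (hW : W ∈ 𝓝 x) :
    ∀ᶠ y in 𝓝 x, JoinedIn (W ∩ range j.f) x y := by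
  obtain ⟨w, rfl⟩ := hx
  obtain ⟨δ, hδ, hb⟩ := Metric.mem_nhds_iff.1 (j.cont.continuousAt.preimage_mem_nhds hW)
  filter_upwards [j.emb.isOpenMap.image_mem_nhds (ball_mem_nhds w hδ)] with y hy
  refine (j.joinedIn ((convex_ball w δ).isPathConnected ⟨w, mem_ball_self hδ⟩)
    ⟨w, mem_ball_self hδ, rfl⟩ hy).mono ?_
  rintro _ ⟨v, hv, rfl⟩
  exact ⟨hb hv, ⟨v, rfl⟩⟩

def Lab (D : κ → Disc M) (P Z : Set M) (c x l : M) : Prop :=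
  (x ∈ Z ∧ l = x) ∨ (∃ h : Sg D Z, x ∈ h.g ∧ l = h.a) ∨ (x ∈ P ∧ x ∉ Z ∧ l = c)

lemma exists_lab (G : Gr D P d E) (hZ : IsClosed Z) (c : M) {x : M} (hx : x ∈ BB D P Z) :
    ∃ l, Lab D P Z c x l := by
  rcases BB_cases G hZ hx with h | ⟨h, hg⟩ | h
  · exact ⟨x, Or.inl ⟨h, rfl⟩⟩
  · exact ⟨h.a, Or.inr (Or.inl ⟨h, hg, rfl⟩)⟩
  · exact ⟨c, Or.inr (Or.inr ⟨h.1, h.2, rfl⟩)⟩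

lemma lab_Z {c x l : M} (hx : x ∈ Z) (h : Lab D P Z c x l) : l = x := by
  rcases h with h | ⟨h, hg, -⟩ | h
  · exact h.2
  · exact absurd hx (h.not_Z hg)
  · exact absurd hx h.2.1

lemma lab_g (G : Gr D P d E) {c x l : M} {h : Sg D Z} (hx : x ∈ h.g) (hl : Lab D P Z c x l) :
    l = h.a := by
  rcases hl with h' | ⟨h', hg, e⟩ | h'
  · exact absurd h'.1 (h.not_Z hx)
  · rw [e, h.g_eq G hx hg]
  · exact absurd h'.1 (h.not_P G hx)

variable [Finite κ]

lemma end_near (D : κ → Disc M) (Z : Set M) (x : M) {W : Set M} (hW : W ∈ 𝓝 x) :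
    ∀ᶠ y in 𝓝 x, ∀ h : Sg D Z,
    y ∈ h.g → x ∉ h.g → JoinedIn W x h.a ∨ JoinedIn W x h.b := by
  have := eventually_all.2 fun k => near_arc (D k) x hW
  filter_upwards [this] with y hy h hg hx
  obtain ⟨θ, hθ, rfl⟩ := hg
  obtain ⟨τ, hτ, rfl, hr⟩ := hy h.k θ (Ioo_subset_Icc_self (h.Ioo_sub hθ)) rfl
  by_cases hc : h.s < τ
  · right
    have ht : h.t ≤ τ := by
      by_contra h'
      exact hx ⟨τ, ⟨hc, not_le.1 h'⟩, rfl⟩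
    apply joined_uIcc
    intro r hr'
    apply hr
    rw [uIcc_of_ge ht] at hr'
    exact mem_uIcc_of_le (hθ.2.le.trans hr'.1) hr'.2
  · left
    apply joined_uIcc
    intro r hr'
    apply hr
    rw [uIcc_of_le (not_lt.1 hc)] at hr'
    exact mem_uIcc_of_ge hr'.1 (hr'.2.trans hθ.1.le)

lemma Rel.refl' {j : Disc M} {U : Set M} {x : M} (h1 : x ∈ U) (h2 : x ∈ range j.f) : Rel j U x x :=
  Rel.of_joinedIn (JoinedIn.refl ⟨h1, h2⟩)

lemma loc_lab (G : Gr D P d E) (hZ : IsClosed Z) {j : Disc M} {U K : Set M} {c : M} (hU : IsOpen U)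
    (hZU : Z ⊆ U) (hKj : K ⊆ range j.f) (hKB : K ⊆ BB D P Z)
    (hK : ∀ h : Sg D Z, (h.g ∩ K).Nonempty → h.Good ∧ Rel j U h.a h.b)
    (hcZ : c ∈ Z) (hcj : c ∈ range j.f) {x : M} (hx : x ∈ K) :
    ∀ᶠ y in 𝓝[K] x, ∀ lx ly, Lab D P Z c x lx → Lab D P Z c y ly → Rel j U lx ly := by
  have hfin : ∀ᶠ y in 𝓝 x, y ∉ P \ {x} :=
    (G.fin.subset diff_subset).isClosed.isOpen_compl.mem_nhds (by simp)
  rcases BB_cases G hZ (hKB hx) with hxZ | ⟨h0, hg0⟩ | ⟨hxP, hxZ⟩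
  · have hW : U ∩ range j.f ∈ 𝓝 x := (hU.inter j.isOpen).mem_nhds ⟨hZU hxZ, hKj hx⟩
    filter_upwards [self_mem_nhdsWithin, nhdsWithin_le_nhds (end_near D Z x hW),
      nhdsWithin_le_nhds (near_join j (hKj hx) hW), nhdsWithin_le_nhds hfin] with y hyK h1 h2 h3 lx ly hlx hly
    rw [lab_Z hxZ hlx]
    rcases hly with ⟨hyZ, rfl⟩ | ⟨h, hg, rfl⟩ | ⟨hyP, hyZ, rfl⟩
    · exact Rel.of_joinedIn (h2.mono inter_subset_left)
    · obtain ⟨g1, g2⟩ := hK h ⟨y, hg, hyK⟩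
      rcases h1 h hg (fun hg' => h.not_Z hg' hxZ) with h4 | h4
      · exact Rel.of_joinedIn h4
      · exact (Rel.of_joinedIn h4).trans g2.symm
    · exact absurd ⟨hyP, fun e => hyZ ((show y = x from e) ▸ hxZ)⟩ h3
  · have hcl := (h0.isClosed_diff G hZ).isOpen_compl.mem_nhds (fun hc : x ∈ _ => hc.2 hg0)
    filter_upwards [self_mem_nhdsWithin, nhdsWithin_le_nhds hcl] with y hyK h1 lx ly hlx hly
    have hyg : y ∈ h0.g := by by_contra h'; exact h1 ⟨hKB hyK, h'⟩
    rw [lab_g G hg0 hlx, lab_g G hyg hly]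
    obtain ⟨g1, g2⟩ := hK h0 ⟨x, hg0, hx⟩
    exact Rel.refl' (hZU g1.1) g2.mem_left
  · have hW : Zᶜ ∈ 𝓝 x := hZ.isOpen_compl.mem_nhds hxZ
    filter_upwards [self_mem_nhdsWithin, nhdsWithin_le_nhds (end_near D Z x hW),
      nhdsWithin_le_nhds hW, nhdsWithin_le_nhds hfin] with y hyK h1 h2 h3 lx ly hlx hly
    have e1 : lx = c := by
      rcases hlx with h | ⟨h, hg, -⟩ | h
      · exact absurd h.1 hxZ
      · exact absurd hxP (h.not_P G hg)
      · exact h.2.2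
    rcases hly with ⟨hyZ, -⟩ | ⟨h, hg, -⟩ | ⟨hyP, hyZ, rfl⟩
    · exact absurd hyZ h2
    · obtain ⟨g1, g2⟩ := hK h ⟨y, hg, hyK⟩
      rcases h1 h hg (fun hg' => h.not_P G hg' hxP) with h4 | h4
      · exact absurd g1.1 h4.target_mem
      · exact absurd g1.2 h4.target_mem
    · rw [e1]; exact Rel.refl' (hZU hcZ) hcj

end S14
end

section
open Set Filter Topology Metric unitInterval
namespace S14

universe u
variable {M : Type u} [MetricSpace M]

lemma planar_core (j Dk : Disc M) {Q KA KB : Set M} {mid ρ e : ℝ}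
    (hQj : Q ⊆ j.f '' ball 0 2) (hfr : frontier Q ⊆ KA ∪ KB) (hA : IsClosed KA) (hB : IsClosed KB)
    (hAB : ∀ x ∈ KA, x ∈ KB → x = Dk.f mid) (hmj : Dk.f mid ∈ range j.f) (hρ : 0 < ρ)
    (he : e = 1 ∨ e = -1)
    (h1 : ∀ w ∈ ball (mid : ℂ) ρ, 0 < e * w.im → Dk.f w ∈ Q)
    (h2 : ∀ w ∈ ball (mid : ℂ) ρ, e * w.im ≤ 0 → Dk.f w ∉ Q)
    (h3 : ∀ r : ℝ, (r : ℂ) ∈ ball (mid : ℂ) ρ → r < mid → Dk.f r ∈ KA)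
    (h4 : ∀ r : ℝ, (r : ℂ) ∈ ball (mid : ℂ) ρ → mid < r → Dk.f r ∈ KB) : False := by
  classical
  have hee : e * e = 1 := by rcases he with rfl | rfl <;> norm_num
  set m := Dk.f mid with hm
  -- shrink
  obtain ⟨δ, hδ, hb⟩ := Metric.mem_nhds_iff.1
    (Dk.cont.continuousAt.preimage_mem_nhds (j.isOpen.mem_nhds hmj))
  obtain ⟨r, hr0, hrρ, hrδ⟩ : ∃ r : ℝ, 0 < r ∧ 2 * r ≤ ρ ∧ 2 * r ≤ δ :=
    ⟨min ρ δ / 2, by positivity, by linarith [min_le_left ρ δ], by linarith [min_le_right ρ δ]⟩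
  let c : ℝ → I → ℂ := fun f τ => mid + r * ((2 * (τ : ℝ) - 1 : ℝ) + (f * (τ * (1 - τ)) : ℝ) * Complex.I)
  have hcc : ∀ f, Continuous (c f) := fun f => by fun_prop
  have cim : ∀ f τ, (c f τ).im = r * (f * (τ * (1 - τ))) := fun f τ => by simp [c]
  have cre : ∀ f τ, (c f τ).re = mid + r * (2 * τ - 1) := fun f τ => by simp [c]
  have c0 : ∀ f, c f 0 = ((mid - r : ℝ) : ℂ) := fun f => by simp [c]; ring
  have c1 : ∀ f, c f 1 = ((mid + r : ℝ) : ℂ) := fun f => by simp [c]; ring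
  have hcb : ∀ f, |f| = 1 → ∀ τ, ‖c f τ - mid‖ < 2 * r := by
    intro f hf τ
    have e1 : c f τ - mid = r * ((2 * (τ : ℝ) - 1 : ℝ) + (f * (τ * (1 - τ)) : ℝ) * Complex.I) := by
      simp [c]
    have t0 := τ.2.1
    have t1 := τ.2.2
    rw [e1, norm_mul, Complex.norm_real, Real.norm_of_nonneg hr0.le, mul_comm]
    refine mul_lt_mul_of_pos_right ?_ hr0
    refine (norm_add_le _ _).trans_lt ?_
    rw [norm_mul, Complex.norm_I, Complex.norm_real, Complex.norm_real, Real.norm_eq_abs,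
      Real.norm_eq_abs, abs_mul, hf, mul_one, one_mul, abs_of_nonneg (mul_nonneg t0 (by linarith))]
    have : |2 * (τ : ℝ) - 1| ≤ 1 := by rw [abs_le]; constructor <;> linarith
    nlinarith [sq_nonneg (2 * (τ : ℝ) - 1)]
  have hce : |e| = 1 := by rcases he with rfl | rfl <;> norm_num
  have hce' : |-e| = 1 := by rw [abs_neg, hce]
  have hcρ : ∀ f, |f| = 1 → ∀ τ, c f τ ∈ ball (mid : ℂ) ρ := fun f hf τ => by
    rw [mem_ball, dist_eq_norm]; exact (hcb f hf τ).trans_le hrρ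
  have hcj : ∀ f, |f| = 1 → ∀ τ, Dk.f (c f τ) ∈ range j.f := fun f hf τ => by
    apply hb; rw [mem_ball, dist_eq_norm]; exact (hcb f hf τ).trans_le hrδ
  have hcm : ∀ f, |f| = 1 → ∀ τ, Dk.f (c f τ) ≠ m := by
    intro f hf τ h
    have h' := Dk.emb.injective h
    have e1 := congrArg Complex.re h'
    have e2 := congrArg Complex.im h'
    rw [cre] at e1; rw [cim] at e2
    simp only [Complex.ofReal_re, Complex.ofReal_im, add_eq_left, mul_eq_zero, hr0.ne', false_or] at e1 e2
    have hf0 : f ≠ 0 := fun h => by simp [h] at hf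
    have ht : (τ : ℝ) = 1 / 2 := by linarith
    rw [ht] at e2
    rcases e2 with e2 | e2 | e2
    · exact hf0 e2
    · norm_num at e2
    · norm_num at e2
  have hKAne : KA.Nonempty := ⟨_, h3 (mid - r) (by simpa [c0] using hcρ e hce 0) (by linarith)⟩
  have hKBne : KB.Nonempty := ⟨_, h4 (mid + r) (by simpa [c1] using hcρ e hce 1) (by linarith)⟩
  -- the angle
  let θ : M → ℝ := fun x => infDist x KA / (infDist x KA + infDist x KB)
  have hden : ∀ x ≠ m, infDist x KA + infDist x KB ≠ 0 := by
    intro x hx h0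
    have a1 : 0 ≤ infDist x KA := infDist_nonneg
    have a2 : 0 ≤ infDist x KB := infDist_nonneg
    exact hx (hAB x ((hA.mem_iff_infDist_zero hKAne).2 (by linarith))
      ((hB.mem_iff_infDist_zero hKBne).2 (by linarith)))
  have hθc : ContinuousOn θ {m}ᶜ := (continuous_infDist_pt _).continuousOn.div
    ((continuous_infDist_pt _).add (continuous_infDist_pt _)).continuousOn (fun x hx => hden x hx)
  have hθA : ∀ x ∈ KA, θ x = 0 := fun x hx => by
    simp only [θ, infDist_zero_of_mem hx, zero_div]
  have hθB : ∀ x ∈ KB, x ≠ m → θ x = 1 := fun x hx hxm => by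
    have := hden x hxm
    simp only [θ, infDist_zero_of_mem hx, add_zero] at this ⊢
    exact div_self this
  let F : M → ℂ := fun x => if x ∈ Q then Complex.exp (2 * Real.pi * Complex.I * θ x) else 1
  have hF : ContinuousOn F {m}ᶜ := by
    apply ContinuousOn.if
    · rintro x ⟨hx, hxf⟩
      rcases hfr hxf with h | h
      · rw [hθA x h]; simp
      · rw [hθB x h hx]; simp [Complex.exp_two_pi_mul_I]
    · exact ((continuousOn_const.mul (Complex.continuous_ofReal.comp_continuousOn
        (hθc.mono inter_subset_left)))).cexp
    · exact continuousOn_const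
  have hF0 : ∀ x, F x ≠ 0 := fun x => by
    simp only [F]; split_ifs
    · exact Complex.exp_ne_zero _
    · exact one_ne_zero
  obtain ⟨m', hm'⟩ := hmj
  obtain ⟨S, hS, hS2⟩ := planar_sqrt (fun w => F (j.f w)) m' (2 + ‖m'‖)
    (hF.comp j.cont.continuousOn fun w hw h => hw (j.emb.injective (by rw [hm']; exact h)))
    (fun w _ => hF0 _) (fun w hw => by
      simp only [F]
      rw [if_neg]
      intro hq
      obtain ⟨v, hv, e⟩ := hQj hq
      rw [j.emb.injective e, mem_ball_zero_iff] at hv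
      linarith [norm_sub_le w m'])
  have hSt : ∀ f, |f| = 1 → Continuous fun τ => S (j.inv (Dk.f (c f τ))) := fun f hf =>
    hS.comp_continuous (j.cont_inv.comp_continuous (Dk.cont.comp (hcc f)) (hcj f hf)) (fun τ h => by
      apply hcm f hf τ
      rw [← j.f_inv (hcj f hf τ), show j.inv (Dk.f (c f τ)) = m' from h, hm'])
  have hSt2 : ∀ f, |f| = 1 → ∀ τ, S (j.inv (Dk.f (c f τ))) ^ 2 = F (Dk.f (c f τ)) := fun f hf τ => by
    rw [hS2, j.f_inv (hcj f hf τ)]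
    intro h
    apply hcm f hf τ
    rw [← j.f_inv (hcj f hf τ), h, hm']
  have r1 := sr_eq (hSt e hce) (hSt2 e hce) (fun τ => hF0 _)
  have r2 := sr_eq (hSt (-e) hce') (hSt2 (-e) hce') (fun τ => hF0 _)
  have q1 : sr (fun τ => F (Dk.f (c (-e) τ))) = 1 := by
    rw [sr_eq (s := fun _ => 1) continuous_const _ (fun τ => hF0 _)]
    · simp
    · intro τ
      simp only [F]
      rw [if_neg]
      · simp
      apply h2 _ (hcρ _ hce' τ)
      rw [cim]
      have : 0 ≤ (τ : ℝ) * (1 - τ) := mul_nonneg τ.2.1 (by linarith [τ.2.2])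
      have : e * (r * (-e * (τ * (1 - τ)))) = - ((e * e) * (r * (τ * (1 - τ)))) := by ring
      rw [this, hee]
      have : 0 ≤ r * ((τ : ℝ) * (1 - τ)) := by positivity
      linarith
  have t0 : θ (Dk.f (c e 0)) = 0 := by
    apply hθA; rw [c0]; exact h3 _ (by simpa [c0] using hcρ e hce 0) (by linarith)
  have t1 : θ (Dk.f (c e 1)) = 1 := by
    refine hθB _ ?_ (hcm e hce 1); rw [c1]; exact h4 _ (by simpa [c1] using hcρ e hce 1) (by linarith)
  have q2 : sr (fun τ => F (Dk.f (c e τ))) = -1 := by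
    rw [sr_eq (s := fun τ => Complex.exp (Real.pi * Complex.I * θ (Dk.f (c e τ)))) _ _ (fun τ => hF0 _)]
    · rw [t0, t1]; simp
    · exact (continuous_const.mul (Complex.continuous_ofReal.comp
        (hθc.comp_continuous (Dk.cont.comp (hcc e)) (hcm e hce)))).cexp
    · intro τ
      rw [← Complex.exp_nat_mul]
      have hdd : (τ = 0 ∨ τ = 1) ∨ (0 < (τ : ℝ) * (1 - τ)) := by
        by_cases g0 : τ = 0
        · exact Or.inl (Or.inl g0)
        by_cases g1 : τ = 1
        · exact Or.inl (Or.inr g1)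
        · exact Or.inr (mul_pos (unitInterval.pos_iff_ne_zero.2 g0)
            (sub_pos.2 (unitInterval.lt_one_iff_ne_one.2 g1)))
      rcases hdd with (rfl | rfl) | g
      · simp only [F]
        rw [if_neg, t0]
        · simp
        · apply h2 _ (hcρ e hce 0); rw [cim]; simp
      · simp only [F]
        rw [if_neg, t1]
        · push_cast; rw [mul_one, ← mul_assoc]; exact Complex.exp_two_pi_mul_I
        · apply h2 _ (hcρ e hce 1); rw [cim]; simp
      · simp only [F]
        rw [if_pos]
        · push_cast; congr 1; ring
        · apply h1 _ (hcρ e hce τ)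
          rw [cim]
          have : e * (r * (e * (τ * (1 - τ)))) = (e * e) * (r * (τ * (1 - τ))) := by ring
          rw [this, hee]; positivity
  rw [q1] at r2
  rw [q2, c0, c1] at r1
  rw [c0, c1, ← r1] at r2
  norm_num at r2

end S14
end

section
open Set Filter Topology Metric unitInterval
namespace S14

universe u
variable {M : Type u} [MetricSpace M]
variable {κ ι α : Type*} {D : κ → Disc M} {P : Set M} {d : ι → Disc M} {E : α → Disc M} {Z : Set M}

section
variable [LocallyConnectedSpace M]

lemma cc_closure {O : Set M} (hO : IsOpen O) {x y : M} (hy : y ∈ closure (connectedComponentIn O x))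
    (hyO : y ∈ O) : y ∈ connectedComponentIn O x := by
  have h1 : connectedComponentIn O y ∈ 𝓝 y :=
    hO.connectedComponentIn.mem_nhds (mem_connectedComponentIn hyO)
  obtain ⟨w, hw1, hw2⟩ := mem_closure_iff_nhds.1 hy _ h1
  have e1 := connectedComponentIn_eq hw1
  have e2 := connectedComponentIn_eq hw2
  rw [e2, ← e1]
  exact mem_connectedComponentIn hyO

lemma cc_frontier {O : Set M} (hO : IsOpen O) {x y : M}
    (hy : y ∈ frontier (connectedComponentIn O x)) : y ∉ O := by
  intro h
  rw [hO.connectedComponentIn.frontier_eq] at hy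
  exact hy.2 (cc_closure hO hy.1 h)
end

lemma cc_sub {O S : Set M} (hS : IsPreconnected S) (hSO : S ⊆ O) {x y : M} (hy : y ∈ S)
    (hyc : y ∈ connectedComponentIn O x) : S ⊆ connectedComponentIn O x := by
  rw [connectedComponentIn_eq hyc]
  exact hS.subset_connectedComponentIn hy hSO

variable [Finite κ]

lemma ne_neg {e : ℝ} (he : e = 1 ∨ e = -1) : -e = 1 ∨ -e = -1 := by
  rcases he with rfl | rfl <;> simp

lemma closed_lab (G : Gr D P d E) (hZ : IsClosed Z) {j : Disc M} {U K : Set M} {c : M} (hU : IsOpen U)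
    (hZU : Z ⊆ U) (hKc : IsClosed K) (hKj : K ⊆ range j.f) (hKB : K ⊆ BB D P Z)
    (hK : ∀ h : Sg D Z, (h.g ∩ K).Nonempty → h.Good ∧ Rel j U h.a h.b)
    (hcZ : c ∈ Z) (hcj : c ∈ range j.f) (R : M → Prop) (hR : ∀ x y, Rel j U x y → R x → R y) :
    IsClosed {x | x ∈ K ∧ ∀ l, Lab D P Z c x l → R l} := by
  rw [isClosed_iff_frequently]
  intro x hx
  have hxK : x ∈ K := hKc.mem_of_frequently_of_tendsto (hx.mono fun y hy => hy.1) tendsto_id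
  refine ⟨hxK, fun l hl => ?_⟩
  obtain ⟨y, ⟨hyK, hy⟩, h2⟩ := (hx.and_eventually (eventually_nhdsWithin_iff.1
    (loc_lab G hZ hU hZU hKj hKB hK hcZ hcj hxK))).exists
  obtain ⟨ly, hly⟩ := exists_lab G hZ c (hKB hyK)
  exact hR _ _ (h2 hyK l ly hl hly).symm (hy _ hly)

lemma Sg.change (h : Sg D Z) {U : Set M} {j : Disc M} (hj : arc (D h.k) ⊆ range j.f) :
    JoinedIn (range (D h.k).f ∩ range j.f) h.a h.b := by
  apply joined_uIcc
  intro r hr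
  rw [uIcc_of_le h.hst.le] at hr
  exact ⟨⟨_, rfl⟩, hj ⟨r, ⟨h.h0.trans hr.1, hr.2.trans h.h1⟩, rfl⟩⟩

variable [LocallyConnectedSpace M]

lemma core (G : Gr D P d E) (hZ : IsClosed Z) {U : Set M} (hU : IsOpen U) (hZU : Z ⊆ U)
    {h : Sg D Z} (hg : h.Good) {e : ℝ} (he : e = 1 ∨ e = -1)
    (hn : h.x P (-e) ∉ connectedComponentIn (BB D P Z)ᶜ (h.x P e))
    (hadj : ∀ h' : Sg D Z, h' ≠ h → (closure (connectedComponentIn (BB D P Z)ᶜ (h.x P e)) ∩ h'.g).Nonempty →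
      h'.Good ∧ Rel (D h'.k) U h'.a h'.b) : Rel (D h.k) U h.a h.b := by
  set Q := connectedComponentIn (BB D P Z)ᶜ (h.x P e) with hQ
  have hO : IsOpen (BB D P Z)ᶜ := (isClosed_BB G hZ).isOpen_compl
  have hQB : Q ⊆ (BB D P Z)ᶜ := connectedComponentIn_subset _ _
  have hxQ : h.x P e ∈ Q := mem_connectedComponentIn (h.side_BB he (h.x_mem G hZ he))
  have hs1 : h.side P e ⊆ Q := cc_sub (h.side_conn G hZ he) (h.side_BB he) (h.x_mem G hZ he) hxQ
  have hs2 : ∀ y ∈ h.side P (-e), y ∉ Q := fun y hy hyQ =>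
    hn (cc_sub (h.side_conn G hZ (ne_neg he)) (h.side_BB (ne_neg he)) hy hyQ (h.x_mem G hZ (ne_neg he)))
  obtain ⟨i, hi⟩ := G.faces Q isPreconnected_connectedComponentIn
    (hQB.trans (compl_subset_compl.2 subset_union_left))
  have hcl : closure Q ⊆ (d i).f '' closedBall 0 2 :=
    closure_minimal (hi.trans (image_mono ball_subset_closedBall))
      ((isCompact_closedBall _ _).image (d i).cont).isClosed
  have hclr : closure Q ⊆ range (d i).f := hcl.trans (image_subset_range _ _)
  -- ball around mid
  have hop : IsOpen {w : ℂ | w.re ∈ Ioo h.s h.t ∧ |w.im| < h.rad P w.re} :=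
    (isOpen_Ioo.preimage Complex.continuous_re).inter
      (isOpen_lt (Complex.continuous_im.abs) (h.rad_cont.comp Complex.continuous_re))
  obtain ⟨ρ, hρ, hb⟩ := Metric.isOpen_iff.1 hop (h.mid : ℂ)
    ⟨by simpa using h.mid_mem, by simpa using h.rad_pos G hZ h.mid_mem⟩
  have hee : e * e = 1 := by rcases he with rfl | rfl <;> norm_num
  have habs : ∀ y : ℝ, |e * y| = |y| := fun y => by rcases he with rfl | rfl <;> simp
  have h1 : ∀ w ∈ ball (h.mid : ℂ) ρ, 0 < e * w.im → (D h.k).f w ∈ Q := fun w hw hp => by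
    obtain ⟨b1, b2⟩ := hb hw
    exact hs1 ⟨w, ⟨b1, hp, by rw [← habs, abs_of_pos hp] at b2; exact b2⟩, rfl⟩
  have h2 : ∀ w ∈ ball (h.mid : ℂ) ρ, e * w.im ≤ 0 → (D h.k).f w ∉ Q := fun w hw hp => by
    obtain ⟨b1, b2⟩ := hb hw
    rcases hp.eq_or_lt with hp | hp
    · intro hq
      refine hQB hq (h.g_BB ⟨w.re, b1, ?_⟩)
      have : w.im = 0 := by
        rcases mul_eq_zero.1 hp with h' | h'
        · rw [h'] at hee; simp at hee
        · exact h'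
      exact congrArg _ (by apply Complex.ext <;> simp [this])
    · refine hs2 _ ⟨w, ⟨b1, by linarith, ?_⟩, rfl⟩
      rw [← habs, abs_of_neg hp] at b2; linarith
  have hgcl : h.g ⊆ closure Q := by
    rintro _ ⟨θ, hθ, rfl⟩
    have hr := h.rad_pos G hZ hθ
    have ht : Tendsto (fun y : ℝ => (D h.k).f (θ + (e * y : ℝ) * Complex.I)) (𝓝[>] 0) (𝓝 ((D h.k).f θ)) := by
      have : Continuous fun y : ℝ => (D h.k).f (θ + (e * y : ℝ) * Complex.I) :=
        (D h.k).cont.comp (by fun_prop)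
      have := (this.tendsto 0).mono_left (nhdsWithin_le_nhds (s := Ioi 0))
      simpa using this
    refine mem_closure_of_tendsto ht ?_
    filter_upwards [Ioo_mem_nhdsGT hr] with y hy
    refine hs1 ⟨_, ⟨by simpa using hθ, ?_, ?_⟩, rfl⟩
    · simpa [← mul_assoc, hee] using hy.1
    · simpa [← mul_assoc, hee] using hy.2
  have hmg : (D h.k).f h.mid ∈ h.g := ⟨_, h.mid_mem, rfl⟩
  have hark : arc (D h.k) ⊆ range (d i).f :=
    G.near _ _ ⟨_, h.g_sub hmg, hcl (hgcl hmg)⟩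
  by_contra hrel
  have hrel' : ¬ Rel (d i) U h.a h.b := fun h' => hrel (h'.change (by
    rw [inter_comm]; exact h.change (U := U) hark))
  set K := closure Q ∩ (BB D P Z \ h.g) with hKdef
  have hKc : IsClosed K := isClosed_closure.inter (h.isClosed_diff G hZ)
  have hKj : K ⊆ range (d i).f := inter_subset_left.trans hclr
  have hKB : K ⊆ BB D P Z := fun x hx => hx.2.1
  have hK : ∀ h' : Sg D Z, (h'.g ∩ K).Nonempty → h'.Good ∧ Rel (d i) U h'.a h'.b := by
    rintro h' ⟨x, hx, hxK⟩
    have hne : h' ≠ h := fun e => hxK.2.2 (e ▸ hx)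
    obtain ⟨g1, g2⟩ := hadj h' hne ⟨x, hxK.1, hx⟩
    exact ⟨g1, g2.change (h'.change (U := U) (G.near _ _ ⟨x, h'.g_sub hx, hcl hxK.1⟩))⟩
  have haj : h.a ∈ range (d i).f := hark h.a_mem
  have hA := closed_lab G hZ hU hZU hKc hKj hKB hK hg.1 haj (fun l => Rel (d i) U h.a l)
    (fun x y hxy hx => hx.trans hxy)
  have hB := closed_lab G hZ hU hZU hKc hKj hKB hK hg.1 haj (fun l => ¬ Rel (d i) U h.a l)
    (fun x y hxy hx hy => hx (hy.trans hxy.symm))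
  have hc : ∀ u v : ℝ, IsClosed ((fun r : ℝ => (D h.k).f r) '' Icc u v) := fun u v =>
    (isCompact_Icc.image (D h.k).cont_real).isClosed
  have hmm := h.mid_mem
  refine planar_core (d i) (D h.k) (Q := Q) (mid := h.mid) hi ?_ (hA.union (hc h.s h.mid))
    (hB.union (hc h.mid h.t)) ?_ (hclr (hgcl hmg)) hρ he h1 h2 ?_ ?_
  · intro x hx
    have hxB : x ∈ BB D P Z := by
      by_contra h'; exact cc_frontier hO hx h'
    by_cases hxg : x ∈ h.g
    · obtain ⟨r, hr, rfl⟩ := hxg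
      rcases le_total r h.mid with h' | h'
      · exact Or.inl (Or.inr ⟨r, ⟨hr.1.le, h'⟩, rfl⟩)
      · exact Or.inr (Or.inr ⟨r, ⟨h', hr.2.le⟩, rfl⟩)
    · have hxK : x ∈ K := ⟨frontier_subset_closure hx, hxB, hxg⟩
      have huni := (loc_lab G hZ hU hZU hKj hKB hK hg.1 haj hxK).self_of_nhdsWithin hxK
      obtain ⟨l, hl⟩ := exists_lab G hZ h.a hxB
      by_cases hr : Rel (d i) U h.a l
      · exact Or.inl (Or.inl ⟨hxK, fun l' hl' => hr.trans (huni _ _ hl hl')⟩)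
      · exact Or.inr (Or.inl ⟨hxK, fun l' hl' hr' => hr (hr'.trans (huni _ _ hl' hl))⟩)
  · rintro x (⟨hxK, hx⟩ | ⟨r, hr, rfl⟩) (⟨hxK', hx'⟩ | ⟨r', hr', er⟩)
    · obtain ⟨l, hl⟩ := exists_lab G hZ h.a hxK.2.1
      exact absurd (hx _ hl) (hx' _ hl)
    · exfalso
      rcases hr'.2.eq_or_lt with h' | h'
      · subst h'
        refine hrel' (hx h.b (Or.inl ⟨?_, er⟩))
        rw [← er]; exact hg.2
      · exact hxK.2.2 ⟨r', ⟨hmm.1.trans_le hr'.1, h'⟩, er⟩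
    · exfalso
      rcases hr.1.eq_or_lt with h' | h'
      · subst h'
        exact hx' h.a (Or.inl ⟨hg.1, rfl⟩) (Rel.refl' (hZU hg.1) haj)
      · exact hxK'.2.2 ⟨r, ⟨h', hr.2.trans_lt hmm.2⟩, rfl⟩
    · have := (D h.k).inj_real er
      subst this
      rw [le_antisymm hr.2 hr'.1]
  · intro r hr hlt
    have := (hb hr).1.1
    simp only [Complex.ofReal_re] at this
    exact Or.inr ⟨r, ⟨this.le, hlt.le⟩, rfl⟩
  · intro r hr hlt
    have := (hb hr).1.2
    simp only [Complex.ofReal_re] at this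
    exact Or.inr ⟨r, ⟨hlt.le, this.le⟩, rfl⟩

end S14
end

section
open Set Filter Topology Metric unitInterval
namespace S14

universe u
variable {M : Type u} [MetricSpace M]
variable {κ ι α : Type*} {D : κ → Disc M} {P : Set M} {d : ι → Disc M} {E : α → Disc M} {Z : Set M}
variable [Finite κ]

lemma nonGood_finite (G : Gr D P d E) : {h : Sg D Z | ¬ h.Good}.Finite := by
  classical
  refine Set.Finite.of_injOn (f := fun h : Sg D Z => (h.k, decide (h.a ∈ Z))) (t := univ)
    (fun _ _ => mem_univ _) ?_ finite_univ
  intro h hh h' hh' e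
  simp only [Prod.mk.injEq, decide_eq_decide] at e
  obtain ⟨ek, ea⟩ := e
  have q1 := h.hst
  have q2 := h'.hst
  have q3 := h.h1
  have q4 := h'.h1
  have q5 := h.h0
  have q6 := h'.h0
  by_cases ha : h.a ∈ Z
  · have t1 : h.t = 1 := h.et.resolve_right fun hb => hh ⟨ha, hb⟩
    have t2 : h'.t = 1 := h'.et.resolve_right fun hb => hh' ⟨ea.1 ha, hb⟩
    have m1 := le_max_left h.s h'.s
    have m2 := le_max_right h.s h'.s
    have m3 : max h.s h'.s < 1 := max_lt (by linarith) (by linarith)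
    refine h.g_eq G (x := (D h.k).f (((max h.s h'.s + 1) / 2 : ℝ) : ℂ))
      ⟨_, ⟨by linarith, by linarith⟩, rfl⟩ ?_
    rw [ek]
    exact ⟨_, ⟨by linarith, by linarith⟩, rfl⟩
  · have t1 : h.s = 0 := h.es.resolve_right ha
    have t2 : h'.s = 0 := h'.es.resolve_right fun hb => ha (ea.2 hb)
    have m1 := min_le_left h.t h'.t
    have m2 := min_le_right h.t h'.t
    have m3 : 0 < min h.t h'.t := lt_min (by linarith) (by linarith)
    refine h.g_eq G (x := (D h.k).f (((min h.t h'.t) / 2 : ℝ) : ℂ))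
      ⟨_, ⟨by linarith, by linarith⟩, rfl⟩ ?_
    rw [ek]
    exact ⟨_, ⟨by linarith, by linarith⟩, rfl⟩

lemma meet_finite (G : Gr D P d E) (hZ : IsClosed Z) {K : Set M} (hK : IsCompact K) (hKZ : K ⊆ Zᶜ) :
    {h : Sg D Z | (h.g ∩ K).Nonempty}.Finite := by
  refine hK.induction_on (p := fun K => {h : Sg D Z | (h.g ∩ K).Nonempty}.Finite) (by simp)
    (fun s t hst ht => ht.subset fun h hh => hh.mono (inter_subset_inter_right _ hst))
    (fun s t hs ht => (hs.union ht).subset ?_) ?_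
  · rintro h ⟨x, hx, h1 | h1⟩
    · exact Or.inl ⟨x, hx, h1⟩
    · exact Or.inr ⟨x, hx, h1⟩
  · intro x hx
    suffices h : ∀ᶠ y in 𝓝 x, ∀ h : Sg D Z, y ∈ h.g → ¬ h.Good ∨ x ∈ h.g by
      refine ⟨_, nhdsWithin_le_nhds h, ?_⟩
      refine ((nonGood_finite G).union (Set.Subsingleton.finite (s := {h : Sg D Z | x ∈ h.g})
        fun h hh h' hh' => h.g_eq G hh hh')).subset ?_
      rintro h ⟨y, hy, hy'⟩
      exact hy' h hy
    filter_upwards [end_near D Z x (hZ.isOpen_compl.mem_nhds (hKZ hx))] with y hy h hg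
    by_contra hc
    push Not at hc
    rcases hy h hg hc.2 with h' | h'
    · exact h'.target_mem hc.1.1
    · exact h'.target_mem hc.1.2

lemma Sg.col_conn (G : Gr D P d E) (hZ : IsClosed Z) (h : Sg D Z) :
    IsPreconnected (h.col P) := by
  have : h.col P = (fun p : ℝ × ℝ => (D h.k).f (p.1 + ((p.2 * h.rad P p.1) : ℝ) * Complex.I)) ''
      (Ioo h.s h.t ×ˢ Ioo (-1) 1) := by
    ext x
    constructor
    · rintro ⟨w, ⟨h1, h2⟩, rfl⟩
      have hr : 0 < h.rad P w.re := (abs_nonneg _).trans_lt h2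
      rw [abs_lt] at h2
      refine ⟨(w.re, w.im / h.rad P w.re), ⟨h1, ?_, ?_⟩, ?_⟩
      · rw [lt_div_iff₀ hr]; linarith
      · rw [div_lt_iff₀ hr]; linarith
      · simp only
        rw [div_mul_cancel₀ _ hr.ne']
        exact congrArg _ (by apply Complex.ext <;> simp)
    · rintro ⟨⟨θ, u⟩, ⟨h1, h2, h3⟩, rfl⟩
      simp only at h1 h2 h3 ⊢
      have hr := h.rad_pos G hZ h1
      refine ⟨_, ⟨by simpa using h1, ?_⟩, rfl⟩
      simp [abs_mul, abs_of_pos hr]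
      have : |u| < 1 := abs_lt.2 ⟨h2, h3⟩
      nlinarith
  rw [this]
  refine IsPreconnected.image (isPreconnected_Ioo.prod isPreconnected_Ioo) _ ?_
  have := h.rad_cont (P := P)
  exact ((D h.k).cont.comp (by fun_prop)).continuousOn


lemma col_Om {S : Set (Sg D Z)} {h : Sg D Z} (hS : h ∈ S) : h.col P ⊆ Om P S := by
  intro x hx
  exact mem_Om fun hB => ⟨h, hS, h.col_BB hx hB⟩

/-- separation property -/
def Sep (P : Set M) (S : Set (Sg D Z)) : Prop := ∀ h ∈ S, ∀ e : ℝ, (e = 1 ∨ e = -1) →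
  h.x P (-e) ∉ connectedComponentIn (Om P (S \ {h})) (h.x P e)

/-- no bad representative -/
def Free (P : Set M) (S : Set (Sg D Z)) (V : Set M) : Prop :=
  ∀ b ∉ S, ∀ e : ℝ, (e = 1 ∨ e = -1) → b.x P e ∉ V

lemma Sg.x_col (G : Gr D P d E) (hZ : IsClosed Z) (h : Sg D Z) {e : ℝ} (he : e = 1 ∨ e = -1) :
    h.x P e ∈ h.col P := h.side_col he (h.x_mem G hZ he)

lemma Sg.x_BB (G : Gr D P d E) (hZ : IsClosed Z) (h : Sg D Z) {e : ℝ} (he : e = 1 ∨ e = -1) :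
    h.x P e ∈ (BB D P Z)ᶜ := h.side_BB he (h.x_mem G hZ he)

lemma Sg.rel_of_sub (h : Sg D Z) (hg : h.Good) {U : Set M} (hZU : Z ⊆ U) (hU : h.g ⊆ U) :
    Rel (D h.k) U h.a h.b := by
  apply Rel.of_joinedIn
  apply joined_uIcc
  intro r hr
  rw [uIcc_of_le h.hst.le] at hr
  refine ⟨?_, ⟨_, rfl⟩⟩
  rcases h.cl_cases hg ⟨r, hr, rfl⟩ with h' | h'
  · exact hZU h'
  · exact hU h'

section
variable [LocallyConnectedSpace M]

lemma all_rel (G : Gr D P d E) (hZ : IsClosed Z) {S : Set (Sg D Z)} (hS : ∀ h ∈ S, h.Good)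
    (sep : Sep P S) {U : Set M} (hU : IsOpen U) (hZU : Z ⊆ U)
    (hbig : {h : Sg D Z | ¬ h.g ⊆ U}.Finite) (n : ℕ) : ∀ h ∈ S, ∀ e : ℝ, (e = 1 ∨ e = -1) →
    Free P S (connectedComponentIn (Om P (S \ {h})) (h.x P e)) →
    {h' : Sg D Z | ¬ h'.g ⊆ U ∧
      (h'.g ∩ (connectedComponentIn (Om P (S \ {h})) (h.x P e) ∪ h.g)).Nonempty}.ncard < n →
    Rel (D h.k) U h.a h.b := by
  induction n with
  | zero => intro h _ e _ _ hn; simp at hn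
  | succ n ih =>
    intro h hhS e he hfree hn
    set V := connectedComponentIn (Om P (S \ {h})) (h.x P e) with hV
    by_cases hgU : h.g ⊆ U
    · exact h.rel_of_sub (hS h hhS) hZU hgU
    set Q := connectedComponentIn (BB D P Z)ᶜ (h.x P e) with hQ
    have hxQ : h.x P e ∈ Q := mem_connectedComponentIn (h.x_BB G hZ he)
    have hxV : h.x P e ∈ V := mem_connectedComponentIn (BBc_Om _ (h.x_BB G hZ he))
    have hQB : Q ⊆ (BB D P Z)ᶜ := connectedComponentIn_subset _ _
    have hQc : IsPreconnected Q := isPreconnected_connectedComponentIn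
    have hQV : Q ⊆ V := cc_sub hQc (hQB.trans (BBc_Om _)) hxQ hxV
    refine core G hZ hU hZU (hS h hhS) he (fun hc => sep h hhS e he (hQV hc)) ?_
    rintro h' hne ⟨y, hyQ, hyg⟩
    obtain ⟨w, hwc, hwQ⟩ := mem_closure_iff.1 hyQ _ h'.isOpen_col (h'.g_col G hZ hyg)
    obtain ⟨b, hb, hwb⟩ : ∃ b : ℝ, (b = 1 ∨ b = -1) ∧ w ∈ h'.side P b := by
      rcases h'.col_cases hwc with h1 | h1 | h1
      · exact absurd (h'.g_BB h1) (hQB hwQ)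
      · exact ⟨1, Or.inl rfl, h1⟩
      · exact ⟨-1, Or.inr rfl, h1⟩
    have hxbQ : h'.x P b ∈ Q :=
      cc_sub (h'.side_conn G hZ hb) (h'.side_BB hb) hwb hwQ (h'.x_mem G hZ hb)
    have hS' : h' ∈ S := by
      by_contra hc
      exact hfree h' hc b hb (hQV hxbQ)
    refine ⟨hS h' hS', ?_⟩
    have hnb := ne_neg hb
    have hnV' : ∀ y ∈ connectedComponentIn (Om P (S \ {h'})) (h'.x P (-b)), y ∉ h.g := by
      intro y hy hyg
      have h1 : h.col P ⊆ _ := cc_sub (h.col_conn G hZ)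
        (col_Om (S := S \ {h'}) ⟨hhS, fun e => hne e.symm⟩) (h.g_col G hZ hyg) hy
      have h2 : Q ⊆ _ := cc_sub hQc (hQB.trans (BBc_Om _)) hxQ (h1 (h.x_col G hZ he))
      have h3 := sep h' hS' (-b) hnb
      rw [neg_neg] at h3
      exact h3 (h2 hxbQ)
    have hcolV : h'.col P ⊆ V := cc_sub (h'.col_conn G hZ)
      (col_Om (S := S \ {h}) ⟨hS', hne⟩) (h'.x_col G hZ hb) (hQV hxbQ)
    have hVV : connectedComponentIn (Om P (S \ {h'})) (h'.x P (-b)) ⊆ V := by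
      refine cc_sub isPreconnected_connectedComponentIn ?_
        (mem_connectedComponentIn (BBc_Om _ (h'.x_BB G hZ hnb))) (hcolV (h'.x_col G hZ hnb))
      intro y hy
      refine mem_Om fun hB => ?_
      obtain ⟨h'', hm, hg''⟩ := Om_cases (connectedComponentIn_subset _ _ hy) hB
      exact ⟨h'', ⟨hm.1, fun e => hnV' y hy ((show h'' = h from e) ▸ hg'')⟩, hg''⟩
    refine ih h' hS' (-b) hnb (fun c hc e' he' hx => hfree c hc e' he' (hVV hx)) ?_
    refine lt_of_lt_of_le (Set.ncard_lt_ncard ?_ (hbig.subset fun _ h => h.1)) (Nat.lt_succ_iff.1 hn)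
    rw [Set.ssubset_def]
    constructor
    · rintro h'' ⟨h1, y, h2, h3⟩
      refine ⟨h1, y, h2, Or.inl ?_⟩
      rcases h3 with h3 | h3
      · exact hVV h3
      · exact hcolV (h'.g_col G hZ h3)
    · intro hc
      have hmg : (D h.k).f h.mid ∈ h.g := ⟨_, h.mid_mem, rfl⟩
      obtain ⟨-, y, h2, h3 | h3⟩ := hc (show h ∈ _ from ⟨hgU, _, hmg, Or.inr hmg⟩)
      · exact hnV' y h3 h2
      · exact hne (h'.g_eq G h3 h2)
end

section
variable [LocallyPathConnectedSpace M]

lemma cc_joined {O : Set M} (hO : IsOpen O) {x y : M} (hy : y ∈ connectedComponentIn O x) :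
    JoinedIn O x y := by
  have hx : x ∈ O := by
    by_contra h
    rw [connectedComponentIn_eq_empty h] at hy
    exact hy
  have h1 : IsPathConnected (connectedComponentIn O x) :=
    (hO.connectedComponentIn.isConnected_iff_isPathConnected).1
      (isConnected_connectedComponentIn_iff.2 hx)
  exact (h1.joinedIn x (mem_connectedComponentIn hx) y hy).mono (connectedComponentIn_subset _ _)

lemma joined_cc {O : Set M} {x y : M} (h : JoinedIn O x y) : y ∈ connectedComponentIn O x := by
  have h1 : range h.somePath ⊆ O := by rintro _ ⟨t, rfl⟩; exact h.somePath_mem t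
  exact (isPreconnected_range h.somePath.continuous).subset_connectedComponentIn
    h.somePath.source_mem_range h1 h.somePath.target_mem_range

lemma exists_Ex (G : Gr D P d E) (hZ : IsClosed Z) {S : Set (Sg D Z)} (hfin : Sᶜ.Finite)
    (sep : Sep P S) : ∃ Ex : Set (Sg D Z), Ex.Finite ∧ Sᶜ ⊆ Ex ∧ ∀ h ∉ Ex, ∃ e : ℝ, (e = 1 ∨ e = -1) ∧
      Free P S (connectedComponentIn (Om P (S \ {h})) (h.x P e)) := by
  classical
  let B : Set M := (fun b : Sg D Z => b.x P 1) '' Sᶜ ∪ (fun b : Sg D Z => b.x P (-1)) '' Sᶜ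
  have hB : B.Finite := (hfin.image _).union (hfin.image _)
  have hBm : ∀ b ∉ S, ∀ e : ℝ, (e = 1 ∨ e = -1) → b.x P e ∈ B := by
    rintro b hb e (rfl | rfl)
    · exact Or.inl ⟨b, hb, rfl⟩
    · exact Or.inr ⟨b, hb, rfl⟩
  have hT : ∀ p : M × M, ∃ T : Set (Sg D Z), T.Finite ∧ (JoinedIn (Om P S) p.1 p.2 →
      ∀ h ∉ T, JoinedIn (Om P (S \ {h})) p.1 p.2) := by
    intro p
    by_cases hp : JoinedIn (Om P S) p.1 p.2
    · refine ⟨{h | (h.g ∩ range hp.somePath).Nonempty}, ?_, fun _ h hh => ⟨hp.somePath, fun t => ?_⟩⟩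
      · refine meet_finite G hZ (isCompact_range hp.somePath.continuous) ?_
        rintro _ ⟨t, rfl⟩; exact Om_Z (hp.somePath_mem t)
      · refine mem_Om fun hb => ?_
        obtain ⟨h', h1, h2⟩ := Om_cases (hp.somePath_mem t) hb
        refine ⟨h', ⟨h1, fun e => hh ⟨_, (show h' = h from e) ▸ h2, t, rfl⟩⟩, h2⟩
    · exact ⟨∅, finite_empty, fun h => absurd h hp⟩
  choose T hT1 hT2 using hT
  refine ⟨Sᶜ ∪ ⋃ p ∈ B ×ˢ B, T p, hfin.union ((hB.prod hB).biUnion fun p _ => hT1 p),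
    subset_union_left, fun h hh => ?_⟩
  have hhS : h ∈ S := by by_contra hc; exact hh (Or.inl hc)
  by_contra hc
  have key : ∀ e : ℝ, (e = 1 ∨ e = -1) → ∃ y ∈ B, JoinedIn (Om P (S \ {h})) (h.x P e) y := by
    intro e he
    by_contra hc'
    refine hc ⟨e, he, fun b hb e' he' hx => hc' ⟨_, hBm b hb e' he', cc_joined (isOpen_Om G hZ _) hx⟩⟩
  obtain ⟨y, hy, hjy⟩ := key 1 (Or.inl rfl)
  obtain ⟨y', hy', hjy'⟩ := key (-1) (Or.inr rfl)
  have hm : Om P (S \ {h}) ⊆ Om P S := Om_mono diff_subset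
  have hx : JoinedIn (Om P S) (h.x P 1) (h.x P (-1)) := by
    refine cc_joined (isOpen_Om G hZ _) ?_
    exact (h.col_conn G hZ).subset_connectedComponentIn (h.x_col G hZ (Or.inl rfl)) (col_Om hhS)
      (h.x_col G hZ (Or.inr rfl))
  have h1 : JoinedIn (Om P S) y y' := ((hjy.mono hm).symm.trans hx).trans (hjy'.mono hm)
  have h2 := hT2 (y, y') h1 h fun hc => hh (Or.inr (mem_biUnion (mk_mem_prod hy hy') hc))
  exact sep h hhS 1 (Or.inl rfl) (joined_cc ((hjy.trans h2).trans hjy'.symm))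

theorem main_gaps [CompactSpace M] [Finite α] [Finite ι] (G : Gr D P d E) (hZ : IsClosed Z)
    (hZc : IsConnected Z) : ∃ Ex : Set (Sg D Z), Ex.Finite ∧ ∀ h ∉ Ex, h.Good ∧
      ∀ U, IsOpen U → Z ⊆ U → Rel (D h.k) U h.a h.b := by
  obtain ⟨F, hF, hFg, hFs⟩ := exists_F G hZ hZc
  set S : Set (Sg D Z) := {h | h.Good ∧ h ∉ F} with hS
  have hSc : Sᶜ.Finite := ((nonGood_finite (Z := Z) G).union hF).subset fun h hh => by
    by_contra hc
    simp only [mem_union, mem_setOf_eq, not_or, not_not] at hc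
    exact hh hc
  have sep : Sep P S := by
    have h1 : ∀ h ∈ S, ¬ JoinedIn (Om P (S \ {h})) (h.x P 1) (h.x P (-1)) := by
      intro h hh
      have e : S \ {h} = {h' | h'.Good ∧ h' ∉ insert h F} := by
        ext h'; simp [hS]; tauto
      rw [e]; exact hFs h hh.1 hh.2
    rintro h hh e (rfl | rfl) hc
    · exact h1 h hh (cc_joined (isOpen_Om G hZ _) hc)
    · rw [neg_neg] at hc
      exact h1 h hh (cc_joined (isOpen_Om G hZ _) hc).symm
  obtain ⟨Ex, h1, h2, h3⟩ := exists_Ex G hZ hSc sep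
  refine ⟨Ex, h1, fun h hh => ?_⟩
  have hhS : h ∈ S := by by_contra hc; exact hh (h2 hc)
  refine ⟨hhS.1, fun U hU hZU => ?_⟩
  obtain ⟨e, he, hfree⟩ := h3 h hh
  refine all_rel G hZ (fun h hh => hh.1) sep hU hZU ?_ _ h hhS e he hfree (Nat.lt_succ_self _)
  refine (meet_finite G hZ hU.isClosed_compl.isCompact (compl_subset_compl.2 hZU)).subset ?_
  intro h hh
  rw [mem_setOf_eq, not_subset] at hh
  obtain ⟨y, hy, hy'⟩ := hh
  exact ⟨y, hy, hy'⟩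
end

end S14
end

section
open Set Filter Topology Metric unitInterval
namespace S14

universe u
variable {M : Type u} [MetricSpace M]
variable {κ ι α : Type*} {D : κ → Disc M} {P : Set M} {d : ι → Disc M} {E : α → Disc M} {Z : Set M}
variable [Finite κ]

lemma Rel.mono {j : Disc M} {U V : Set M} {x y : M} (h : Rel j U x y) (hUV : U ⊆ V) : Rel j V x y := by
  obtain ⟨γ, hγ, h⟩ := h
  exact ⟨γ, hγ.trans hUV, h⟩

lemma Rel.mem_U {j : Disc M} {U : Set M} {x y : M} (h : Rel j U x y) : y ∈ U := by
  obtain ⟨γ, hγ, -⟩ := h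
  exact hγ γ.target_mem_range

lemma arc_rel (G : Gr D P d E) (hZ : IsClosed Z) {Ex : Set (Sg D Z)} {U : Set M} (hU : IsOpen U)
    (hZU : Z ⊆ U) (hEx : ∀ h ∉ Ex, h.Good ∧ Rel (D h.k) U h.a h.b) {k : κ} {τ τ' : ℝ}
    (h0 : 0 ≤ τ) (hτ : τ ≤ τ') (h1 : τ' ≤ 1) (hz : (D k).f τ ∈ Z) (hz' : (D k).f τ' ∈ Z)
    (hno : ∀ h ∈ Ex, h.k = k → h.t ≤ τ' → h.t ≤ τ) : Rel (D k) U ((D k).f τ) ((D k).f τ') := by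
  set K := (fun r : ℝ => (D k).f r) '' Icc τ τ' with hK
  have hKB : K ⊆ BB D P Z := (image_mono (Icc_subset_Icc h0 h1)).trans (arc_BB k)
  have hKj : K ⊆ range (D k).f := by rintro _ ⟨r, -, rfl⟩; exact ⟨_, rfl⟩
  have hgK : ∀ h : Sg D Z, (h.g ∩ K).Nonempty → h.Good ∧ Rel (D k) U h.a h.b := by
    rintro h ⟨_, hg, r, hr, rfl⟩
    have hP := h.not_P G hg
    simp only at hP hg
    have hr0 : r ≠ 0 := by rintro rfl; exact hP (G.e0 k)
    have hr1 : r ≠ 1 := by rintro rfl; exact hP (G.e1 k)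
    obtain ⟨θ, hθ, e⟩ := hg
    simp only at e
    have hk : h.k = k := G.disj _ _ _ (h.Ioo_sub hθ) r
      ⟨lt_of_le_of_ne (h0.trans hr.1) hr0.symm, lt_of_le_of_ne (hr.2.trans h1) hr1⟩ e
    subst hk
    have := (D h.k).inj_real e
    subst this
    refine hEx h fun hc => ?_
    have h3 : τ' < h.t := by
      by_contra h'
      have := hno h hc rfl (not_lt.1 h')
      linarith [hr.1, hθ.2]
    exact h.av τ' ⟨hθ.1.trans_le hr.2, h3⟩ hz'
  have hc : IsPreconnected K := isPreconnected_Icc.image _ (D k).cont_real.continuousOn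
  have key := hc.induction₂' (fun x y => ∀ lx ly, Lab D P Z ((D k).f τ) x lx →
      Lab D P Z ((D k).f τ) y ly → Rel (D k) U lx ly) (fun x hx => by
    filter_upwards [loc_lab G hZ hU hZU hKj hKB hgK hz ⟨_, rfl⟩ hx] with y hy
    exact ⟨hy, fun lx ly h1 h2 => (hy _ _ h2 h1).symm⟩)
    (fun x y w hx hy hw h1 h2 lx lw hlx hlw => by
      obtain ⟨ly, hly⟩ := exists_lab G hZ ((D k).f τ) (hKB hy)
      exact (h1 _ _ hlx hly).trans (h2 _ _ hly hlw))
    (x := (D k).f τ) (y := (D k).f τ') ⟨τ, ⟨le_rfl, hτ⟩, rfl⟩ ⟨τ', ⟨hτ, le_rfl⟩, rfl⟩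
  exact key _ _ (Or.inl ⟨hz, rfl⟩) (Or.inl ⟨hz', rfl⟩)

lemma to_graph [LocallyConnectedSpace M] (G : Gr D P d E) (hZc : IsPreconnected Z)
    (hz : (Z ∩ P).Nonempty) {x : M} (hx : x ∈ Z) :
    ∃ i, x ∈ (d i).f '' closedBall 0 2 ∧ ∀ U, IsOpen U → Z ⊆ U →
      ∃ x' ∈ Z, x' ∈ P ∪ ⋃ k, arc (D k) ∧ x' ∈ (d i).f '' closedBall 0 2 ∧ Rel (d i) U x x' := by
  have hΓ : IsClosed (P ∪ ⋃ k, arc (D k)) :=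
    G.fin.isClosed.union (isClosed_iUnion_of_finite fun k => (isCompact_arc _).isClosed)
  set Γ := P ∪ ⋃ k, arc (D k) with hΓd
  by_cases hxΓ : x ∈ Γ
  · obtain ⟨i, hi⟩ := G.cov x
    exact ⟨i, hi, fun U hU hZU => ⟨x, hx, hxΓ, hi, Rel.refl' (hZU hx) (image_subset_range _ _ hi)⟩⟩
  set W := connectedComponentIn Γᶜ x with hW
  have hxW : x ∈ W := mem_connectedComponentIn hxΓ
  have hWΓ : W ⊆ Γᶜ := connectedComponentIn_subset _ _
  have hWo : IsOpen W := hΓ.isOpen_compl.connectedComponentIn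
  obtain ⟨i, hi⟩ := G.faces W isPreconnected_connectedComponentIn hWΓ
  have hi' : W ⊆ (d i).f '' closedBall 0 2 := hi.trans (image_mono ball_subset_closedBall)
  have hcl : closure W ⊆ (d i).f '' closedBall 0 2 :=
    closure_minimal hi' ((isCompact_closedBall _ _).image (d i).cont).isClosed
  refine ⟨i, hi' hxW, fun U hU hZU => ?_⟩
  by_contra hcon
  have hnb : ∀ y ∈ U, y ∈ range (d i).f → ∀ᶠ y' in 𝓝 y, Rel (d i) U y y' := by
    intro y hyU hyd
    filter_upwards [near_join (d i) hyd (hU.mem_nhds hyU)] with y' hy'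
    exact Rel.of_joinedIn hy'
  have ho : IsOpen {y | y ∈ W ∧ Rel (d i) U x y} := by
    rw [isOpen_iff_mem_nhds]
    rintro y ⟨hyW, hyR⟩
    filter_upwards [hWo.mem_nhds hyW, hnb y hyR.mem_U hyR.mem_right] with y' h1 h2
    exact ⟨h1, hyR.trans h2⟩
  have hsub := hZc.subset_of_closure_inter_subset ho
    ⟨x, hx, hxW, Rel.refl' (hZU hx) (image_subset_range _ _ (hi' hxW))⟩ (by
    rintro y ⟨hyc, hyZ⟩
    have hycW : y ∈ closure W := closure_mono (fun _ h => h.1) hyc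
    have hyd := hcl hycW
    obtain ⟨y', h1, h2, h3⟩ := mem_closure_iff_nhds.1 hyc _
      (hnb y (hZU hyZ) (image_subset_range _ _ hyd))
    have hR : Rel (d i) U x y := h3.trans h1.symm
    have hyΓ : y ∉ Γ := fun hy => hcon ⟨y, hyZ, hy, hyd, hR⟩
    exact ⟨cc_closure hΓ.isOpen_compl hycW hyΓ, hR⟩)
  obtain ⟨z, hzZ, hzP⟩ := hz
  exact hWΓ (hsub hzZ).1 (Or.inl hzP)

theorem TT_of_Gr [ChartedSpace (EuclideanSpace ℝ (Fin 2)) M] [CompactSpace M]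
    [Finite α] [Finite ι] (G : Gr D P d E) (hZ : IsCompact Z) (hZc : IsConnected Z)
    (hz : (Z ∩ P).Nonempty) : ∃ ρ > 0, TT Z ρ := by
  classical
  have : LocallyPathConnectedSpace M :=
    ChartedSpace.locallyPathConnectedSpace (EuclideanSpace ℝ (Fin 2)) M
  obtain ⟨Ex, hExf, hEx⟩ := main_gaps G hZ.isClosed hZc
  have := hExf.to_subtype
  have := G.fin.to_subtype
  let C : P ⊕ (κ × Set Ex) → M → Prop := fun c x => match c with
    | .inl p => x = p
    | .inr (k, T) => ∃ τ ∈ Icc (0 : ℝ) 1, x = (D k).f τ ∧ T = {h : Ex | h.1.k = k ∧ h.1.t ≤ τ}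
  have hC : ∀ x ∈ P ∪ ⋃ k, arc (D k), ∃ c, C c x := by
    rintro x (hx | hx)
    · exact ⟨.inl ⟨x, hx⟩, rfl⟩
    · obtain ⟨k, τ, hτ, rfl⟩ := mem_iUnion.1 hx
      exact ⟨.inr (k, _), τ, hτ, rfl, rfl⟩
  let Zs : ι × (P ⊕ (κ × Set Ex)) → Set M := fun q => {x | x ∈ Z ∧ x ∈ (d q.1).f '' closedBall 0 2 ∧
    ∀ ε > 0, ∃ x' ∈ Z, x' ∈ (d q.1).f '' closedBall 0 2 ∧ C q.2 x' ∧ Rel (d q.1) (thickening ε Z) x x'}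
  refine TT_of_pieces hZ Zs (fun q => d q.1) ?_ (fun q x hx => hx.2.1) ?_
  · intro x hx
    obtain ⟨i, hi, hU⟩ := to_graph G hZc.isPreconnected hz hx
    by_contra hcon
    have h1 : ∀ c, ∃ ε > 0, ¬ ∃ x' ∈ Z, x' ∈ (d i).f '' closedBall 0 2 ∧ C c x' ∧
        Rel (d i) (thickening ε Z) x x' := by
      intro c
      by_contra hc
      push Not at hc
      exact hcon (mem_iUnion.2 ⟨(i, c), hx, hi, fun ε hε => hc ε hε⟩)
    choose ε hε hno using h1
    obtain ⟨z, hzZ, hzP⟩ := hz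
    have : Nonempty (P ⊕ (κ × Set Ex)) := ⟨.inl ⟨z, hzP⟩⟩
    obtain ⟨c0, hc0⟩ := Finite.exists_min ε
    obtain ⟨x', h1, h2, h3, h4⟩ := hU (thickening (ε c0) Z) isOpen_thickening (self_subset_thickening (hε c0) Z)
    obtain ⟨c, hc⟩ := hC x' h2
    exact hno c ⟨x', h1, h3, hc, h4.mono (thickening_mono (hc0 c) Z)⟩
  · rintro ⟨i, c⟩ x ⟨hxZ, hxd, hx⟩ y ⟨hyZ, hyd, hy⟩ ε hε
    obtain ⟨x', hx1, hx2, hx3, hx4⟩ := hx ε hε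
    obtain ⟨y', hy1, hy2, hy3, hy4⟩ := hy ε hε
    refine hx4.trans (Rel.trans ?_ hy4.symm)
    have hZU := self_subset_thickening hε Z
    rcases c with p | ⟨k, T⟩
    · have e1 : x' = p := hx3
      have e2 : y' = p := hy3
      rw [e2, ← e1]
      exact Rel.refl' (hZU hx1) (image_subset_range _ _ hx2)
    · obtain ⟨τ, hτ, rfl, hT⟩ := hx3
      obtain ⟨τ', hτ', rfl, hT'⟩ := hy3
      simp only at *
      have key : ∀ τ τ' : ℝ, τ ∈ Icc (0 : ℝ) 1 → τ' ∈ Icc (0 : ℝ) 1 → (D k).f τ ∈ Z → (D k).f τ' ∈ Z →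
          τ ≤ τ' → {h : Ex | h.1.k = k ∧ h.1.t ≤ τ} = {h : Ex | h.1.k = k ∧ h.1.t ≤ τ'} →
          (D k).f τ ∈ (d i).f '' closedBall 0 2 → 
          Rel (d i) (thickening ε Z) ((D k).f τ) ((D k).f τ') := by
        intro τ τ' hτ hτ' h1 h2 hle heq hd
        have hr := arc_rel G hZ.isClosed isOpen_thickening hZU (fun h hh =>
          ⟨(hEx h hh).1, (hEx h hh).2 _ isOpen_thickening hZU⟩) hτ.1 hle hτ'.2 h1 h2
          (fun h hh hk ht => by
            have : (⟨h, hh⟩ : Ex) ∈ {h : Ex | h.1.k = k ∧ h.1.t ≤ τ} := by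
              rw [heq]; exact ⟨hk, ht⟩
            exact this.2)
        refine hr.change ?_
        have := G.near k i ⟨_, ⟨τ, hτ, rfl⟩, hd⟩
        apply joined_uIcc
        intro r hr
        rw [uIcc_of_le hle] at hr
        exact ⟨⟨_, rfl⟩, this ⟨r, ⟨hτ.1.trans hr.1, hr.2.trans hτ'.2⟩, rfl⟩⟩
      rcases le_total τ τ' with h | h
      · exact key τ τ' hτ hτ' hx1 hy1 h (hT.symm.trans hT') hx2
      · exact (key τ' τ hτ' hτ hy1 hx1 h (hT'.symm.trans hT) hy2).symm

end S14
end

section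
open Set Filter Topology Metric unitInterval
namespace S14

lemma sr_near_one {u : I → ℂ} (hu : Continuous u) (h : ∀ t, ‖u t - 1‖ < 1) (h01 : u 0 = u 1) :
    sr u = 1 := by
  have hs : ∀ t, u t ∈ Complex.slitPlane := fun t => by
    left
    have := (Complex.abs_re_le_norm (u t - 1)).trans_lt (h t)
    rw [abs_lt] at this
    simp at this
    linarith
  have h0 : ∀ t, u t ≠ 0 := fun t => Complex.slitPlane_ne_zero (hs t)
  rw [sr_eq (s := fun t => (u t) ^ ((2 : ℕ)⁻¹ : ℂ)) (hu.cpow continuous_const hs)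
    (fun t => Complex.cpow_nat_inv_pow (u t) two_ne_zero) h0, h01]
  refine div_self fun hc => h0 1 ?_
  rw [← Complex.cpow_nat_inv_pow (u 1) two_ne_zero, hc]; simp

lemma planar_loop {σ' : I → ℂ} {τ : I → ℂ} (hσ : Continuous σ') (hτ : Continuous τ)
    (h1 : ∀ t : I, ‖σ' t - Complex.exp (2 * Real.pi * Complex.I * (t : ℝ))‖ ≤ 1 / 5) (h01 : σ' 0 = σ' 1)
    (hq0 : ‖τ 0‖ < 1 / 2) (hq1 : 3 / 2 ≤ ‖τ 1‖) (hne : ∀ t s, σ' t ≠ τ s) : False := by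
  obtain ⟨R, hR, hR2⟩ := exists_sqrt_II (fun p => σ' p.1 - τ p.2) (by fun_prop)
    (fun p => sub_ne_zero.2 (hne _ _))
  have hsr : ∀ s, sr (fun t => σ' t - τ s) = R (1, s) / R (0, s) := fun s =>
    sr_eq (s := fun t => R (t, s)) (by fun_prop) (fun t => hR2 _) (fun t => sub_ne_zero.2 (hne _ _))
  have hR0 : ∀ p, R p ≠ 0 := fun p hp => by
    have := hR2 p
    rw [hp] at this
    exact sub_ne_zero.2 (hne p.1 p.2) (by rw [← this]; simp)
  have hexp : ∀ t : I, ‖Complex.exp (2 * Real.pi * Complex.I * (t : ℝ))‖ = 1 := fun t => by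
    rw [show (2 * Real.pi * Complex.I * (t : ℝ) : ℂ) = ((2 * Real.pi * t : ℝ) : ℂ) * Complex.I by
      push_cast; ring]
    exact Complex.norm_exp_ofReal_mul_I _
  have e0 : sr (fun t => σ' t - τ 0) = -1 := by
    let v : I → ℂ := fun t => Complex.exp (-(2 * Real.pi * Complex.I * (t : ℝ))) * (σ' t - τ 0)
    have hv : Continuous v := by fun_prop
    have hv1 : ∀ t, ‖v t - 1‖ < 1 := fun t => by
      have e : v t - 1 = Complex.exp (-(2 * Real.pi * Complex.I * (t : ℝ))) *
          ((σ' t - Complex.exp (2 * Real.pi * Complex.I * (t : ℝ))) - τ 0) := by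
        have : Complex.exp (-(2 * Real.pi * Complex.I * (t : ℝ))) *
          Complex.exp (2 * Real.pi * Complex.I * (t : ℝ)) = 1 := by rw [← Complex.exp_add]; simp
        simp only [v]
        linear_combination this
      rw [e, norm_mul, Complex.exp_neg, norm_inv, hexp, inv_one, one_mul]
      refine (norm_sub_le _ _).trans_lt ?_
      linarith [h1 t]
    have hv01 : v 0 = v 1 := by
      simp only [v, h01]
      simp [Complex.exp_neg]
    have hv0 : ∀ t, v t ≠ 0 := fun t =>
      mul_ne_zero (Complex.exp_ne_zero _) (sub_ne_zero.2 (hne _ _))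
    have e1 := sr_mul (f := fun t : I => Complex.exp (2 * Real.pi * Complex.I * (t : ℝ))) (g := v)
      (by fun_prop) hv (fun t => Complex.exp_ne_zero _) hv0
    have e2 : (fun t => σ' t - τ 0) =
        fun t : I => Complex.exp (2 * Real.pi * Complex.I * (t : ℝ)) * v t := by
      funext t
      simp only [v]
      rw [← mul_assoc, ← Complex.exp_add]; simp
    rw [e2, e1, sr_near_one hv hv1 hv01, mul_one, sr_eq
      (s := fun t : I => Complex.exp (Real.pi * Complex.I * (t : ℝ))) (by fun_prop)
      (fun t => by rw [← Complex.exp_nat_mul]; congr 1; push_cast; ring) (fun t => Complex.exp_ne_zero _)]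
    simp
  have e1 : sr (fun t => σ' t - τ 1) = 1 := by
    have hq : τ 1 ≠ 0 := fun h => by rw [h] at hq1; norm_num at hq1
    let v : I → ℂ := fun t => 1 - σ' t / τ 1
    have hv : Continuous v := by fun_prop
    have hv1 : ∀ t, ‖v t - 1‖ < 1 := fun t => by
      simp only [v]
      rw [sub_sub_cancel_left, norm_neg, norm_div, div_lt_one (by linarith)]
      have h2 := norm_le_norm_add_norm_sub' (σ' t) (Complex.exp (2 * Real.pi * Complex.I * (t : ℝ)))
      rw [hexp] at h2
      linarith [h1 t]
    have hv0 : ∀ t, v t ≠ 0 := fun t h => by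
      have := hv1 t; rw [h] at this; simp at this
    have e3 := sr_mul (f := fun _ : I => -τ 1) (g := v) (by fun_prop) hv (fun t => neg_ne_zero.2 hq) hv0
    have e2 : (fun t => σ' t - τ 1) = fun t : I => (-τ 1) * v t := by
      funext t
      simp only [v]
      field_simp
      ring
    obtain ⟨c, hc⟩ := IsAlgClosed.exists_pow_nat_eq (-τ 1) (n := 2) (by norm_num)
    rw [e2, e3, sr_near_one hv hv1 (by simp only [v, h01]), mul_one, sr_eq (s := fun t : I => c) (by fun_prop)
      (fun t => hc) (fun t => neg_ne_zero.2 hq)]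
    refine div_self fun h => hq ?_
    rw [h] at hc; simpa using hc.symm
  rw [hsr, div_eq_iff (hR0 _)] at e0 e1
  rcases isPreconnected_univ.eq_or_eq_neg_of_sq_eq (f := fun s => R (1, s)) (g := fun s => R (0, s))
    (by fun_prop) (by fun_prop) (fun s _ => by simp [hR2, h01]) (fun {s} _ => hR0 _) with h | h
  · have := h (mem_univ 0)
    simp only at this
    rw [this] at e0
    have h3 := hR0 (0, 0)
    have : (2 : ℂ) * R (0, 0) = 0 := by linear_combination e0
    simp [h3] at this
  · have := h (mem_univ 1)
    simp only [Pi.neg_apply] at this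
    rw [this] at e1
    have h3 := hR0 (0, 1)
    have : (2 : ℂ) * R (0, 1) = 0 := by linear_combination -e1
    simp [h3] at this

end S14
end

section
open Set Filter Topology Metric unitInterval
namespace S14

universe u
variable {M : Type u} [MetricSpace M]
variable {κ : Type*} {D : κ → Disc M} {P : Set M}

/-- affine reparametrisation -/
def Disc.aff (j : Disc M) (a b : ℂ) (h : a ≠ b) : Disc M where
  f w := j.f (a + (b - a) * w)
  emb := j.emb.comp
    ((Homeomorph.mulLeft₀ (b - a) (sub_ne_zero.2 h.symm)).trans (Homeomorph.addLeft a)).isOpenEmbedding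

lemma Disc.aff_f (j : Disc M) {a b : ℂ} (h : a ≠ b) (w : ℂ) : (j.aff a b h).f w = j.f (a + (b - a) * w) := rfl

lemma Disc.aff_range (j : Disc M) {a b : ℂ} (h : a ≠ b) : range (j.aff a b h).f = range j.f := by
  apply Subset.antisymm
  · rintro _ ⟨w, rfl⟩; exact ⟨_, rfl⟩
  · rintro _ ⟨w, rfl⟩
    refine ⟨(w - a) / (b - a), ?_⟩
    rw [j.aff_f h, mul_div_cancel₀ _ (sub_ne_zero.2 h.symm)]
    simp

def Disc.restr (j : Disc M) (s t : ℝ) (h : s < t) : Disc M :=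
  j.aff s t (fun e => h.ne (Complex.ofReal_injective e))

lemma Disc.restr_f (j : Disc M) {s t : ℝ} (h : s < t) (r : ℝ) :
    (j.restr s t h).f r = j.f ((s + (t - s) * r : ℝ) : ℂ) := by
  rw [Disc.restr, j.aff_f]; push_cast; rfl

lemma Disc.restr_arc (j : Disc M) {s t : ℝ} (h : s < t) :
    arc (j.restr s t h) = (fun r : ℝ => j.f r) '' Icc s t := by
  have h0 : 0 < t - s := sub_pos.2 h
  apply Subset.antisymm
  · rintro _ ⟨r, hr, rfl⟩
    refine ⟨_, ?_, (j.restr_f h r).symm⟩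
    constructor <;> nlinarith [hr.1, hr.2]
  · rintro _ ⟨r, hr, rfl⟩
    refine ⟨(r - s) / (t - s), ⟨div_nonneg (by linarith [hr.1]) h0.le, ?_⟩, ?_⟩
    · rw [div_le_one h0]; linarith [hr.2]
    · simp only
      rw [j.restr_f, mul_div_cancel₀ _ h0.ne']; simp

lemma restr_Ioo {s t r : ℝ} (h : s < t) (hr : r ∈ Ioo (0 : ℝ) 1) : s + (t - s) * r ∈ Ioo s t := by
  have h0 : 0 < t - s := sub_pos.2 h
  constructor <;> nlinarith [hr.1, hr.2]

def Gam (D : κ → Disc M) (P : Set M) : Set M := P ∪ ⋃ k, arc (D k)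

lemma arc_Gam (k : κ) : arc (D k) ⊆ Gam D P := (subset_iUnion (fun k => arc (D k)) k).trans subset_union_right

lemma isClosed_Gam [Finite κ] (hP : P.Finite) : IsClosed (Gam D P) :=
  hP.isClosed.union (isClosed_iUnion_of_finite fun k => (isCompact_arc _).isClosed)

lemma gam_near [Finite κ] (hP : P.Finite) {x : M} (hxΓ : x ∈ Gam D P) {W : Set M} (hW : W ∈ 𝓝 x) :
    ∀ᶠ y in 𝓝 x, y ∈ Gam D P → JoinedIn (Gam D P ∩ W) x y := by
  have hfin : ∀ᶠ y in 𝓝 x, y ∉ P \ {x} :=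
    (hP.subset diff_subset).isClosed.isOpen_compl.mem_nhds (by simp)
  filter_upwards [hfin, eventually_all.2 fun k => near_arc (D k) x hW] with y h1 h2 hy
  rcases hy with hy | hy
  · have : y = x := by by_contra hc; exact h1 ⟨hy, hc⟩
    rw [this]
    exact JoinedIn.refl ⟨hxΓ, mem_of_mem_nhds hW⟩
  · obtain ⟨k, θ, hθ, rfl⟩ := mem_iUnion.1 hy
    obtain ⟨τ, hτ, rfl, hr⟩ := h2 k θ hθ rfl
    refine (joined_uIcc _ fun r hr1 => ?_).symm
    have h3 : (D k).f r ∈ arc (D k) := ⟨r, uIcc_subset_Icc hθ hτ hr1, rfl⟩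
    exact ⟨arc_Gam k h3, hr r hr1⟩

lemma gapsel [Finite κ] (hP : P.Finite) (j : Disc M) (h0 : j.f (0 : ℝ) ∈ Gam D P)
    (h1 : j.f (1 : ℝ) ∈ Gam D P) {W : Set M} (hW : IsOpen W) (hjW : arc j ⊆ W) :
    ∃ S : Finset (ℝ × ℝ), (∀ p ∈ S, 0 ≤ p.1 ∧ p.1 < p.2 ∧ p.2 ≤ 1 ∧ j.f p.1 ∈ Gam D P ∧
      j.f p.2 ∈ Gam D P ∧ ∀ r ∈ Ioo p.1 p.2, j.f r ∉ Gam D P) ∧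
      JoinedIn ((Gam D P ∪ ⋃ p ∈ S, (fun r : ℝ => j.f r) '' Icc p.1 p.2) ∩ W) (j.f (0 : ℝ)) (j.f (1 : ℝ)) := by
  classical
  set Γ := Gam D P with hΓ
  have hcl : IsClosed Γ := isClosed_Gam hP
  set T : Set ℝ := Icc 0 1 ∩ (fun r : ℝ => j.f r) ⁻¹' Γ with hT
  have hTc : IsCompact T := isCompact_Icc.inter_right (hcl.preimage j.cont_real)
  have hTW : ∀ u ∈ T, j.f u ∈ W := fun u hu => hjW ⟨u, hu.1, rfl⟩
  have h0T : (0 : ℝ) ∈ T := ⟨by simp, h0⟩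
  have h1T : (1 : ℝ) ∈ T := ⟨by simp, h1⟩
  -- Lebesgue number
  have hloc : ∀ u ∈ T, ∃ ρ > 0, ∀ v ∈ T, dist v u < ρ → JoinedIn (Γ ∩ W) (j.f u) (j.f v) := by
    intro u hu
    have h2 := (j.cont_real.tendsto u).eventually (gam_near hP hu.2 (hW.mem_nhds (hTW u hu)))
    obtain ⟨ρ, hρ, hb⟩ := Metric.eventually_nhds_iff.1 h2
    exact ⟨ρ, hρ, fun v hv hd => hb hd hv.2⟩
  choose! ρ hρ hj using hloc
  obtain ⟨η, hη, hL⟩ := lebesgue_number_lemma_of_metric hTc (c := fun u : T => ball (u : ℝ) (ρ u))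
    (fun _ => isOpen_ball) (fun u hu => mem_iUnion.2 ⟨⟨u, hu⟩, mem_ball_self (hρ u hu)⟩)
  have hnear : ∀ u ∈ T, ∀ v ∈ T, dist v u < η → JoinedIn (Γ ∩ W) (j.f u) (j.f v) := by
    intro u hu v hv hd
    obtain ⟨c, hc⟩ := hL u hu
    exact (hj c c.2 u hu (hc (mem_ball_self hη))).symm.trans (hj c c.2 v hv (hc hd))
  let Ok : Finset (ℝ × ℝ) → Prop := fun S => ∀ p ∈ S, 0 ≤ p.1 ∧ p.1 < p.2 ∧ p.2 ≤ 1 ∧ j.f p.1 ∈ Γ ∧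
      j.f p.2 ∈ Γ ∧ ∀ r ∈ Ioo p.1 p.2, j.f r ∉ Γ
  let G : Finset (ℝ × ℝ) → Set M := fun S => (Γ ∪ ⋃ p ∈ S, (fun r : ℝ => j.f r) '' Icc p.1 p.2) ∩ W
  have hGm : ∀ S, Γ ∩ W ⊆ G S := fun S => inter_subset_inter_left _ subset_union_left
  let A : Set ℝ := {u | u ∈ T ∧ ∃ S, Ok S ∧ JoinedIn (G S) (j.f (0 : ℝ)) (j.f u)}
  have hA0 : (0 : ℝ) ∈ A := ⟨h0T, ∅, by simp [Ok], JoinedIn.refl (hGm _ ⟨h0, hTW _ h0T⟩)⟩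
  have hAb : BddAbove A := ⟨1, fun u hu => hu.1.1.2⟩
  have hstep : ∀ u ∈ A, ∀ v ∈ T, dist v u < η → v ∈ A := by
    rintro u ⟨hu, S, hS, hJ⟩ v hv hd
    exact ⟨hv, S, hS, hJ.trans ((hnear u hu v hv hd).mono (hGm S))⟩
  set s := sSup A with hs
  have hsT : s ∈ T := hTc.isClosed.closure_subset
    (closure_mono (fun u hu => hu.1) (csSup_mem_closure ⟨0, hA0⟩ hAb))
  have hsA : s ∈ A := by
    obtain ⟨a, ha, hlt⟩ := exists_lt_of_lt_csSup ⟨0, hA0⟩ (show s - η < sSup A by linarith)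
    have hle : a ≤ s := le_csSup hAb ha
    exact hstep a ha s hsT (by rw [Real.dist_eq, abs_of_nonneg (by linarith)]; linarith)
  have hno : ∀ v ∈ T, s < v → v ∉ A := fun v _ h hv => absurd (le_csSup hAb hv) (not_le.2 h)
  suffices hs1 : s = 1 by
    rw [hs1] at hsA
    exact hsA.2
  by_contra hne
  have hlt : s < 1 := lt_of_le_of_ne hsT.1.2 hne
  have hT2 : IsCompact (T ∩ Ici (s + η)) := hTc.inter_right isClosed_Ici
  have hsm : ∀ v ∈ T, s < v → s + η ≤ v := by
    intro v hv hsv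
    by_contra hc
    exact hno v hv hsv (hstep s hsA v hv (by rw [Real.dist_eq, abs_of_nonneg (by linarith)]; linarith))
  obtain ⟨t, ht, hmin⟩ := hT2.exists_isLeast ⟨1, h1T, hsm 1 h1T hlt⟩
  have hst : s < t := by have := ht.2; simp only [mem_Ici] at this; linarith
  refine hno t ht.1 hst ⟨ht.1, ?_⟩
  obtain ⟨-, S, hS, hJ⟩ := hsA
  refine ⟨insert (s, t) S, ?_, ?_⟩
  · intro p hp
    rcases Finset.mem_insert.1 hp with rfl | hp
    · refine ⟨hsT.1.1, hst, ht.1.1.2, hsT.2, ht.1.2, fun r hr hc => ?_⟩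
      have hrT : r ∈ T := ⟨⟨hsT.1.1.trans hr.1.le, hr.2.le.trans ht.1.1.2⟩, hc⟩
      exact absurd (hmin ⟨hrT, hsm r hrT hr.1⟩) (not_le.2 hr.2)
    · exact hS p hp
  · refine (hJ.mono ?_).trans ?_
    · exact inter_subset_inter_left _ (union_subset_union_right _
        (biUnion_subset_biUnion_left fun p hp => Finset.mem_insert_of_mem hp))
    · apply joined_uIcc
      intro r hr
      rw [uIcc_of_le hst.le] at hr
      refine ⟨Or.inr (mem_biUnion (Finset.mem_insert_self _ _) ⟨r, hr, rfl⟩), hjW ⟨r, ?_, rfl⟩⟩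
      exact ⟨hsT.1.1.trans hr.1, hr.2.trans ht.1.1.2⟩

def DJ (D : κ → Disc M) : Prop :=
  ∀ k k', ∀ θ ∈ Ioo (0 : ℝ) 1, ∀ θ' ∈ Ioo (0 : ℝ) 1, (D k).f θ = (D k').f θ' → k = k'

lemma step {κ : Type} [Finite κ] {D : κ → Disc M} (hD : DJ D) (hP : P.Finite) (j : Disc M)
    (h0 : j.f (0 : ℝ) ∈ Gam D P) (h1 : j.f (1 : ℝ) ∈ Gam D P) {W : Set M} (hW : IsOpen W)
    (hjW : arc j ⊆ W) : ∃ (κ' : Type) (_ : Finite κ') (D' : κ' → Disc M), DJ D' ∧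
      Gam D P ⊆ Gam D' P ∧ (∀ k, (∃ k0, D' k = D k0) ∨ ∃ s t, ∃ h : s < t, 0 ≤ s ∧ t ≤ 1 ∧
        D' k = j.restr s t h) ∧ JoinedIn (Gam D' P ∩ W) (j.f (0 : ℝ)) (j.f (1 : ℝ)) := by
  obtain ⟨S, hS, hJ⟩ := gapsel hP j h0 h1 hW hjW
  let D' : κ ⊕ S → Disc M := Sum.elim D fun p => j.restr p.1.1 p.1.2 (hS p.1 p.2).2.1
  have harc : ∀ p : S, arc (D' (.inr p)) = (fun r : ℝ => j.f r) '' Icc p.1.1 p.1.2 := fun p =>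
    j.restr_arc (hS p.1 p.2).2.1
  have hsub : Gam D P ⊆ Gam D' P := by
    rintro x (hx | hx)
    · exact Or.inl hx
    · obtain ⟨k, hk⟩ := mem_iUnion.1 hx
      exact Or.inr (mem_iUnion.2 ⟨.inl k, hk⟩)
  have hgap : ∀ (p : S) (θ : ℝ), θ ∈ Ioo (0 : ℝ) 1 → (D' (.inr p)).f θ ∉ Gam D P := fun p θ hθ => by
    have e : (D' (.inr p)).f θ = _ := j.restr_f (hS p.1 p.2).2.1 θ
    rw [e]
    exact (hS p.1 p.2).2.2.2.2.2 _ (restr_Ioo (hS p.1 p.2).2.1 hθ)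
  refine ⟨κ ⊕ S, inferInstance, D', ?_, hsub, ?_, hJ.mono (inter_subset_inter_left _ ?_)⟩
  · rintro (k | p) (k' | p') θ hθ θ' hθ' e
    · exact congrArg _ (hD k k' θ hθ θ' hθ' e)
    · exact absurd (arc_Gam k ⟨θ, Ioo_subset_Icc_self hθ, e⟩) (hgap p' θ' hθ')
    · exact absurd (arc_Gam k' ⟨θ', Ioo_subset_Icc_self hθ', e.symm⟩) (hgap p θ hθ)
    · obtain ⟨a1, a2, a3, a4, a5, a6⟩ := hS p.1 p.2
      obtain ⟨b1, b2, b3, b4, b5, b6⟩ := hS p'.1 p'.2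
      have e1 : (D' (.inr p)).f θ = _ := j.restr_f a2 θ
      have e2 : (D' (.inr p')).f θ' = _ := j.restr_f b2 θ'
      rw [e1, e2] at e
      have e3 := j.inj_real e
      have c1 := restr_Ioo a2 hθ
      have c2 := restr_Ioo b2 hθ'
      rw [← e3] at c2
      have q1 : p.1.1 = p'.1.1 := by
        rcases lt_trichotomy p.1.1 p'.1.1 with h | h | h
        · exact absurd b4 (a6 _ ⟨h, c2.1.trans c1.2⟩)
        · exact h
        · exact absurd a4 (b6 _ ⟨h, c1.1.trans c2.2⟩)
      have q2 : p.1.2 = p'.1.2 := by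
        rcases lt_trichotomy p.1.2 p'.1.2 with h | h | h
        · exact absurd a5 (b6 _ ⟨c2.1.trans c1.2, h⟩)
        · exact h
        · exact absurd b5 (a6 _ ⟨c1.1.trans c2.2, h⟩)
      rw [Subtype.ext (Prod.ext q1 q2)]
  · rintro (k | p)
    · exact Or.inl ⟨k, rfl⟩
    · obtain ⟨a1, a2, a3, -⟩ := hS p.1 p.2
      exact Or.inr ⟨_, _, a2, a1, a3, rfl⟩
  · refine union_subset hsub (iUnion₂_subset fun p hp => ?_)
    rw [← harc ⟨p, hp⟩]
    exact arc_Gam _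

end S14
end

section
open Set Filter Topology Metric unitInterval
namespace S14

universe u
variable {M : Type u} [MetricSpace M] {P : Set M}

lemma graph_list (hP : P.Finite) (N : Disc M → Prop)
    (hN : ∀ j s t, ∀ h : s < t, N j → 0 ≤ s → t ≤ 1 → N (j.restr s t h)) (L : List (Disc M × Set M))
    (hL : ∀ e ∈ L, N e.1 ∧ e.1.f (0 : ℝ) ∈ P ∧ e.1.f (1 : ℝ) ∈ P ∧ IsOpen e.2 ∧ arc e.1 ⊆ e.2) :
    ∃ (κ : Type) (_ : Finite κ) (D : κ → Disc M), DJ D ∧ (∀ k, N (D k)) ∧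
      ∀ e ∈ L, JoinedIn (Gam D P ∩ e.2) (e.1.f (0 : ℝ)) (e.1.f (1 : ℝ)) := by
  induction L with
  | nil => exact ⟨Empty, inferInstance, fun k => k.elim, fun k => k.elim, fun k => k.elim, by simp⟩
  | cons e L ih =>
    obtain ⟨κ, hκ, D, hD, hDN, hJ⟩ := ih fun e he => hL e (List.mem_cons_of_mem _ he)
    obtain ⟨n1, n2, n3, n4, n5⟩ := hL e List.mem_cons_self
    obtain ⟨κ', hκ', D', hD', hs, hc, hj⟩ := step hD hP e.1 (Or.inl n2) (Or.inl n3) n4 n5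
    refine ⟨κ', hκ', D', hD', fun k => ?_, fun e' he' => ?_⟩
    · rcases hc k with ⟨k0, e⟩ | ⟨s, t, h, h0, h1, e⟩
      · rw [e]; exact hDN k0
      · rw [e]; exact hN _ _ _ _ n1 h0 h1
    · rcases List.mem_cons.1 he' with rfl | he'
      · exact hj
      · exact (hJ e' he').mono (inter_subset_inter_left _ hs)

lemma graph_sub (hP : P.Finite) (N : Disc M → Prop)
    (hN : ∀ j s t, ∀ h : s < t, N j → 0 ≤ s → t ≤ 1 → N (j.restr s t h)) {κ : Type} [Finite κ]
    {D : κ → Disc M} (hD : DJ D) (hDN : ∀ k, N (D k)) :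
    ∃ (κ' : Type) (_ : Finite κ') (D' : κ' → Disc M) (P' : Set M), P'.Finite ∧ P ⊆ P' ∧ DJ D' ∧
      (∀ k, (D' k).f (0 : ℝ) ∈ P') ∧ (∀ k, (D' k).f (1 : ℝ) ∈ P') ∧
      (∀ k, ∀ θ ∈ Ioo (0 : ℝ) 1, (D' k).f θ ∉ P') ∧ (∀ k, N (D' k)) ∧ Gam D P ⊆ Gam D' P' := by
  set P' : Set M := P ∪ ((range fun k => (D k).f (0 : ℝ)) ∪ range fun k => (D k).f (1 : ℝ)) with hP'
  have hfin : P'.Finite := hP.union ((finite_range _).union (finite_range _))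
  have q0 : ∀ k, (D k).f (0 : ℝ) ∈ P' := fun k => Or.inr (Or.inl ⟨k, rfl⟩)
  have q1 : ∀ k, (D k).f (1 : ℝ) ∈ P' := fun k => Or.inr (Or.inr ⟨k, rfl⟩)
  have es : ∀ h : Sg D P', (D h.k).f h.s ∈ P' := fun h => by
    rcases h.es with e | e
    · rw [e]; exact q0 _
    · exact e
  have et : ∀ h : Sg D P', (D h.k).f h.t ∈ P' := fun h => by
    rcases h.et with e | e
    · rw [e]; exact q1 _
    · exact e
  have : Finite P' := hfin
  have hF : Finite (Sg D P') := by
    refine Finite.of_injective (β := κ × P' × P')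
      (fun h => (h.k, ⟨_, es h⟩, ⟨_, et h⟩)) fun h h' e => ?_
    simp only [Prod.mk.injEq, Subtype.mk.injEq] at e
    obtain ⟨e1, e2, e3⟩ := e
    rw [e1] at e2 e3
    exact Sg.ext e1 ((D _).inj_real e2) ((D _).inj_real e3)
  let D' : Sg D P' → Disc M := fun h => (D h.k).restr h.s h.t h.hst
  have hf : ∀ h r, (D' h).f ((r : ℝ) : ℂ) = (D h.k).f ((h.s + (h.t - h.s) * r : ℝ) : ℂ) := fun h r =>
    (D h.k).restr_f h.hst r
  refine ⟨Sg D P', hF, D', P', hfin, subset_union_left, ?_, ?_, ?_, ?_, ?_, ?_⟩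
  · intro h h' θ hθ θ' hθ' e
    rw [hf, hf] at e
    exact Sg.g_eq0 hD ⟨_, restr_Ioo h.hst hθ, rfl⟩ ⟨_, restr_Ioo h'.hst hθ', e.symm⟩
  · intro h
    rw [hf, mul_zero, add_zero]; exact es h
  · intro h
    rw [hf, mul_one, add_sub_cancel]; exact et h
  · intro h θ hθ
    rw [hf]; exact h.av _ (restr_Ioo h.hst hθ)
  · intro h
    exact hN _ _ _ _ (hDN _) h.h0 h.h1
  · rintro x (hx | hx)
    · exact Or.inl (Or.inl hx)
    · obtain ⟨k, θ, hθ, rfl⟩ := mem_iUnion.1 hx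
      by_cases hc : (D k).f θ ∈ P'
      · exact Or.inl hc
      have h0 : 0 ≠ θ := fun e => hc (by rw [← e]; exact q0 k)
      have h1 : θ ≠ 1 := fun e => hc (by rw [e]; exact q1 k)
      obtain ⟨h, rfl, hm⟩ := exists_sg hfin.isClosed k
        ⟨lt_of_le_of_ne hθ.1 h0, lt_of_le_of_ne hθ.2 h1⟩ hc
      refine Or.inr (mem_iUnion.2 ⟨h, ?_⟩)
      rw [(D h.k).restr_arc h.hst]
      exact ⟨θ, Ioo_subset_Icc_self hm, rfl⟩

end S14
end

section
open Set Filter Topology Metric unitInterval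
namespace S14

universe u

noncomputable def ex (a : ℝ) : ℂ := Complex.exp (2 * Real.pi * Complex.I * a)

lemma ex_close (a b : ℝ) : ‖ex a - ex b‖ ≤ 2 * Real.pi * |a - b| := by
  have e : ex a - ex b = ex b * (Complex.exp (Complex.I * ((2 * Real.pi * (a - b) : ℝ) : ℂ)) - 1) := by
    unfold ex
    rw [mul_sub, ← Complex.exp_add, mul_one]
    congr 2
    push_cast; ring
  have h1 : ‖ex b‖ = 1 := by
    unfold ex
    rw [show 2 * (Real.pi : ℂ) * Complex.I * b = ((2 * Real.pi * b : ℝ) : ℂ) * Complex.I by push_cast; ring]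
    exact Complex.norm_exp_ofReal_mul_I _
  rw [e, norm_mul, h1, one_mul]
  refine (Real.norm_exp_I_mul_ofReal_sub_one_le).trans ?_
  rw [Real.norm_eq_abs, abs_mul, abs_of_pos Real.two_pi_pos]

lemma chain_path {X : Type*} [TopologicalSpace X] {S : ℕ → Set X} {v : ℕ → X} (n : ℕ)
    (h : ∀ m < n, JoinedIn (S m) (v m) (v (m + 1))) : ∃ σ' : ℝ → X, Continuous σ' ∧ σ' 0 = v 0 ∧
      σ' n = v n ∧ ∀ m < n, ∀ t ∈ Icc (m : ℝ) (m + 1), σ' t ∈ S m := by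
  induction n with
  | zero => exact ⟨fun _ => v 0, continuous_const, rfl, rfl, by simp⟩
  | succ n ih =>
    obtain ⟨c, hc, c0, c1, hS⟩ := ih fun m hm => h m (hm.trans (Nat.lt_succ_self n))
    let p := (h n (Nat.lt_succ_self n)).somePath
    refine ⟨fun t => if t ≤ n then c t else p.extend (t - n), ?_, ?_, ?_, ?_⟩
    · refine Continuous.if_le hc (p.continuous_extend.comp (continuous_id.sub continuous_const))
        continuous_id continuous_const ?_
      rintro t rfl
      simp [c1]
    · simp [c0]
    · simp
    · intro m hm t ht
      by_cases hmn : m < n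
      · have : (m : ℝ) + 1 ≤ n := by exact_mod_cast hmn
        simp only [if_pos (ht.2.trans this)]
        exact hS m hmn t ht
      · obtain rfl : m = n := by omega
        have hp : ∀ r, p.extend r ∈ S m := fun r => (h m hm).somePath_mem _
        simp only
        split_ifs with h2
        · have : t = m := le_antisymm h2 ht.1
          rw [this, c1, ← p.extend_zero]
          exact hp 0
        · exact hp _

variable {M : Type u} [MetricSpace M]

lemma face_lem [LocallyPathConnectedSpace M] (d : Disc M) {Γ : Set M} (hΓ : IsClosed Γ) {n : ℕ}
    (hn : 0 < n) (hn2 : 2 * Real.pi / n ≤ 1 / 10)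
    (hJ : ∀ m < n, JoinedIn (Γ ∩ d.f '' ball (ex (m / n)) (1 / 10)) (d.f (ex (m / n)))
      (d.f (ex ((m + 1 : ℕ) / n)))) {Q : Set M} (hQ : IsPreconnected Q) (hQΓ : Q ⊆ Γᶜ) {x : M} (hx : x ∈ Q)
    (hxd : x ∈ d.f '' ball 0 (1 / 2)) : Q ⊆ d.f '' ball 0 2 := by
  have hn0 : (0 : ℝ) < n := by exact_mod_cast hn
  set O := Γᶜ ∩ d.f '' ball 0 2 with hO'
  have hO : IsOpen O := hΓ.isOpen_compl.inter (d.emb.isOpenMap _ isOpen_ball)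
  have hxO : x ∈ O := ⟨hQΓ hx, image_mono (ball_subset_ball (by norm_num)) hxd⟩
  set Q' := connectedComponentIn O x with hQ'
  have hQO : Q' ⊆ O := connectedComponentIn_subset _ _
  by_cases hall : Q' ⊆ d.f '' closedBall 0 (3 / 2)
  · have h1 : Q ⊆ Q' := by
      refine hQ.subset_of_closure_inter_subset hO.connectedComponentIn
        ⟨x, hx, mem_connectedComponentIn hxO⟩ ?_
      rintro y ⟨hy, hyQ⟩
      refine cc_closure hO hy ⟨hQΓ hyQ, ?_⟩
      have h2 : IsClosed (d.f '' closedBall 0 (3 / 2)) :=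
        ((isCompact_closedBall _ _).image d.cont).isClosed
      exact image_mono (closedBall_subset_ball (by norm_num)) (closure_minimal hall h2 hy)
    exact h1.trans (hQO.trans inter_subset_right)
  · exfalso
    obtain ⟨y, hy, hyn⟩ := not_subset.1 hall
    have hj := cc_joined hO hy
    let p := hj.somePath
    have hp : ∀ s, p s ∈ O := hj.somePath_mem
    obtain ⟨c, hc, c0, c1, hS⟩ := chain_path (v := fun m : ℕ => d.f (ex (m / n))) n hJ
    have key : ∀ t : I, ∃ m < n, (n * t : ℝ) ∈ Icc (m : ℝ) (m + 1) := by
      intro t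
      have t0 := t.2.1
      have t1 := t.2.2
      have h0 : 0 ≤ (n * t : ℝ) := by positivity
      have h1 : (n * t : ℝ) ≤ n := by nlinarith
      rcases h1.lt_or_eq with h1 | h1
      · exact ⟨⌊(n * t : ℝ)⌋₊, (Nat.floor_lt h0).2 h1, Nat.floor_le h0, (Nat.lt_floor_add_one _).le⟩
      · refine ⟨n - 1, by omega, ?_⟩
        rw [h1, Nat.cast_sub hn]
        constructor <;> simp
    have hcd : ∀ t : I, c (n * t) ∈ range d.f ∩ Γ := by
      intro t
      obtain ⟨m, hm, hmt⟩ := key t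
      have := hS m hm _ hmt
      exact ⟨image_subset_range _ _ this.2, this.1⟩
    refine planar_loop (σ' := fun t => d.inv (c (n * t))) (τ := fun s => d.inv (p s)) ?_ ?_ ?_ ?_ ?_ ?_ ?_
    · refine d.cont_inv.comp_continuous (hc.comp (by fun_prop)) fun t => (hcd t).1
    · exact d.cont_inv.comp_continuous p.continuous fun s => image_subset_range _ _ (hp s).2
    · intro t
      obtain ⟨m, hm, hmt⟩ := key t
      obtain ⟨-, w, hw, e⟩ := hS m hm _ hmt
      rw [← e, d.inv_f]
      have h2 := ex_close (m / n) t
      have h3 : |(m / n : ℝ) - t| ≤ 1 / n := by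
        rw [abs_sub_comm, abs_of_nonneg, sub_le_iff_le_add, ← add_div, le_div_iff₀ hn0]
        · linarith [hmt.2]
        · rw [sub_nonneg, div_le_iff₀ hn0]; linarith [hmt.1]
      have h4 : ‖ex (m / n) - ex t‖ ≤ 1 / 10 := by
        refine h2.trans (le_trans ?_ hn2)
        rw [div_eq_mul_one_div (2 * Real.pi)]
        exact mul_le_mul_of_nonneg_left h3 Real.two_pi_pos.le
      have h5 : ‖w - ex (m / n)‖ < 1 / 10 := by simpa [dist_eq_norm] using hw
      have h6 := norm_sub_le_norm_sub_add_norm_sub w (ex (m / n)) (ex t)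
      change ‖w - ex t‖ ≤ 1 / 5
      linarith
    · have : c 0 = c n := by
        rw [c0, c1]
        simp only [Nat.cast_zero, zero_div, div_self hn0.ne']
        simp [ex, Complex.exp_two_pi_mul_I]
      simp [this]
    · obtain ⟨w, hw, e⟩ := hxd
      simp only [p.source]
      rw [← e, d.inv_f]
      simpa using hw
    · simp only [p.target]
      by_contra hlt
      exact hyn ⟨d.inv y, by simpa using (not_le.1 hlt).le,
        d.f_inv (image_subset_range _ _ (hQO hy).2)⟩
    · intro t s e
      have h1 := d.f_inv (hcd t).1
      have h2 := d.f_inv (image_subset_range _ _ (hp s).2)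
      rw [e, h2] at h1
      exact (hp s).1 (h1 ▸ (hcd t).2)

end S14
end

section
open Set Filter Topology Metric unitInterval
namespace S14

universe u

lemma ex_norm (b : ℝ) : ‖ex b‖ = 1 := by
  unfold ex
  rw [show 2 * (Real.pi : ℂ) * Complex.I * b = ((2 * Real.pi * b : ℝ) : ℂ) * Complex.I by push_cast; ring]
  exact Complex.norm_exp_ofReal_mul_I _

lemma ex_ne {n : ℕ} (hn : 2 ≤ n) (m : ℕ) : ex (m / n) ≠ ex ((m + 1 : ℕ) / n) := by
  intro e
  obtain ⟨k, hk⟩ := Complex.exp_eq_exp_iff_exists_int.1 e.symm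
  have h0 : (2 * Real.pi * Complex.I : ℂ) ≠ 0 := Complex.two_pi_I_ne_zero
  have hn0 : (n : ℂ) ≠ 0 := by exact_mod_cast (by omega : n ≠ 0)
  have h1 : (2 * Real.pi * Complex.I : ℂ) * ((m + 1) / n) = (2 * Real.pi * Complex.I : ℂ) * (m / n + k) := by
    push_cast at hk
    rw [hk]; ring
  have h2 := mul_left_cancel₀ h0 h1
  field_simp at h2
  have h3 : (1 : ℂ) = n * k := by linear_combination h2
  have h4 : (1 : ℤ) = n * k := by exact_mod_cast h3
  have h5 : (n : ℤ) ∣ 1 := ⟨k, h4⟩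
  have h6 := Int.le_of_dvd one_pos h5
  omega

lemma seg_close {n m : ℕ} (hn : 0 < n) {r : ℝ} (hr : r ∈ Icc (0 : ℝ) 1) :
    ‖(ex ((m + 1 : ℕ) / n) - ex (m / n)) * (r : ℂ)‖ ≤ 2 * Real.pi / n := by
  have hn0 : (0 : ℝ) < n := by exact_mod_cast hn
  rw [norm_mul, Complex.norm_real, Real.norm_of_nonneg hr.1]
  have h1 := ex_close ((m + 1 : ℕ) / n) (m / n)
  have h2 : |(((m + 1 : ℕ) : ℝ) / n - m / n)| = 1 / n := by
    rw [← sub_div]; push_cast; rw [add_sub_cancel_left, abs_of_pos (by positivity)]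
  rw [h2, ← div_eq_mul_one_div] at h1
  exact (mul_le_of_le_one_right (norm_nonneg _) hr.2).trans h1

variable {M : Type u} [MetricSpace M]

lemma exists_gr [ChartedSpace (EuclideanSpace ℝ (Fin 2)) M] [CompactSpace M] (z : M) :
    ∃ (κ : Type) (ι α : Type u) (_ : Finite κ) (_ : Finite ι) (_ : Finite α) (D : κ → Disc M) (P : Set M)
      (d : ι → Disc M) (E : α → Disc M), Gr D P d E ∧ z ∈ P := by
  classical
  have : LocallyPathConnectedSpace M :=
    ChartedSpace.locallyPathConnectedSpace (EuclideanSpace ℝ (Fin 2)) M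
  choose dd hd0 _ using fun x : M => small_disc x univ univ_mem
  obtain ⟨t, ht⟩ := CompactSpace.elim_nhds_subcover (fun x => (dd x).f '' ball 0 (1 / 2)) fun x => by
    have := (dd x).emb.isOpenMap.image_mem_nhds (ball_mem_nhds (0 : ℂ) (by norm_num : (0 : ℝ) < 1 / 2))
    rwa [hd0] at this
  let d : t → Disc M := fun i => dd i
  have hcov : ∀ x, ∃ i, x ∈ (d i).f '' ball 0 (1 / 2) := by
    intro x
    have hx : x ∈ (⊤ : Set M) := trivial
    rw [← ht] at hx
    obtain ⟨i, hi, h⟩ := mem_iUnion₂.1 hx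
    exact ⟨⟨i, hi⟩, h⟩
  obtain ⟨lam, hlam, hlam0⟩ : ∃ lam : ℝ, (∀ i, thickening lam ((d i).f '' closedBall 0 2) ⊆ range (d i).f) ∧
      0 < lam := by
    have h1 : ∀ᶠ δ in 𝓝[>] (0 : ℝ), ∀ i, thickening δ ((d i).f '' closedBall 0 2) ⊆ range (d i).f := by
      refine eventually_all.2 fun i => ?_
      obtain ⟨δ, hδ, h⟩ := ((isCompact_closedBall (0 : ℂ) 2).image (d i).cont).exists_thickening_subset_open
        (d i).isOpen (image_subset_range _ _)
      filter_upwards [Ioo_mem_nhdsGT hδ] with δ' h'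
      exact (thickening_mono h'.2.le _).trans h
    exact (h1.and self_mem_nhdsWithin).exists
  have hlam1 : ∀ i, ∀ p ∈ (d i).f '' closedBall 0 2, ball p lam ⊆ range (d i).f := fun i p hp =>
    (ball_subset_thickening hp _).trans (hlam i)
  choose EE hE0 hE1 using fun x : M => small_disc x (ball x (lam / 4)) (ball_mem_nhds x (by positivity))
  obtain ⟨s, hs⟩ := CompactSpace.elim_nhds_subcover (fun x => range (EE x).f) fun x =>
    (EE x).isOpen.mem_nhds ⟨0, hE0 x⟩
  let E : s → Disc M := fun i => EE i
  have hcovE : ∀ x, ∃ i, x ∈ range (E i).f := by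
    intro x
    have hx : x ∈ (⊤ : Set M) := trivial
    rw [← hs] at hx
    obtain ⟨i, hi, h⟩ := mem_iUnion₂.1 hx
    exact ⟨⟨i, hi⟩, h⟩
  have hE : ∀ a, ∀ p ∈ range (E a).f, range (E a).f ⊆ ball p lam := by
    intro a p hp q hq
    have h1 := hE1 a hp
    have h2 := hE1 a hq
    rw [mem_ball] at h1 h2 ⊢
    linarith [dist_triangle_right q p a]
  obtain ⟨μ, hμ, hL⟩ := lebesgue_number_lemma_of_metric (isCompact_univ (X := M))
    (c := fun a => range (E a).f) (fun a => (E a).isOpen) (fun x _ => mem_iUnion.2 (hcovE x))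
  have hlim : Tendsto (fun n : ℕ => 2 * Real.pi / (n : ℝ)) atTop (𝓝 0) :=
    tendsto_const_div_atTop_nhds_zero_nat _
  have hun : ∀ᶠ n : ℕ in atTop, ∀ i, ∀ w ∈ closedBall (0 : ℂ) 2, ∀ w' ∈ closedBall (0 : ℂ) 2,
      ‖w - w'‖ ≤ 2 * Real.pi / n → dist ((d i).f w) ((d i).f w') < μ := by
    refine eventually_all.2 fun i => ?_
    obtain ⟨δ, hδ, h⟩ := Metric.uniformContinuousOn_iff.1
      ((isCompact_closedBall (0 : ℂ) 2).uniformContinuousOn_of_continuous (d i).cont.continuousOn) μ hμ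
    filter_upwards [hlim.eventually_lt_const hδ] with n hn w hw w' hw' hd
    exact h w hw w' hw' (by rw [dist_eq_norm]; linarith)
  obtain ⟨n, hun, hn10, hn2⟩ := (hun.and ((hlim.eventually_lt_const (by norm_num : (0 : ℝ) < 1 / 10)).and
    (eventually_ge_atTop 2))).exists
  have hn : 0 < n := by omega
  let N : Disc M → Prop := fun D => ∃ i x, range D.f = range (d i).f ∧
    arc D ⊆ (d i).f '' closedBall 0 2 ∧ arc D ⊆ ball x μ
  have hN : ∀ j s t, ∀ h : s < t, N j → 0 ≤ s → t ≤ 1 → N (j.restr s t h) := by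
    rintro j s t h ⟨i, x, h1, h2, h3⟩ h0 h1'
    have h4 : arc (j.restr s t h) ⊆ arc j := by
      rw [j.restr_arc h]
      exact image_mono (Icc_subset_Icc h0 h1')
    exact ⟨i, x, (j.aff_range _).trans h1, h4.trans h2, h4.trans h3⟩
  let P : Set M := {z} ∪ range fun p : t × Fin (n + 1) => (d p.1).f (ex ((p.2 : ℕ) / n))
  have hP : P.Finite := (finite_singleton z).union (finite_range _)
  have hPv : ∀ i m, m ≤ n → (d i).f (ex (m / n)) ∈ P := fun i m hm =>
    Or.inr ⟨(i, ⟨m, by omega⟩), rfl⟩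
  let ed : t × Fin n → Disc M × Set M := fun p =>
    ((d p.1).aff (ex ((p.2 : ℕ) / n)) (ex (((p.2 : ℕ) + 1 : ℕ) / n)) (ex_ne hn2 _),
      (d p.1).f '' ball (ex ((p.2 : ℕ) / n)) (1 / 10))
  have ef : ∀ p w, (ed p).1.f w = (d p.1).f (ex ((p.2 : ℕ) / n) +
    (ex (((p.2 : ℕ) + 1 : ℕ) / n) - ex ((p.2 : ℕ) / n)) * w) := fun p w => rfl
  have ef0 : ∀ p, (ed p).1.f (0 : ℝ) = (d p.1).f (ex ((p.2 : ℕ) / n)) := fun p => by rw [ef]; simp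
  have ef1 : ∀ p, (ed p).1.f (1 : ℝ) = (d p.1).f (ex (((p.2 : ℕ) + 1 : ℕ) / n)) := fun p => by
    rw [ef, Complex.ofReal_one, mul_one, add_sub_cancel]
  have hed : ∀ e ∈ (Finset.univ : Finset (t × Fin n)).toList.map ed, N e.1 ∧ e.1.f (0 : ℝ) ∈ P ∧
      e.1.f (1 : ℝ) ∈ P ∧ IsOpen e.2 ∧ arc e.1 ⊆ e.2 := by
    intro e he
    obtain ⟨p, -, rfl⟩ := List.mem_map.1 he
    have hb : ∀ r ∈ Icc (0 : ℝ) 1, ‖ex ((p.2 : ℕ) / n) +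
        (ex (((p.2 : ℕ) + 1 : ℕ) / n) - ex ((p.2 : ℕ) / n)) * (r : ℂ)‖ ≤ 2 := by
      intro r hr
      have h1 := seg_close (m := p.2) hn hr
      have h2 := ex_norm ((p.2 : ℕ) / n)
      refine (norm_add_le _ _).trans ?_
      linarith
    refine ⟨⟨p.1, (d p.1).f (ex ((p.2 : ℕ) / n)), (d p.1).aff_range (ex_ne hn2 _), ?_, ?_⟩, ?_, ?_, ?_, ?_⟩
    · rintro _ ⟨r, hr, rfl⟩
      exact ⟨_, by simpa using hb r hr, (ef p r).symm⟩
    · rintro _ ⟨r, hr, rfl⟩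
      rw [mem_ball]
      simp only
      rw [ef]
      refine hun _ _ (by simpa using hb r hr) _ (by rw [mem_closedBall_zero_iff, ex_norm]; norm_num) ?_
      rw [add_sub_cancel_left]
      exact seg_close hn hr
    · rw [ef0]; exact hPv _ _ (by omega)
    · rw [ef1]; exact hPv _ _ (by omega)
    · exact (d p.1).emb.isOpenMap _ isOpen_ball
    · rintro _ ⟨r, hr, rfl⟩
      refine ⟨_, ?_, (ef p r).symm⟩
      rw [mem_ball, dist_eq_norm, add_sub_cancel_left]
      exact (seg_close hn hr).trans_lt hn10
  obtain ⟨κ0, hκ0, D0, hD0, hDN0, hJ0⟩ := graph_list hP N hN _ hed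
  obtain ⟨κ, hκ, D, P', hP', hPP, hDJ, he0, he1, hoP, hDN, hG⟩ := graph_sub hP N hN hD0 hDN0
  have hJ : ∀ i, ∀ m < n, JoinedIn (Gam D P' ∩ (d i).f '' ball (ex (m / n)) (1 / 10)) ((d i).f (ex (m / n)))
      ((d i).f (ex ((m + 1 : ℕ) / n))) := by
    intro i m hm
    have h1 := hJ0 (ed (i, ⟨m, hm⟩)) (List.mem_map.2 ⟨_, Finset.mem_toList.2 (Finset.mem_univ _), rfl⟩)
    rw [ef0, ef1] at h1
    exact h1.mono (inter_subset_inter_left _ hG)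
  have harcE : ∀ k, ∃ a, arc (D k) ⊆ range (E a).f ∧ range (E a).f ⊆ range (D k).f := by
    intro k
    obtain ⟨i, x, h1, h2, h3⟩ := hDN k
    obtain ⟨a, ha⟩ := hL x trivial
    have h0 : (D k).f (0 : ℝ) ∈ arc (D k) := ⟨0, by simp, rfl⟩
    refine ⟨a, h3.trans ha, ?_⟩
    rw [h1]
    exact (hE a _ (ha (h3 h0))).trans (hlam1 i _ (h2 h0))
  have hcov2 : ∀ x, ∃ i, x ∈ (d i).f '' closedBall 0 2 := fun x => by
    obtain ⟨i, hi⟩ := hcov x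
    exact ⟨i, image_mono (ball_subset_closedBall.trans (closedBall_subset_closedBall (by norm_num))) hi⟩
  refine ⟨κ, t, s, hκ, inferInstance, inferInstance, D, P', d, E, ?_, hPP (Or.inl rfl)⟩
  refine ⟨hP', he0, he1, hoP, hDJ, hcov2, ?_, ?_, hcovE, ?_, harcE⟩
  · intro Q hQ hQΓ
    rcases Q.eq_empty_or_nonempty with rfl | ⟨x, hx⟩
    · exact ⟨(hcov z).choose, empty_subset _⟩
    · obtain ⟨i, hi⟩ := hcov x
      exact ⟨i, face_lem (d i) (isClosed_Gam hP') hn hn10.le (hJ i) hQ hQΓ hx hi⟩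
  · rintro k i ⟨p, hp, hpi⟩
    obtain ⟨a, ha, -⟩ := harcE k
    exact ha.trans ((hE a p (ha hp)).trans (hlam1 i p hpi))
  · rintro a b ⟨p, hpa, hpb⟩
    obtain ⟨i, hi⟩ := hcov2 p
    exact ⟨i, (hE a p hpa).trans (hlam1 i p hi), (hE b p hpb).trans (hlam1 i p hi)⟩

theorem main [ChartedSpace (EuclideanSpace ℝ (Fin 2)) M] [CompactSpace M]
    (Z : Set M) (hZcomp : IsCompact Z) (hZconn : IsConnected Z) (z : M) (hz : z ∈ Z) :
    ∃ ε₀ : ℝ, 0 < ε₀ ∧ ∀ ε : ℝ, 0 < ε → ε < ε₀ →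
      (∀ γ : Path z z, Set.range γ ⊆ Metric.thickening ε₀ Z →
        ∃ γ' : Path z z, Set.range γ' ⊆ Metric.thickening ε Z ∧ γ.Homotopic γ') ∧
      (∀ γ : Path z z, Set.range γ ⊆ Metric.thickening ε Z →
        ∃ γ' : Path z z, Set.range γ' ⊆ Metric.thickening ε₀ Z ∧ γ.Homotopic γ') := by
  obtain ⟨κ, ι, α, _, _, _, D, P, d, E, G, hP⟩ := exists_gr z
  obtain ⟨ρ, hρ, hT⟩ := TT_of_Gr G hZcomp hZconn ⟨z, hz, hP⟩
  obtain ⟨ε₀, h0, h⟩ := final_of_TT hρ hT hz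
  exact ⟨ε₀, h0, fun ε he hlt => ⟨h ε he hlt, fun γ hγ =>
    ⟨γ, hγ.trans (thickening_mono hlt.le _), .refl _⟩⟩⟩

end S14
end



/-- Let `M` be a closed (orientable) surface with a metric inducing its
topology, `Z ⊆ M` a compact connected subset and `z ∈ Z`. Then there is `ε₀ > 0` such
that for all `0 < ε < ε₀` the images of `π₁(Z_ε, z)` and `π₁(Z_{ε₀}, z)` in `π₁(M, z)`
coincide, where `Z_ε` is the open `ε`-neighborhood of `Z`. (Equality of the images is
expressed by saying that every loop at `z` contained in one neighborhood is homotopic,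
with fixed endpoints in `M`, to a loop at `z` contained in the other.) -/
theorem stmt_14 {M : Type*} [MetricSpace M] [CompactSpace M] [ConnectedSpace M]
    [ChartedSpace (EuclideanSpace ℝ (Fin 2)) M]
    (Z : Set M) (hZcomp : IsCompact Z) (hZconn : IsConnected Z) (z : M) (hz : z ∈ Z) :
    ∃ ε₀ : ℝ, 0 < ε₀ ∧ ∀ ε : ℝ, 0 < ε → ε < ε₀ →
      (∀ γ : Path z z, Set.range γ ⊆ Metric.thickening ε₀ Z →
        ∃ γ' : Path z z, Set.range γ' ⊆ Metric.thickening ε Z ∧ γ.Homotopic γ') ∧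
      (∀ γ : Path z z, Set.range γ ⊆ Metric.thickening ε Z →
        ∃ γ' : Path z z, Set.range γ' ⊆ Metric.thickening ε₀ Z ∧ γ.Homotopic γ') := by
  exact S14.main Z hZcomp hZconn z hz
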